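/- Let d be a positive integer and c, N > 0 real numbers. There exist constants k₀ ∈ ℕ and C > 0 depending only on N, c, d such that: for every 0 < ε < 1/2 and every polynomial p : ℝⁿ → ℝ of degree d with |p|₂ ≤ 1 satisfying Pr_X(‖∇p(X)‖₂ < ε) > ε^N, there exist an integer k ≤ k₀ and polynomials a₁, …, a_k, b₁, …, b_k : ℝⁿ → ℝ, each of degree strictly less than d, with deg(a_i) + deg(b_i) = d for each i, such that |a_i|₂·|b_i|₂ ≤ C·ε^{−c}·|p^{[d]}|₂ for every i, and |(p − Σ_{i=1}^k a_i·b_i)^{[d]}|₂ < C·ε^{1−c}. -/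

import Mathlib

open MeasureTheory ProbabilityTheory

/-- The standard Gaussian measure on `ℝⁿ`. -/
noncomputable def stdGaussian (n : ℕ) : Measure (Fin n → ℝ) :=
  Measure.pi fun _ => gaussianReal 0 1

/-- The Gaussian `L²` norm of a polynomial on `ℝⁿ`. -/
noncomputable def gaussL2 {n : ℕ} (p : MvPolynomial (Fin n) ℝ) : ℝ :=
  Real.sqrt (∫ x, (MvPolynomial.eval x p) ^ 2 ∂(stdGaussian n))

/-- The normalized multivariate Hermite function `H_a(x) = ∏ᵢ He_{aᵢ}(xᵢ)/√(aᵢ!)`,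
orthonormal for the standard Gaussian measure. -/
noncomputable def hermiteFun {n : ℕ} (a : Fin n → ℕ) (x : Fin n → ℝ) : ℝ :=
  ∏ i, Polynomial.aeval (x i) (Polynomial.hermite (a i)) / Real.sqrt (Nat.factorial (a i))

/-- The Hermite coefficient `c_a(p) = E[p(X) H_a(X)]`. -/
noncomputable def hermiteCoeff {n : ℕ} (p : MvPolynomial (Fin n) ℝ) (a : Fin n → ℕ) : ℝ :=
  ∫ x, MvPolynomial.eval x p * hermiteFun a x ∂(stdGaussian n)

/-- The Gaussian `L²` norm of the `k`-th harmonic component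
`p^{[k]} = ∑_{|a|₁ = k} c_a(p) H_a` of `p`; by orthonormality this equals
`(∑_{|a|₁ = k} c_a(p)²)^{1/2}`. -/
noncomputable def harmonicNorm {n : ℕ} (p : MvPolynomial (Fin n) ℝ) (k : ℕ) : ℝ :=
  Real.sqrt (∑ a ∈ Finset.Nat.antidiagonalTuple n k, (hermiteCoeff p a) ^ 2)

open Filter Topology
set_option linter.all false

/-- Standard Gaussian measure on a finite index type. -/
noncomputable abbrev gam (I : Type) [Fintype I] : Measure (I → ℝ) :=
  Measure.pi fun _ : I => gaussianReal 0 1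

/-- Product over slots of standard Gaussian measures. -/
noncomputable abbrev gamS (κ I : Type) [Fintype κ] [Fintype I] : Measure (κ → I → ℝ) :=
  Measure.pi fun _ : κ => gam I

section charfun
variable {I : Type} [Fintype I] [DecidableEq I] {κ : Type} [Fintype κ] [DecidableEq κ]

lemma charFunDual_gam (L : StrongDual ℝ (I → ℝ)) :
    charFunDual (gam I) L = Complex.exp (-(((∑ i, (L (Pi.single i 1)) ^ 2 : ℝ) : ℂ)) / 2) := by
  rw [charFunDual_pi]
  have : ∀ i, charFunDual (gaussianReal 0 1)
      (L.comp (ContinuousLinearMap.single ℝ (fun _ : I => ℝ) i)) =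
      Complex.exp (-(((L (Pi.single i 1)) ^ 2 : ℝ) : ℂ) / 2) := by
    intro i
    have e : L.comp (ContinuousLinearMap.single ℝ (fun _ : I => ℝ) i) =
       (L (Pi.single i 1)) • ContinuousLinearMap.id ℝ ℝ := by
      ext; simp
    rw [e, ← charFun_map_eq_charFunDual_smul]
    have : (Measure.map (⇑(ContinuousLinearMap.id ℝ ℝ)) (gaussianReal 0 1)) = gaussianReal 0 1 := by
      simp
    rw [this, charFun_gaussianReal]
    simp; ring_nf
  simp_rw [this]
  rw [← Complex.exp_sum]
  congr 1
  push_cast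
  rw [← Finset.sum_div, Finset.sum_neg_distrib]

lemma charFunDual_gamS (L : StrongDual ℝ (κ → I → ℝ)) :
    charFunDual (gamS κ I) L =
      Complex.exp (-(((∑ s, ∑ i, (L (Pi.single s (Pi.single i 1))) ^ 2 : ℝ) : ℂ)) / 2) := by
  rw [charFunDual_pi]
  simp_rw [charFunDual_gam]
  rw [← Complex.exp_sum]
  congr 1
  push_cast
  rw [← Finset.sum_div, Finset.sum_neg_distrib]
  rfl

/-- Two linear images of Gaussian measures agree if the covariance forms agree. -/
lemma gam_map_eq {A B : Type} [Fintype A] [Fintype B] [DecidableEq A] [DecidableEq B]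
    {E : Type} [Fintype E] (L₁ : (A → ℝ) →L[ℝ] (E → ℝ)) (L₂ : (B → ℝ) →L[ℝ] (E → ℝ))
    (h : ∀ L : StrongDual ℝ (E → ℝ), ∑ a, (L (L₁ (Pi.single a 1))) ^ 2 =
      ∑ b, (L (L₂ (Pi.single b 1))) ^ 2) :
    (gam A).map L₁ = (gam B).map L₂ := by
  apply Measure.ext_of_charFunDual
  ext L
  rw [charFunDual_map, charFunDual_map, charFunDual_gam, charFunDual_gam]
  simp only [ContinuousLinearMap.comp_apply]
  rw [h L]

/-- normalised sums of slots are Gaussian -/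
lemma gamS_map_sum (a : ℝ) (ha : a ^ 2 * Fintype.card κ = 1) :
    (gamS κ I).map (fun x => a • ∑ s, x s) = gam I := by
  let T : (κ → I → ℝ) →L[ℝ] (I → ℝ) := a • ∑ s, ContinuousLinearMap.proj s
  have hT : (fun x : κ → I → ℝ => a • ∑ s, x s) = T := by
    ext x; simp [T]
  rw [hT]
  apply Measure.ext_of_charFunDual
  ext L
  rw [charFunDual_map, charFunDual_gam, charFunDual_gamS]
  congr 4
  have : ∀ s i, (L.comp T) (Pi.single s (Pi.single i 1)) = a * L (Pi.single i 1) := by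
    intro s i
    have : T (Pi.single s (Pi.single i 1)) = a • Pi.single i 1 := by
      simp only [T, smul_apply, sum_apply,
        ContinuousLinearMap.proj_apply]
      congr 1
      rw [Finset.sum_eq_single s] <;> simp +contextual
    simp [this]
  simp_rw [this]
  simp only [mul_pow, ← Finset.mul_sum, Finset.sum_const, Finset.card_univ, nsmul_eq_mul]
  rw [← mul_assoc, ha, one_mul]

/-- law of a linear functional -/
lemma gam_map_inner (v : I → ℝ) :
    (gam I).map (fun y => ∑ i, v i * y i) =
      (gaussianReal 0 1).map (fun g => Real.sqrt (∑ i, v i ^ 2) * g) := by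
  let T : (I → ℝ) →L[ℝ] ℝ := ∑ i, v i • ContinuousLinearMap.proj i
  have hT : (fun y : I → ℝ => ∑ i, v i * y i) = T := by
    ext x; simp [T]
  let T2 : ℝ →L[ℝ] ℝ := Real.sqrt (∑ i, v i ^ 2) • ContinuousLinearMap.id ℝ ℝ
  have hT2 : (fun g : ℝ => Real.sqrt (∑ i, v i ^ 2) * g) = T2 := by
    ext x; simp [T2]
  rw [hT, hT2]
  apply Measure.ext_of_charFunDual
  ext L
  rw [charFunDual_map, charFunDual_map, charFunDual_gam]
  have : L.comp T2 = (Real.sqrt (∑ i, v i ^ 2) * L 1) • ContinuousLinearMap.id ℝ ℝ := by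
    ext; simp [T2]
  rw [this, ← charFun_map_eq_charFunDual_smul]
  have : (Measure.map (⇑(ContinuousLinearMap.id ℝ ℝ)) (gaussianReal 0 1)) = gaussianReal 0 1 := by
      simp
  rw [this, charFun_gaussianReal]
  have e : ∀ i, (L.comp T) (Pi.single i 1) = v i * L 1 := by
    intro i
    have : T (Pi.single i 1) = v i := by
      simp [T, Pi.single_apply]
    have h2 : L (v i) = v i * L 1 := by
      rw [← smul_eq_mul, ← map_smul]; simp
    simp [this, h2]
  simp_rw [e, mul_pow, ← Finset.sum_mul]
  congr 1
  simp only [Complex.ofReal_zero, mul_zero, zero_mul, zero_sub, NNReal.coe_one, Complex.ofReal_one, one_mul]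
  rw [← Complex.ofReal_pow, mul_pow, Real.sq_sqrt (by positivity)]
  ring

/-- rotation invariance -/
lemma gam_rot : MeasurePreserving
    (fun z : (I → ℝ) × (I → ℝ) =>
      ((Real.sqrt 2)⁻¹ • z.1 + (Real.sqrt 2)⁻¹ • z.2, (Real.sqrt 2)⁻¹ • z.1 - (Real.sqrt 2)⁻¹ • z.2))
    ((gam I).prod (gam I)) ((gam I).prod (gam I)) := by
  refine ⟨by fun_prop, ?_⟩
  let a : ℝ := (Real.sqrt 2)⁻¹
  have ha : a ^ 2 = 1/2 := by simp [a]
  let F := ContinuousLinearMap.fst ℝ (I → ℝ) (I → ℝ)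
  let S := ContinuousLinearMap.snd ℝ (I → ℝ) (I → ℝ)
  let T : (I → ℝ) × (I → ℝ) →L[ℝ] (I → ℝ) × (I → ℝ) :=
    (a • F + a • S).prod (a • F - a • S)
  have hT : (fun z : (I → ℝ) × (I → ℝ) =>
      ((Real.sqrt 2)⁻¹ • z.1 + (Real.sqrt 2)⁻¹ • z.2, (Real.sqrt 2)⁻¹ • z.1 - (Real.sqrt 2)⁻¹ • z.2)) = T := by
    ext x <;> simp [T, F, S, a]
  rw [hT]
  apply Measure.ext_of_charFunDual
  ext L
  rw [charFunDual_map, charFunDual_prod, charFunDual_prod]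
  simp_rw [charFunDual_gam, ← Complex.exp_add]
  congr 1
  rw [← add_div, ← add_div]
  congr 1
  rw [← neg_add, ← neg_add]
  congr 1
  rw [← Complex.ofReal_add, ← Complex.ofReal_add]
  congr 1
  rw [← Finset.sum_add_distrib, ← Finset.sum_add_distrib]
  refine Finset.sum_congr rfl fun i _ => ?_
  simp only [ContinuousLinearMap.comp_apply, ContinuousLinearMap.inl_apply, ContinuousLinearMap.inr_apply]
  set e := (Pi.single i 1 : I → ℝ)
  have h1 : T (e, 0) = a • (e, (0: I → ℝ)) + a • ((0: I → ℝ), e) := by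
    simp [T, F, S]
  have h2 : T (0, e) = a • (e, (0: I → ℝ)) - a • ((0: I → ℝ), e) := by
    simp [T, F, S]
  rw [h1, h2]
  simp only [map_add, map_sub, map_smul, smul_eq_mul]
  linear_combination (2 * L (e, 0)^2 + 2 * L (0, e)^2) * ha
end charfun

/-- Euclidean norm of a finite family. -/
noncomputable def nrm {K : Type} [Fintype K] (v : K → ℝ) : ℝ := Real.sqrt (∑ k, v k ^ 2)

section nrm
variable {K K' : Type} [Fintype K] [Fintype K']

lemma nrm_nonneg (v : K → ℝ) : 0 ≤ nrm v := Real.sqrt_nonneg _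
lemma nrm_sq (v : K → ℝ) : nrm v ^ 2 = ∑ k, v k ^ 2 :=
  Real.sq_sqrt (Finset.sum_nonneg fun _ _ => sq_nonneg _)
lemma nrm_eq_norm (v : K → ℝ) : nrm v = ‖(WithLp.toLp 2 v : EuclideanSpace ℝ K)‖ := by
  simp [nrm, EuclideanSpace.norm_eq]
lemma nrm_add_le (v w : K → ℝ) : nrm (v + w) ≤ nrm v + nrm w := by
  simp only [nrm_eq_norm, WithLp.toLp_add]; exact norm_add_le _ _
lemma nrm_sub_le (v w : K → ℝ) : nrm (v - w) ≤ nrm v + nrm w := by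
  simp only [nrm_eq_norm, WithLp.toLp_sub]; exact norm_sub_le _ _
lemma nrm_smul (a : ℝ) (v : K → ℝ) : nrm (a • v) = |a| * nrm v := by
  simp only [nrm_eq_norm, WithLp.toLp_smul, norm_smul, Real.norm_eq_abs]
@[simp] lemma nrm_zero : nrm (0 : K → ℝ) = 0 := by simp [nrm]
lemma nrm_eq_zero {v : K → ℝ} (h : nrm v = 0) : v = 0 := by
  rw [nrm_eq_norm, norm_eq_zero] at h
  simpa using h
lemma abs_le_nrm (v : K → ℝ) (k : K) : |v k| ≤ nrm v := by
  rw [nrm]; apply Real.le_sqrt_of_sq_le; rw [sq_abs]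
  exact Finset.single_le_sum (f := fun k => v k ^ 2) (fun _ _ => sq_nonneg _) (Finset.mem_univ k)
lemma nrm_sum_le {ι : Type} (s : Finset ι) (f : ι → K → ℝ) :
    nrm (∑ i ∈ s, f i) ≤ ∑ i ∈ s, nrm (f i) := by
  classical
  induction s using Finset.induction_on with
  | empty => simp
  | insert a s ha ih =>
    rw [Finset.sum_insert ha, Finset.sum_insert ha]
    exact (nrm_add_le _ _).trans (by linarith)
lemma nrm_comp_equiv (e : K' ≃ K) (v : K → ℝ) : nrm (fun k => v (e k)) = nrm v := by
  simp only [nrm]; congr 1; exact Equiv.sum_comp e (fun k => v k ^ 2)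
lemma nrm_mul (u : K → ℝ) (v : K' → ℝ) :
    nrm (fun z : K × K' => u z.1 * v z.2) = nrm u * nrm v := by
  simp only [nrm]
  rw [← Real.sqrt_mul (Finset.sum_nonneg fun _ _ => sq_nonneg _), Fintype.sum_prod_type,
    Finset.sum_mul_sum]
  congr 1
  simp [mul_pow]
lemma nrm_le_of_sq {v : K → ℝ} {b : ℝ} (hb : 0 ≤ b) (h : ∑ k, v k ^ 2 ≤ b ^ 2) : nrm v ≤ b := by
  rw [nrm]; exact Real.sqrt_le_left hb |>.mpr h
@[fun_prop] lemma continuous_nrm : Continuous (nrm : (K → ℝ) → ℝ) := by unfold nrm; fun_prop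
@[fun_prop] lemma measurable_nrm : Measurable (nrm : (K → ℝ) → ℝ) := continuous_nrm.measurable
end nrm

lemma mp_comp_inj {E : Type} [MeasurableSpace E] (μ : Measure E) [IsProbabilityMeasure μ]
    {α β : Type} [Fintype α] [Fintype β] (f : α → β) (hf : Function.Injective f) :
    MeasurePreserving (fun x : β → E => fun a => x (f a))
      (Measure.pi fun _ : β => μ) (Measure.pi fun _ : α => μ) := by
  classical
  refine ⟨by fun_prop, ?_⟩
  symm
  apply Measure.pi_eq
  intro s hs
  rw [Measure.map_apply (by fun_prop) (MeasurableSet.univ_pi hs)]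
  have : (fun x : β → E => fun a => x (f a)) ⁻¹' (Set.univ.pi s) =
      Set.univ.pi (fun b => ⋂ a, ⋂ (_ : f a = b), s a) := by
    ext x
    simp only [Set.mem_preimage, Set.mem_pi, Set.mem_univ, true_implies, Set.mem_iInter]
    constructor
    · rintro h b a rfl; exact h a
    · intro h a; exact h _ a rfl
  rw [this, Measure.pi_pi]
  have h2 : ∀ a, (⋂ a', ⋂ (_ : f a' = f a), s a') = s a := by
    intro a; ext z
    simp only [Set.mem_iInter]
    constructor
    · intro h; exact h a rfl
    · intro h a' ha'; rw [hf ha']; exact h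
  calc _ = ∏ b ∈ Finset.univ.image f, μ (⋂ a, ⋂ (_ : f a = b), s a) := by
        symm; apply Finset.prod_subset (Finset.subset_univ _)
        intro b _ hb
        have : (⋂ a, ⋂ (_ : f a = b), s a) = Set.univ := by
          apply Set.eq_univ_of_forall; intro z
          simp only [Set.mem_iInter]
          intro a ha; exact absurd (Finset.mem_image.mpr ⟨a, Finset.mem_univ _, ha⟩) hb
        rw [this, measure_univ]
    _ = _ := by
        rw [Finset.prod_image (fun a _ b _ h => hf h)]
        simp_rw [h2]

/-- glue a value at `none` -/
def ocons {κ E : Type} (y : E) (x : κ → E) : Option κ → E := fun o => o.elim y x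

@[simp] lemma ocons_none {κ E : Type} (y : E) (x : κ → E) : ocons y x none = y := rfl
@[simp] lemma ocons_some {κ E : Type} (y : E) (x : κ → E) (s : κ) : ocons y x (some s) = x s := rfl

lemma measurable_ocons {E κ : Type} [MeasurableSpace E] :
    Measurable (fun z : E × (κ → E) => ocons z.1 z.2) := by
  rw [measurable_pi_iff]
  intro o; cases o
  · exact measurable_fst
  · simp only [ocons_some]; fun_prop

lemma mp_ocons {E : Type} [MeasurableSpace E] (μ : Measure E) [IsProbabilityMeasure μ]
    {κ : Type} [Fintype κ] :
    MeasurePreserving (fun z : E × (κ → E) => ocons z.1 z.2)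
      (μ.prod (Measure.pi fun _ : κ => μ)) (Measure.pi fun _ : Option κ => μ) := by
  refine ⟨measurable_ocons, ?_⟩
  symm
  apply Measure.pi_eq
  intro s hs
  rw [Measure.map_apply measurable_ocons (MeasurableSet.univ_pi hs)]
  have : (fun z : E × (κ → E) => ocons z.1 z.2) ⁻¹' (Set.univ.pi s) =
      s none ×ˢ Set.univ.pi (fun b => s (some b)) := by
    ext z
    simp only [Set.mem_preimage, Set.mem_pi, Set.mem_univ, true_implies, Set.mem_prod]
    constructor
    · intro h; exact ⟨h none, fun b => h (some b)⟩
    · rintro ⟨h1, h2⟩ (_ | b)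
      · exact h1
      · exact h2 b
  rw [this, Measure.prod_prod, Measure.pi_pi, Fintype.prod_option]

section ev
variable {κ I J : Type} [Fintype κ] [DecidableEq κ] [Fintype I] [Fintype J]

/-- evaluation of a tensor at a tuple of vectors -/
noncomputable def ev (t : (κ → I) × J → ℝ) (x : κ → I → ℝ) (j : J) : ℝ :=
  ∑ i : κ → I, t (i, j) * ∏ s, x s (i s)

/-- matrix times vector -/
noncomputable def ap (t : I × J → ℝ) (y : I → ℝ) (j : J) : ℝ := ∑ i, t (i, j) * y i

/-- separate the `none` slot -/
def cur (t : (Option κ → I) × J → ℝ) : (κ → I) × (I × J) → ℝ :=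
  fun z => t (ocons z.2.1 z.1, z.2.2)

/-- the equivalence behind `cur` -/
def curE : (κ → I) × (I × J) ≃ (Option κ → I) × J where
  toFun z := (ocons z.2.1 z.1, z.2.2)
  invFun z := (fun s => z.1 (some s), (z.1 none, z.2))
  left_inv z := rfl
  right_inv z := by
    refine Prod.ext ?_ rfl
    funext o; cases o <;> rfl

lemma nrm_cur (t : (Option κ → I) × J → ℝ) : nrm (cur t) = nrm t :=
  nrm_comp_equiv curE t

lemma ev_ocons (t : (Option κ → I) × J → ℝ) (y : I → ℝ) (x : κ → I → ℝ) :
    ev t (ocons y x) = ap (ev (cur t) x) y := by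
  funext j
  simp only [ev, ap, Finset.sum_mul]
  rw [Finset.sum_comm, ← Fintype.sum_prod_type']
  let e : (κ → I) × I ≃ (Option κ → I) :=
    ⟨fun z => ocons z.2 z.1, fun z => (fun s => z (some s), z none), fun z => rfl,
     fun z => by funext o; cases o <;> rfl⟩
  rw [← Equiv.sum_comp e]
  refine Finset.sum_congr rfl fun z _ => ?_
  have he : e z = ocons z.2 z.1 := rfl
  rw [he, Fintype.prod_option]
  simp only [ocons_none, ocons_some, cur]
  ring

@[fun_prop] lemma continuous_ev (t : (κ → I) × J → ℝ) : Continuous (ev t) := by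
  unfold ev; fun_prop
@[fun_prop] lemma measurable_ev (t : (κ → I) × J → ℝ) : Measurable (ev t) := by
  unfold ev; fun_prop
@[fun_prop] lemma continuous_ap (t : I × J → ℝ) : Continuous (ap t) := by
  unfold ap; fun_prop

lemma ev_add (t t' : (κ → I) × J → ℝ) (x : κ → I → ℝ) : ev (t + t') x = ev t x + ev t' x := by
  funext j; simp [ev, add_mul, Finset.sum_add_distrib]
lemma ev_sub (t t' : (κ → I) × J → ℝ) (x : κ → I → ℝ) : ev (t - t') x = ev t x - ev t' x := by
  funext j; simp [ev, sub_mul, Finset.sum_sub_distrib]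
lemma ev_smul (a : ℝ) (t : (κ → I) × J → ℝ) (x : κ → I → ℝ) : ev (a • t) x = a • ev t x := by
  funext j; simp [ev, mul_assoc, Finset.mul_sum]
lemma ev_smul_right (a : ℝ) (t : (κ → I) × J → ℝ) (x : κ → I → ℝ) :
    ev t (a • x) = a ^ (Fintype.card κ) • ev t x := by
  funext j
  simp only [ev, Pi.smul_apply, smul_eq_mul, Finset.prod_mul_distrib, Finset.prod_const,
    Finset.card_univ, Finset.mul_sum]
  refine Finset.sum_congr rfl fun i _ => ?_
  ring
end ev

lemma exists_gauss_moment (q : ℕ) : ∃ C : ℝ, 0 < C ∧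
    ∫⁻ g, ENNReal.ofReal ((g ^ 2) ^ q) ∂(gaussianReal 0 1) ≤ ENNReal.ofReal C := by
  have h := (memLp_id_gaussianReal (μ := 0) (v := 1) ((2 * q : ℕ) : NNReal))
  have h2 : Integrable (fun g : ℝ => (g ^ 2) ^ q) (gaussianReal 0 1) := by
    have := h.integrable_norm_pow'
    refine this.congr (Filter.Eventually.of_forall fun g => ?_)
    simp [pow_mul]
  refine ⟨∫ g, (g ^ 2) ^ q ∂(gaussianReal 0 1) + 1, ?_, ?_⟩
  · have : 0 ≤ ∫ g, (g ^ 2) ^ q ∂(gaussianReal 0 1) := integral_nonneg fun g => by positivity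
    linarith
  · rw [← ofReal_integral_eq_lintegral_ofReal h2 (Filter.Eventually.of_forall fun g => by positivity)]
    apply ENNReal.ofReal_le_ofReal; linarith

/-- even Gaussian moment constant -/
noncomputable def mq (q : ℕ) : ℝ := (exists_gauss_moment q).choose
lemma mq_pos (q : ℕ) : 0 < mq q := (exists_gauss_moment q).choose_spec.1
lemma mq_spec (q : ℕ) : ∫⁻ g, ENNReal.ofReal ((g ^ 2) ^ q) ∂(gaussianReal 0 1) ≤ ENNReal.ofReal (mq q) :=
  (exists_gauss_moment q).choose_spec.2

lemma gauss_second : ∫⁻ g, ENNReal.ofReal (g ^ 2) ∂(gaussianReal 0 1) = 1 := by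
  have h := (memLp_id_gaussianReal (μ := 0) (v := 1) 2)
  have h2 : Integrable (fun g : ℝ => g ^ 2) (gaussianReal 0 1) := by
    exact MemLp.integrable_sq h
  rw [← ofReal_integral_eq_lintegral_ofReal h2 (Filter.Eventually.of_forall fun g => by positivity)]
  have := variance_eq_sub h
  rw [variance_id_gaussianReal] at this
  simp at this
  rw [← this]; simp

section mom
variable {κ I J : Type} [Fintype κ] [DecidableEq κ] [Fintype I] [Fintype J]

lemma lintegral_inner_pow (q : ℕ) (v : I → ℝ) :
    ∫⁻ y, ENNReal.ofReal (((∑ i, v i * y i) ^ 2) ^ q) ∂(gam I) =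
      ENNReal.ofReal ((nrm v ^ 2) ^ q) * ∫⁻ g, ENNReal.ofReal ((g ^ 2) ^ q) ∂(gaussianReal 0 1) := by
  classical
  have h1 : ∫⁻ y, ENNReal.ofReal (((∑ i, v i * y i) ^ 2) ^ q) ∂(gam I) =
      ∫⁻ z, ENNReal.ofReal ((z ^ 2) ^ q) ∂((gam I).map (fun y => ∑ i, v i * y i)) := by
    rw [lintegral_map (by fun_prop) (by fun_prop)]
  rw [h1, gam_map_inner, lintegral_map (by fun_prop) (by fun_prop), ← lintegral_const_mul _ (by fun_prop)]
  congr 1; funext g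
  rw [← ENNReal.ofReal_mul (by positivity)]
  congr 1
  rw [nrm, mul_pow, mul_pow]

lemma ap_moment (q : ℕ) (t : I × J → ℝ) :
    ∫⁻ y, ENNReal.ofReal ((nrm (ap t y) ^ 2) ^ q) ∂(gam I) ≤
      ENNReal.ofReal (mq q) * ENNReal.ofReal ((nrm t ^ 2) ^ q) := by
  rcases Nat.eq_zero_or_pos q with rfl | hq
  · simp only [pow_zero, ENNReal.ofReal_one, lintegral_const, measure_univ, mul_one]
    have := mq_spec 0
    simpa using this
  let v : J → I → ℝ := fun j i => t (i, j)
  have hv : ∑ j, nrm (v j) ^ 2 = nrm t ^ 2 := by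
    simp only [nrm_sq, v, Fintype.sum_prod_type]
    rw [Finset.sum_comm]
  have hap : ∀ y j, ap t y j = ∑ i, v j i * y i := fun y j => rfl
  by_cases h0 : nrm t = 0
  · have : t = 0 := nrm_eq_zero h0
    subst this
    have : ∀ y, ap (0 : I × J → ℝ) y = 0 := by intro y; funext j; simp [ap]
    simp [this, hq.ne']
  have hT : 0 < nrm t ^ 2 := by positivity
  let w : J → ℝ := fun j => nrm (v j) ^ 2 / nrm t ^ 2
  have hw : ∑ j, w j = 1 := by simp only [w, ← Finset.sum_div, hv]; field_simp
  let z : (I → ℝ) → J → ℝ := fun y j => (∑ i, v j i * y i) ^ 2 / nrm (v j) ^ 2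
  have hz : ∀ y j, nrm (v j) ^ 2 * z y j = (∑ i, v j i * y i) ^ 2 := by
    intro y j
    by_cases h : nrm (v j) = 0
    · have : v j = 0 := nrm_eq_zero h
      simp [this]
    · simp only [z]; field_simp
  have key : ∀ y, (nrm (ap t y) ^ 2) ^ q ≤ (nrm t ^ 2) ^ q * ∑ j, w j * z y j ^ q := by
    intro y
    have e1 : nrm (ap t y) ^ 2 = nrm t ^ 2 * ∑ j, w j * z y j := by
      rw [nrm_sq, Finset.mul_sum]
      refine Finset.sum_congr rfl fun j _ => ?_
      rw [hap, ← hz]; simp only [w]; field_simp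
    rw [e1, mul_pow]
    gcongr
    exact Real.pow_arith_mean_le_arith_mean_pow _ _ _ (fun j _ => by positivity) hw
      (fun j _ => by positivity) q
  calc _ ≤ ∫⁻ y, ENNReal.ofReal ((nrm t ^ 2) ^ q) * ∑ j, ENNReal.ofReal (w j) * ENNReal.ofReal (z y j ^ q) ∂(gam I) := by
        apply lintegral_mono; intro y
        refine (ENNReal.ofReal_le_ofReal (key y)).trans (le_of_eq ?_)
        rw [ENNReal.ofReal_mul (by positivity), ENNReal.ofReal_sum_of_nonneg (fun j _ => by positivity)]
        congr 1
        refine Finset.sum_congr rfl fun j _ => ?_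
        rw [ENNReal.ofReal_mul (by positivity)]
    _ = ENNReal.ofReal ((nrm t ^ 2) ^ q) * ∑ j, ENNReal.ofReal (w j) * ∫⁻ y, ENNReal.ofReal (z y j ^ q) ∂(gam I) := by
        rw [lintegral_const_mul _ (by fun_prop)]
        congr 1
        rw [lintegral_finsetSum _ (fun j _ => by fun_prop)]
        refine Finset.sum_congr rfl fun j _ => ?_
        rw [lintegral_const_mul _ (by fun_prop)]
    _ ≤ ENNReal.ofReal ((nrm t ^ 2) ^ q) * ∑ j, ENNReal.ofReal (w j) * ENNReal.ofReal (mq q) := by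
        gcongr with j
        by_cases h : nrm (v j) = 0
        · have : v j = 0 := nrm_eq_zero h
          simp [z, this, hq.ne']
        · have e : ∀ y, ENNReal.ofReal (z y j ^ q) = ENNReal.ofReal (((nrm (v j) ^ 2) ^ q)⁻¹) * ENNReal.ofReal (((∑ i, v j i * y i) ^ 2) ^ q) := by
            intro y
            rw [← ENNReal.ofReal_mul (by positivity)]
            congr 1; simp only [z, div_pow]; field_simp
          simp_rw [e]
          rw [lintegral_const_mul _ (by fun_prop), lintegral_inner_pow, ← mul_assoc,
            ← ENNReal.ofReal_mul (by positivity), inv_mul_cancel₀ (by positivity)]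
          simpa using mq_spec q
    _ = _ := by
        rw [← Finset.sum_mul, ← ENNReal.ofReal_sum_of_nonneg (fun j _ => by positivity), hw]
        simp [mul_comm]

lemma ap_second (t : I × J → ℝ) :
    ∫⁻ y, ENNReal.ofReal (nrm (ap t y) ^ 2) ∂(gam I) = ENNReal.ofReal (nrm t ^ 2) := by
  have e : ∀ y, ENNReal.ofReal (nrm (ap t y) ^ 2) = ∑ j, ENNReal.ofReal ((∑ i, t (i, j) * y i) ^ 2) := by
    intro y
    rw [nrm_sq, ENNReal.ofReal_sum_of_nonneg (fun j _ => by positivity)]; rfl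
  simp_rw [e]
  rw [lintegral_finsetSum _ (fun j _ => by fun_prop)]
  have : ∀ j, ∫⁻ y, ENNReal.ofReal ((∑ i, t (i, j) * y i) ^ 2) ∂(gam I) = ENNReal.ofReal (∑ i, t (i, j) ^ 2) := by
    intro j
    have := lintegral_inner_pow 1 (fun i => t (i, j))
    simp only [pow_one] at this
    rw [this, gauss_second, mul_one, nrm_sq]
  simp_rw [this]
  rw [← ENNReal.ofReal_sum_of_nonneg (fun j _ => by positivity), nrm_sq, Fintype.sum_prod_type, Finset.sum_comm]

/-- reindexing of slots -/
lemma ev_equiv {α β : Type} [Fintype α] [Fintype β] [DecidableEq α] [DecidableEq β] (e : α ≃ β)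
    (t : (β → I) × J → ℝ) (x : β → I → ℝ) :
    ev t x = ev (fun z : (α → I) × J => t (fun b => z.1 (e.symm b), z.2)) (fun a => x (e a)) := by
  funext j
  simp only [ev]
  rw [← Equiv.sum_comp (e.arrowCongr (Equiv.refl I))]
  refine Finset.sum_congr rfl fun i _ => ?_
  congr 1
  rw [← Equiv.prod_comp e]
  simp

lemma nrm_reindex {α β : Type} [Fintype α] [Fintype β] [DecidableEq α] [DecidableEq β] (e : α ≃ β)
    (t : (β → I) × J → ℝ) :
    nrm (fun z : (α → I) × J => t (fun b => z.1 (e.symm b), z.2)) = nrm t :=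
  nrm_comp_equiv ((e.arrowCongr (Equiv.refl I)).prodCongr (Equiv.refl J)) t

lemma slot_induction (P : ∀ (κ : Type) [Fintype κ] [DecidableEq κ], Prop)
    (hequiv : ∀ (α β : Type) [Fintype α] [DecidableEq α] [Fintype β] [DecidableEq β], α ≃ β → P α → P β)
    (h0 : P Empty) (hs : ∀ (α : Type) [Fintype α] [DecidableEq α], P α → P (Option α))
    (κ : Type) [Fintype κ] [DecidableEq κ] : P κ := by
  have h : ∀ m, P (Fin m) := by
    intro m; induction m with
    | zero => exact hequiv Empty (Fin 0) (Equiv.equivOfIsEmpty _ _) h0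
    | succ m ih => exact hequiv (Option (Fin m)) (Fin (m+1)) (finSuccEquiv m).symm (hs _ ih)
  exact hequiv _ _ (Fintype.equivFin κ).symm (h _)

lemma ev_empty (t : (Empty → I) × J → ℝ) (x : Empty → I → ℝ) : nrm (ev t x) = nrm t := by
  simp only [nrm, ev, Fintype.sum_prod_type]
  simp

theorem ev_moment (q : ℕ) (κ : Type) [Fintype κ] [DecidableEq κ] : ∀ (I J : Type) [Fintype I] [Fintype J] (t : (κ → I) × J → ℝ),
    ∫⁻ x, ENNReal.ofReal ((nrm (ev t x) ^ 2) ^ q) ∂(gamS κ I) ≤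
      ENNReal.ofReal (mq q ^ Fintype.card κ) * ENNReal.ofReal ((nrm t ^ 2) ^ q) := by
  refine slot_induction (fun κ _ _ => ∀ (I J : Type) [Fintype I] [Fintype J] (t : (κ → I) × J → ℝ),
    ∫⁻ x, ENNReal.ofReal ((nrm (ev t x) ^ 2) ^ q) ∂(gamS κ I) ≤
      ENNReal.ofReal (mq q ^ Fintype.card κ) * ENNReal.ofReal ((nrm t ^ 2) ^ q)) ?_ ?_ ?_ κ
  · intro α β _ _ _ _ e ih I J _ _ t
    have := ih I J (fun z : (α → I) × J => t (fun b => z.1 (e.symm b), z.2))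
    rw [nrm_reindex e t, Fintype.card_congr e] at this
    refine le_trans (le_of_eq ?_) this
    simp_rw [ev_equiv e t]
    exact ((mp_comp_inj (gam I) e e.injective).lintegral_comp (f := fun x => ENNReal.ofReal ((nrm (ev (fun z : (α → I) × J => t (fun b => z.1 (e.symm b), z.2)) x) ^ 2) ^ q)) (by fun_prop))
  · intro I J _ _ t
    simp_rw [ev_empty]
    simp
  · intro κ _ _ ih I J _ _ t
    rw [← (mp_ocons (gam I) (κ := κ)).lintegral_comp (by fun_prop)]
    simp_rw [ev_ocons]
    rw [lintegral_prod_symm _ (by apply Measurable.aemeasurable; unfold ap; fun_prop)]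
    calc _ ≤ ∫⁻ x, ENNReal.ofReal (mq q) * ENNReal.ofReal ((nrm (ev (cur t) x) ^ 2) ^ q) ∂(gamS κ I) :=
          lintegral_mono fun x => ap_moment q _
      _ = ENNReal.ofReal (mq q) * ∫⁻ x, ENNReal.ofReal ((nrm (ev (cur t) x) ^ 2) ^ q) ∂(gamS κ I) :=
          lintegral_const_mul _ (by fun_prop)
      _ ≤ ENNReal.ofReal (mq q) * (ENNReal.ofReal (mq q ^ Fintype.card κ) * ENNReal.ofReal ((nrm (cur t) ^ 2) ^ q)) := by
          gcongr; exact ih _ _ _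
      _ = _ := by
          rw [nrm_cur, ← mul_assoc, ← ENNReal.ofReal_mul (mq_pos q).le, Fintype.card_option, pow_succ' (mq q)]

theorem ev_second (κ : Type) [Fintype κ] [DecidableEq κ] : ∀ (I J : Type) [Fintype I] [Fintype J] (t : (κ → I) × J → ℝ),
    ∫⁻ x, ENNReal.ofReal (nrm (ev t x) ^ 2) ∂(gamS κ I) = ENNReal.ofReal (nrm t ^ 2) := by
  refine slot_induction (fun κ _ _ => ∀ (I J : Type) [Fintype I] [Fintype J] (t : (κ → I) × J → ℝ),
    ∫⁻ x, ENNReal.ofReal (nrm (ev t x) ^ 2) ∂(gamS κ I) = ENNReal.ofReal (nrm t ^ 2)) ?_ ?_ ?_ κ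
  · intro α β _ _ _ _ e ih I J _ _ t
    have := ih I J (fun z : (α → I) × J => t (fun b => z.1 (e.symm b), z.2))
    rw [nrm_reindex e t] at this
    rw [← this]
    simp_rw [ev_equiv e t]
    exact ((mp_comp_inj (gam I) e e.injective).lintegral_comp (f := fun x => ENNReal.ofReal (nrm (ev (fun z : (α → I) × J => t (fun b => z.1 (e.symm b), z.2)) x) ^ 2)) (by fun_prop))
  · intro I J _ _ t
    simp_rw [ev_empty]
    simp
  · intro κ _ _ ih I J _ _ t
    rw [← (mp_ocons (gam I) (κ := κ)).lintegral_comp (by fun_prop)]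
    simp_rw [ev_ocons]
    rw [lintegral_prod_symm _ (by apply Measurable.aemeasurable; unfold ap; fun_prop)]
    simp_rw [ap_second]
    rw [ih, nrm_cur]
end mom

section gen
variable {Ω : Type} [MeasurableSpace Ω] (μ : Measure Ω) [IsProbabilityMeasure μ]

lemma markov {f : Ω → ℝ} (hf : Measurable f) {B L : ℝ} (hB : 0 ≤ B) (hL : 0 < L)
    (h : ∫⁻ x, ENNReal.ofReal (f x) ∂μ ≤ ENNReal.ofReal B) : μ.real {x | L ≤ f x} ≤ B / L := by
  have := mul_meas_ge_le_lintegral (μ := μ) (f := fun x => ENNReal.ofReal (f x)) (by fun_prop) (ENNReal.ofReal L)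
  have e : {x | ENNReal.ofReal L ≤ ENNReal.ofReal (f x)} = {x | L ≤ f x} := by
    ext x; simp only [Set.mem_setOf_eq]; rw [ENNReal.ofReal_le_ofReal_iff']; exact ⟨fun h => h.resolve_right (by linarith), Or.inl⟩
  rw [e] at this
  rw [le_div_iff₀ hL, mul_comm]
  have h2 := (this.trans h)
  have := ENNReal.toReal_mono ENNReal.ofReal_ne_top h2
  rwa [ENNReal.toReal_mul, ENNReal.toReal_ofReal hL.le, ENNReal.toReal_ofReal hB] at this

lemma paley_zygmund {f : Ω → ℝ} (hf : Measurable f) (h0 : ∀ x, 0 ≤ f x) {A K : ℝ} (hA : 0 < A)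
    (hK : 0 < K) (h1 : ∫⁻ x, ENNReal.ofReal (f x) ∂μ = ENNReal.ofReal A)
    (h2 : ∫⁻ x, ENNReal.ofReal (f x ^ 2) ∂μ ≤ ENNReal.ofReal (K * A ^ 2)) :
    1 / (4 * K) ≤ μ.real {x | A / 2 ≤ f x} := by
  have i1 : Integrable f μ := by
    refine ⟨hf.aestronglyMeasurable, ?_⟩
    rw [hasFiniteIntegral_iff_ofReal (Filter.Eventually.of_forall h0), h1]
    exact ENNReal.ofReal_lt_top
  have i2 : Integrable (fun x => f x ^ 2) μ := by
    refine ⟨by fun_prop, ?_⟩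
    rw [hasFiniteIntegral_iff_ofReal (Filter.Eventually.of_forall fun x => sq_nonneg _)]
    exact h2.trans_lt ENNReal.ofReal_lt_top
  have e1 : ∫ x, f x ∂μ = A := by
    rw [integral_eq_lintegral_of_nonneg_ae (Filter.Eventually.of_forall h0) hf.aestronglyMeasurable, h1,
      ENNReal.toReal_ofReal hA.le]
  have e2 : ∫ x, f x ^ 2 ∂μ ≤ K * A ^ 2 := by
    rw [integral_eq_lintegral_of_nonneg_ae (Filter.Eventually.of_forall fun x => sq_nonneg _) (by fun_prop)]
    have := ENNReal.toReal_mono ENNReal.ofReal_ne_top h2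
    rwa [ENNReal.toReal_ofReal (by positivity)] at this
  set S := {x | A / 2 ≤ f x}
  have hS : MeasurableSet S := measurableSet_le measurable_const hf
  have key : ∀ x, f x ≤ A / 2 + (1 / (4 * K * A)) * f x ^ 2 + (K * A) * S.indicator 1 x := by
    intro x
    by_cases hx : x ∈ S
    · simp only [Set.indicator_of_mem hx, Pi.one_apply, mul_one]
      have : 0 ≤ (1 / (4 * K * A)) * (f x - 2 * K * A) ^ 2 := by positivity
      have e : (1 / (4 * K * A)) * (f x - 2 * K * A) ^ 2 = (1 / (4 * K * A)) * f x ^ 2 - f x + K * A := by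
        field_simp; ring
      linarith
    · simp only [Set.indicator_of_notMem hx, mul_zero, add_zero]
      have : f x < A / 2 := by simpa [S] using hx
      have : 0 ≤ (1 / (4 * K * A)) * f x ^ 2 := by positivity
      linarith
  have i3 : Integrable (S.indicator (1 : Ω → ℝ)) μ := (integrable_const (1:ℝ)).indicator hS
  have j1 : Integrable (fun x => A / 2 + (1 / (4 * K * A)) * f x ^ 2) μ := (integrable_const (A/2)).add (i2.const_mul (1 / (4 * K * A)))
  have j2 : Integrable (fun x => A / 2 + (1 / (4 * K * A)) * f x ^ 2 + (K * A) * S.indicator 1 x) μ := j1.add (i3.const_mul (K * A))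
  have := integral_mono i1 j2 key
  rw [integral_add j1 (i3.const_mul _),
    integral_add (integrable_const _) (i2.const_mul _), integral_const_mul, integral_const_mul,
    integral_indicator_one hS, e1] at this
  simp only [integral_const, probReal_univ, smul_eq_mul, one_mul] at this
  have h3 : (1 / (4 * K * A)) * ∫ x, f x ^ 2 ∂μ ≤ (1 / (4 * K * A)) * (K * A ^ 2) := by gcongr
  have e4 : (1 / (4 * K * A)) * (K * A ^ 2) = A / 4 := by field_simp
  have h5 : A / 4 ≤ K * A * μ.real S := by linarith
  rw [div_le_iff₀ (by positivity)]
  nlinarith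

lemma jensen_sq {f : Ω → ENNReal} (hf : Measurable f) : (∫⁻ x, f x ∂μ) ^ 2 ≤ ∫⁻ x, f x ^ 2 ∂μ := by
  have := ENNReal.lintegral_mul_le_Lp_mul_Lq μ (p := 2) (q := 2) ⟨by norm_num, by norm_num, by norm_num⟩
    hf.aemeasurable (measurable_const (a := (1 : ENNReal))).aemeasurable
  simp at this
  calc (∫⁻ x, f x ∂μ) ^ 2 ≤ ((∫⁻ (a : Ω), f a ^ (2:ℕ) ∂μ) ^ (2:ℝ)⁻¹) ^ 2 := by gcongr
    _ = _ := by
      rw [← ENNReal.rpow_natCast, ← ENNReal.rpow_mul]; norm_num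

lemma jensen_pow (m : ℕ) {f : Ω → ENNReal} (hf : Measurable f) :
    (∫⁻ x, f x ∂μ) ^ (2 ^ m) ≤ ∫⁻ x, f x ^ (2 ^ m) ∂μ := by
  induction m generalizing f with
  | zero => simp
  | succ m ih =>
    have := ih (f := fun x => f x ^ 2) (by fun_prop)
    simp only [pow_succ' 2 m, pow_mul]
    refine le_trans ?_ this
    gcongr
    exact jensen_sq μ hf

/-- Fubini choice -/
lemma fubini_choice {Y : Type} [MeasurableSpace Y] (ν : Measure Y) [IsProbabilityMeasure ν]
    {S : Set (Ω × Y)} (hS : MeasurableSet S) {p δ : ℝ} (hp : 0 < p) (hδ : 0 < δ)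
    (h : δ ≤ μ.real {x | p ≤ ν.real {y | (x, y) ∈ S}}) : ∃ y, p * δ ≤ μ.real {x | (x, y) ∈ S} := by
  by_contra hcon
  push Not at hcon
  have h1 : (μ.prod ν).real S < p * δ := by
    have e : (μ.prod ν) S = ∫⁻ y, μ {x | (x, y) ∈ S} ∂ν := Measure.prod_apply_symm hS
    have hlt : ∫⁻ y, μ {x | (x, y) ∈ S} ∂ν < ∫⁻ y, ENNReal.ofReal (p * δ) ∂ν := by
      apply lintegral_strict_mono (IsProbabilityMeasure.ne_zero ν) (by fun_prop)
      · rw [← e]; exact measure_ne_top _ _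
      · refine Filter.Eventually.of_forall fun y => ?_
        rw [ENNReal.lt_ofReal_iff_toReal_lt (measure_ne_top _ _)]
        exact hcon y
    rw [← e] at hlt
    simp only [lintegral_const, measure_univ, mul_one] at hlt
    rwa [ENNReal.lt_ofReal_iff_toReal_lt (measure_ne_top _ _)] at hlt
  have h2 : p * δ ≤ (μ.prod ν).real S := by
    have e : (μ.prod ν) S = ∫⁻ x, ν {y | (x, y) ∈ S} ∂μ := Measure.prod_apply hS
    have := mul_meas_ge_le_lintegral (μ := μ) (f := fun x => ν {y | (x, y) ∈ S})
      (measurable_measure_prodMk_left hS) (ENNReal.ofReal p)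
    rw [← e] at this
    have e2 : {x | ENNReal.ofReal p ≤ ν {y | (x, y) ∈ S}} = {x | p ≤ ν.real {y | (x, y) ∈ S}} := by
      ext x; exact ENNReal.ofReal_le_iff_le_toReal (measure_ne_top _ _)
    rw [e2] at this
    have := ENNReal.toReal_mono (measure_ne_top _ _) this
    rw [ENNReal.toReal_mul, ENNReal.toReal_ofReal hp.le] at this
    refine le_trans ?_ this
    gcongr
    exact h
  linarith

/-- union bound -/
lemma inter_ge {S T : Set Ω} (hT : MeasurableSet T) {a b : ℝ} (hS : a ≤ μ.real S) (hTb : μ.real Tᶜ ≤ b) :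
    a - b ≤ μ.real (S ∩ T) := by
  have := measureReal_inter_add_diff (μ := μ) (s := S) hT
  have h2 : μ.real (S \ T) ≤ μ.real Tᶜ := measureReal_mono (fun x hx => hx.2)
  linarith

/-- pigeonhole over a finite index set -/
lemma pigeon {ι : Type} (s : Finset ι) {G : Set Ω} (A : ι → Set Ω) (h : G ⊆ ⋃ i ∈ s, A i)
    {a : ℝ} (ha : 0 < a) (hG : a ≤ μ.real G) : ∃ i ∈ s, a / s.card ≤ μ.real (A i ∩ G) := by
  have hle : μ.real G ≤ ∑ i ∈ s, μ.real (A i ∩ G) := by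
    refine (measureReal_mono ?_ (measure_ne_top _ _)).trans (measureReal_biUnion_finset_le s (fun i => A i ∩ G))
    intro x hx
    have := h hx
    simp only [Set.mem_iUnion] at this ⊢
    obtain ⟨i, hi, hxi⟩ := this
    exact ⟨i, hi, hxi, hx⟩
  have hs : s.Nonempty := by
    by_contra hs
    rw [Finset.not_nonempty_iff_eq_empty] at hs
    subst hs
    simp at hle; linarith
  by_contra hcon
  push Not at hcon
  have := Finset.sum_lt_sum_of_nonempty hs hcon
  rw [Finset.sum_const, nsmul_eq_mul] at this
  have hc : (s.card : ℝ) ≠ 0 := by exact_mod_cast hs.card_pos.ne'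
  rw [mul_div_cancel₀ _ hc] at this
  linarith

/-- pigeonhole for bounded real-valued functions -/
lemma pigeon_real {ι : Type} [Fintype ι] [DecidableEq ι] {G : Set Ω} (f : Ω → ι → ℝ) {L w a : ℝ}
    (hw : 0 < w) (ha : 0 < a) (hf : ∀ x ∈ G, ∀ i, |f x i| ≤ L) (hL : 0 ≤ L) (hG : a ≤ μ.real G) :
    ∃ x₀ ∈ G, a / (2 * (L / w) + 3) ^ (Fintype.card ι) ≤ μ.real ({x | ∀ i, |f x i - f x₀ i| ≤ w} ∩ G) := by
  let K : ℤ := ⌊L / w⌋ + 1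
  have hK : 0 ≤ ⌊L / w⌋ := Int.floor_nonneg.mpr (by positivity)
  let s : Finset (ι → ℤ) := Fintype.piFinset fun _ => Finset.Icc (-K) (K)
  let A : (ι → ℤ) → Set Ω := fun z => {x | ∀ i, ⌊f x i / w⌋ = z i}
  obtain ⟨z, hz, hz2⟩ := pigeon μ s (G := G) A (by
    intro x hx
    simp only [Set.mem_iUnion]
    refine ⟨fun i => ⌊f x i / w⌋, ?_, fun i => rfl⟩
    simp only [s, Fintype.mem_piFinset, Finset.mem_Icc]
    intro i
    have := abs_le.mp (hf x hx i)
    have h2 : f x i / w ≤ L / w := by gcongr; exact this.2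
    have h1 : -(L / w) ≤ f x i / w := by rw [← neg_div]; gcongr; exact this.1
    constructor
    · rw [Int.le_floor]
      have := Int.lt_floor_add_one (L / w)
      push_cast [K]; linarith
    · have := Int.floor_le_floor h2
      simp only [K]; omega) ha hG
  have hcard : (s.card : ℝ) ≤ (2 * (L / w) + 3) ^ (Fintype.card ι) := by
    simp only [s, Fintype.card_piFinset, Finset.prod_const, Finset.card_univ, Int.card_Icc]
    push_cast
    gcongr
    have h3 : (((K + 1 - -K).toNat : ℤ) : ℝ) = ((K + 1 - -K : ℤ) : ℝ) := by
      rw [Int.toNat_of_nonneg]; simp only [K]; omega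
    have h4 : (((K + 1 - -K).toNat : ℕ) : ℝ) = ((K + 1 - -K : ℤ) : ℝ) := by exact_mod_cast h3
    rw [h4]
    have := Int.floor_le (L / w)
    push_cast [K]; linarith
  have hc0 : 0 < (s.card : ℝ) := by exact_mod_cast Finset.card_pos.mpr ⟨z, hz⟩
  have hpos : 0 < μ.real (A z ∩ G) := lt_of_lt_of_le (by positivity) hz2
  obtain ⟨x₀, hx₀⟩ : (A z ∩ G).Nonempty := by
    by_contra hne
    rw [Set.not_nonempty_iff_eq_empty] at hne
    rw [hne] at hpos; simp at hpos
  refine ⟨x₀, hx₀.2, ?_⟩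
  refine le_trans (le_trans ?_ hz2) (measureReal_mono ?_)
  · gcongr
  · rintro x ⟨hx1, hx2⟩
    refine ⟨fun i => ?_, hx2⟩
    have : ⌊f x i / w⌋ = ⌊f x₀ i / w⌋ := (hx1 i).trans (hx₀.1 i).symm
    have := (Int.abs_sub_lt_one_of_floor_eq_floor this).le
    rw [← sub_div, abs_div, abs_of_pos hw, div_le_one hw] at this
    exact this
end gen

/-- sign of a boolean -/
def sg (b : Bool) : ℝ := if b then 1 else -1
/-- the constant `1/√2` -/
noncomputable def ra : ℝ := (Real.sqrt 2)⁻¹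
lemma ra_pos : 0 < ra := by unfold ra; positivity
lemma ra_sq : ra ^ 2 = 1 / 2 := by simp [ra]
lemma ra_le : ra ≤ 1 := by
  have := ra_sq; have := ra_pos; nlinarith

/-- vertices of the random cube -/
noncomputable def vert {κ I : Type} (c x : κ → I → ℝ) (ω : κ → Bool) : κ → I → ℝ :=
  fun s => ra • c s + (sg (ω s) * ra) • x s

section cube
variable {κ I : Type} [Fintype κ] [Fintype I]

lemma measurable_vert (ω : κ → Bool) : Measurable (fun z : (κ → I → ℝ) × (κ → I → ℝ) => vert z.1 z.2 ω) := by
  unfold vert; fun_prop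

/-- the set of cubes in `G` -/
def cubeSet (G : Set (κ → I → ℝ)) : Set ((κ → I → ℝ) × (κ → I → ℝ)) :=
  {z | ∀ ω, vert z.1 z.2 ω ∈ G}

lemma measurableSet_cubeSet {G : Set (κ → I → ℝ)} (hG : MeasurableSet G) : MeasurableSet (cubeSet G) := by
  classical
  rw [cubeSet, Set.setOf_forall]
  exact MeasurableSet.iInter fun ω => measurable_vert ω hG

lemma reorder {E Ω : Type} [MeasurableSpace E] [MeasurableSpace Ω] (μ : Measure E) (ν : Measure Ω)
    [IsProbabilityMeasure μ] [IsProbabilityMeasure ν] {F : (E × Ω) × (E × Ω) → ENNReal} (hF : Measurable F) :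
    ∫⁻ z, F z ∂((μ.prod ν).prod (μ.prod ν)) =
      ∫⁻ p, ∫⁻ q, F ((p.1, q.1), (p.2, q.2)) ∂(ν.prod ν) ∂(μ.prod μ) := by
  rw [lintegral_prod _ hF.aemeasurable, lintegral_prod _ (by fun_prop), lintegral_prod _ (by fun_prop)]
  refine lintegral_congr fun c => ?_
  have h1 : ∀ c', ∫⁻ q, F ((c, c'), q) ∂(μ.prod ν) = ∫⁻ y, ∫⁻ x, F ((c, c'), (y, x)) ∂ν ∂μ := fun c' =>
    lintegral_prod _ (by fun_prop)
  have h2 : ∀ y, ∫⁻ q, F ((c, q.1), (y, q.2)) ∂(ν.prod ν) = ∫⁻ c', ∫⁻ x, F ((c, c'), (y, x)) ∂ν ∂ν := fun c' =>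
    lintegral_prod _ (by fun_prop)
  simp only [h1, h2]
  rw [lintegral_lintegral_swap]
  apply Measurable.aemeasurable
  fun_prop

lemma vert_ocons (c y : I → ℝ) (c' x' : κ → I → ℝ) (ω : Option κ → Bool) :
    vert (ocons c c') (ocons y x') ω =
      ocons (ra • c + (sg (ω none) * ra) • y) (vert c' x' (fun s => ω (some s))) := by
  funext o; cases o <;> rfl
end cube

theorem cube (κ : Type) [Fintype κ] [DecidableEq κ] : ∀ (I : Type) [Fintype I] (G : Set (κ → I → ℝ)),
    MeasurableSet G → (gamS κ I G) ^ (2 ^ Fintype.card κ) ≤ ((gamS κ I).prod (gamS κ I)) (cubeSet G) := by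
  refine slot_induction (fun κ _ _ => ∀ (I : Type) [Fintype I] (G : Set (κ → I → ℝ)),
    MeasurableSet G → (gamS κ I G) ^ (2 ^ Fintype.card κ) ≤ ((gamS κ I).prod (gamS κ I)) (cubeSet G)) ?_ ?_ ?_ κ
  · intro α β _ _ _ _ e ih I _ G hG
    have mp := mp_comp_inj (gam I) e e.injective
    have mp' := mp_comp_inj (gam I) e.symm e.symm.injective
    have h := ih I ((fun x : α → I → ℝ => fun b => x (e.symm b)) ⁻¹' G) (mp'.measurable hG)
    rw [mp'.measure_preimage hG.nullMeasurableSet] at h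
    rw [← Fintype.card_congr e]
    refine h.trans (le_of_eq ?_)
    rw [← (mp'.prod mp').measure_preimage (measurableSet_cubeSet hG).nullMeasurableSet]
    congr 1
    ext z
    simp only [cubeSet, Set.mem_preimage, Set.mem_setOf_eq, Prod.map]
    constructor
    · intro hz ω
      have := hz (fun a => ω (e a))
      convert this using 2
      simp [vert]
    · intro hz ω
      exact hz (fun b => ω (e.symm b))
  · intro I _ G hG
    rcases Set.eq_empty_or_nonempty G with rfl | ⟨g, hg⟩
    · simp
    · have : cubeSet G = Set.univ := by
        ext z; simp only [cubeSet, Set.mem_setOf_eq, Set.mem_univ, iff_true]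
        intro ω; convert hg
      rw [this]; simp [measure_univ]
      exact prob_le_one
  · intro κ _ _ ih I _ G hG
    classical
    have mp := mp_ocons (κ := κ) (gam I)
    have mo : Measurable (fun z : (I → ℝ) × (κ → I → ℝ) => ocons z.1 z.2) := mp.measurable
    -- slices
    let G' : (I → ℝ) × (I → ℝ) → Set (κ → I → ℝ) := fun p =>
      {x | ocons (ra • p.1 + ra • p.2) x ∈ G ∧ ocons (ra • p.1 - ra • p.2) x ∈ G}
    let T : Set (((I → ℝ) × (I → ℝ)) × (κ → I → ℝ)) := {z | z.2 ∈ G' z.1}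
    have hT : MeasurableSet T := by
      have h1 : Measurable (fun z : ((I → ℝ) × (I → ℝ)) × (κ → I → ℝ) => ocons (ra • z.1.1 + ra • z.1.2) z.2) :=
        mo.comp (by fun_prop : Measurable (fun z : ((I → ℝ) × (I → ℝ)) × (κ → I → ℝ) => (ra • z.1.1 + ra • z.1.2, z.2)))
      have h2 : Measurable (fun z : ((I → ℝ) × (I → ℝ)) × (κ → I → ℝ) => ocons (ra • z.1.1 - ra • z.1.2) z.2) :=
        mo.comp (by fun_prop : Measurable (fun z : ((I → ℝ) × (I → ℝ)) × (κ → I → ℝ) => (ra • z.1.1 - ra • z.1.2, z.2)))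
      exact (h1 hG).inter (h2 hG)
    have hG' : ∀ p, MeasurableSet (G' p) := fun p => measurable_prodMk_left hT
    let G₁ : Set ((I → ℝ) × (κ → I → ℝ)) := (fun z => ocons z.1 z.2) ⁻¹' G
    have hG₁ : MeasurableSet G₁ := mo hG
    -- step 1
    have e1 : gamS (Option κ) I G = ∫⁻ x, gam I {y | ocons y x ∈ G} ∂(gamS κ I) := by
      rw [← mp.measure_preimage hG.nullMeasurableSet, Measure.prod_apply_symm hG₁]; rfl
    have hm1 : Measurable (fun x : κ → I → ℝ => gam I {y | ocons y x ∈ G}) :=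
      measurable_measure_prodMk_right hG₁
    have e2 : ∀ x : κ → I → ℝ, (gam I {y | ocons y x ∈ G}) ^ 2 = ((gam I).prod (gam I)) {p | x ∈ G' p} := by
      intro x
      have hy : MeasurableSet {y | ocons y x ∈ G} := measurable_prodMk_right hG₁
      rw [sq, ← Measure.prod_prod, ← gam_rot.measure_preimage (hy.prod hy).nullMeasurableSet]
      rfl
    have e3 : ∫⁻ x, ((gam I).prod (gam I)) {p | x ∈ G' p} ∂(gamS κ I) =
        ∫⁻ p, gamS κ I (G' p) ∂((gam I).prod (gam I)) := by
      exact (Measure.prod_apply_symm (μ := (gam I).prod (gam I)) (ν := gamS κ I) hT).symm.trans (Measure.prod_apply hT)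
    have hm2 : Measurable (fun p => gamS κ I (G' p)) := measurable_measure_prodMk_left hT
    have s1 : (gamS (Option κ) I G) ^ 2 ≤ ∫⁻ p, gamS κ I (G' p) ∂((gam I).prod (gam I)) := by
      rw [e1, ← e3]; simp only [← e2]; exact jensen_sq _ hm1
    have s2 : (gamS (Option κ) I G) ^ (2 ^ Fintype.card (Option κ)) ≤
        ∫⁻ p, (gamS κ I (G' p)) ^ (2 ^ Fintype.card κ) ∂((gam I).prod (gam I)) := by
      rw [Fintype.card_option, pow_succ', pow_mul]
      refine le_trans ?_ (jensen_pow _ _ hm2)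
      gcongr
    refine s2.trans ?_
    refine (lintegral_mono fun p => ih I (G' p) (hG' p)).trans (le_of_eq ?_)
    have hC := measurableSet_cubeSet hG
    have hC' := (mp.prod mp).measurable hC
    rw [← (mp.prod mp).measure_preimage hC.nullMeasurableSet, ← lintegral_indicator_one hC',
      reorder _ _ (measurable_one.indicator hC')]
    refine lintegral_congr fun p => ?_
    rw [← lintegral_indicator_one (measurableSet_cubeSet (hG' p))]
    refine lintegral_congr fun q => ?_
    have : q ∈ cubeSet (G' p) ↔ ((p.1, q.1), (p.2, q.2)) ∈ (Prod.map (fun z : (I → ℝ) × (κ → I → ℝ) => ocons z.1 z.2)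
        (fun z : (I → ℝ) × (κ → I → ℝ) => ocons z.1 z.2)) ⁻¹' (cubeSet G) := by
      simp only [cubeSet, Set.mem_setOf_eq, Set.mem_preimage, Prod.map, vert_ocons, G']
      constructor
      · intro h ω
        cases hω : ω none with
        | true => simpa [sg] using (h (fun s => ω (some s))).1
        | false => simpa [sg, sub_eq_add_neg] using (h (fun s => ω (some s))).2
      · intro h ω
        constructor
        · simpa [sg] using h (ocons true ω)
        · simpa [sg, sub_eq_add_neg] using h (ocons false ω)
    simp only [Set.indicator, this, Pi.one_apply]

/-- choice of a good centre -/
theorem cube_choice {κ I : Type} [Fintype κ] [DecidableEq κ] [Fintype I] {G : Set (κ → I → ℝ)} (hG : MeasurableSet G)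
    {G' : Set (κ → I → ℝ)} (hG' : MeasurableSet G') {δ : ℝ} (hδ : 0 < δ) (h : δ ≤ (gamS κ I).real G)
    (h' : (gamS κ I).real G'ᶜ ≤ δ ^ (2 ^ Fintype.card κ) / 2) :
    ∃ c ∈ G', δ ^ (2 ^ Fintype.card κ) / 2 ≤ (gamS κ I).real {x | ∀ ω, vert c x ω ∈ G} := by
  set D := δ ^ (2 ^ Fintype.card κ) with hD
  have hDp : 0 < D := by positivity
  have h1 : D ≤ ((gamS κ I).prod (gamS κ I)).real (cubeSet G) := by
    have := ENNReal.toReal_mono (measure_ne_top _ _) (cube κ I G hG)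
    rw [ENNReal.toReal_pow] at this
    refine le_trans ?_ this
    rw [hD]; gcongr; exact h
  have h2 : D - D / 2 ≤ ((gamS κ I).prod (gamS κ I)).real (cubeSet G ∩ (Prod.fst ⁻¹' G')) := by
    apply inter_ge _ (measurable_fst hG') h1
    have e : (Prod.fst ⁻¹' G' : Set ((κ → I → ℝ) × (κ → I → ℝ)))ᶜ = Prod.fst ⁻¹' G'ᶜ := rfl
    rw [e, measureReal_def, measurePreserving_fst.measure_preimage hG'.compl.nullMeasurableSet]
    exact h'
  have hS : MeasurableSet (cubeSet G ∩ (Prod.fst ⁻¹' G')) := (measurableSet_cubeSet hG).inter (measurable_fst hG')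
  by_contra hcon
  push Not at hcon
  have e : ((gamS κ I).prod (gamS κ I)) (cubeSet G ∩ (Prod.fst ⁻¹' G')) =
    ∫⁻ c, gamS κ I {x | (c, x) ∈ cubeSet G ∩ (Prod.fst ⁻¹' G')} ∂(gamS κ I) := Measure.prod_apply hS
  have hlt : ∫⁻ c, gamS κ I {x | (c, x) ∈ cubeSet G ∩ (Prod.fst ⁻¹' G')} ∂(gamS κ I) < ∫⁻ c, ENNReal.ofReal (D / 2) ∂(gamS κ I) := by
    apply lintegral_strict_mono (IsProbabilityMeasure.ne_zero _) (by fun_prop)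
    · rw [← e]; exact measure_ne_top _ _
    · refine Filter.Eventually.of_forall fun c => ?_
      rw [ENNReal.lt_ofReal_iff_toReal_lt (measure_ne_top _ _)]
      by_cases hc : c ∈ G'
      · refine lt_of_le_of_lt ?_ (hcon c hc)
        exact measureReal_mono (fun x hx => hx.1)
      · have : {x | (c, x) ∈ cubeSet G ∩ (Prod.fst ⁻¹' G')} = ∅ := by
          ext x; simp [hc]
        rw [this]; simp; positivity
  rw [← e] at hlt
  simp only [lintegral_const, measure_univ, mul_one] at hlt
  rw [ENNReal.lt_ofReal_iff_toReal_lt (measure_ne_top _ _)] at hlt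
  have : (((gamS κ I).prod (gamS κ I)) (cubeSet G ∩ (Prod.fst ⁻¹' G'))).toReal =
    ((gamS κ I).prod (gamS κ I)).real (cubeSet G ∩ (Prod.fst ⁻¹' G')) := rfl
  linarith

lemma eps_pow (C : ℝ) {a b : ℝ} (h : b < a) : ∀ᶠ ε : ℝ in 𝓝[>] 0, C * ε ^ a ≤ ε ^ b := by
  have h1 : Tendsto (fun ε : ℝ => C * ε ^ (a - b)) (𝓝[>] 0) (𝓝 0) := by
    have := (tendsto_nhdsWithin_of_tendsto_nhds (s := Set.Ioi 0)
      ((Real.continuousAt_rpow_const 0 (a - b) (Or.inr (by linarith))).tendsto)).const_mul C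
    rwa [Real.zero_rpow (by linarith), mul_zero] at this
  filter_upwards [h1.eventually (gt_mem_nhds zero_lt_one), self_mem_nhdsWithin] with ε h2 (h3 : 0 < ε)
  have e : ε ^ a = ε ^ (a - b) * ε ^ b := by rw [← Real.rpow_add h3]; congr 1; ring
  rw [e, ← mul_assoc]
  exact mul_le_of_le_one_left (by positivity) h2.le

lemma eps_lt_one : ∀ᶠ ε : ℝ in 𝓝[>] 0, ε < 1 :=
  (eventually_nhdsWithin_of_eventually_nhds (gt_mem_nhds zero_lt_one))
lemma eps_pos : ∀ᶠ ε : ℝ in 𝓝[>] 0, 0 < ε := self_mem_nhdsWithin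

lemma eps_subst (ρ : ℝ) (hρ : 0 < ρ) {P : ℝ → Prop} (h : ∀ᶠ ε : ℝ in 𝓝[>] 0, P ε) :
    ∀ᶠ ε : ℝ in 𝓝[>] 0, P (ε ^ ρ) := by
  have : Tendsto (fun ε : ℝ => ε ^ ρ) (𝓝[>] 0) (𝓝[>] 0) := by
    refine tendsto_nhdsWithin_iff.mpr ⟨?_, ?_⟩
    · have := (tendsto_nhdsWithin_of_tendsto_nhds (s := Set.Ioi 0)
        ((Real.continuousAt_rpow_const 0 ρ (Or.inr hρ.le)).tendsto))
      rwa [Real.zero_rpow hρ.ne'] at this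
    · filter_upwards [self_mem_nhdsWithin] with ε (h : 0 < ε)
      exact Real.rpow_pos_of_pos h _
  exact this.eventually h

section polar
variable {κ I J K : Type} [Fintype κ] [DecidableEq κ] [Fintype I] [Fintype J]

/-- mixed argument: `x` on `S`, `c` off `S` -/
def mix (S : Finset κ) (x c : κ → I → ℝ) : κ → I → ℝ := fun s => if s ∈ S then x s else c s

lemma ev_vert (t : (κ → I) × J → ℝ) (c x : κ → I → ℝ) (ω : κ → Bool) (j : J) :
    ev t (vert c x ω) j = ra ^ Fintype.card κ * ∑ S : Finset κ, (∏ s ∈ S, sg (ω s)) * ev t (mix S x c) j := by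
  simp only [ev, vert, Pi.add_apply, Pi.smul_apply, smul_eq_mul]
  have : ∀ i : κ → I, ∏ s, (ra * c s (i s) + sg (ω s) * ra * x s (i s)) =
      ra ^ Fintype.card κ * ∑ S : Finset κ, (∏ s ∈ S, sg (ω s)) * ∏ s, mix S x c s (i s) := by
    intro i
    have e : ∀ s, (ra * c s (i s) + sg (ω s) * ra * x s (i s)) = ra * (sg (ω s) * x s (i s) + c s (i s)) := by
      intro s; ring
    simp only [e, Finset.prod_mul_distrib, Finset.prod_const, Finset.card_univ]
    congr 1
    rw [Finset.prod_add, Finset.powerset_univ]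
    refine Finset.sum_congr rfl fun S _ => ?_
    rw [Finset.prod_mul_distrib, mul_assoc]
    congr 1
    rw [← Finset.prod_mul_prod_compl S (fun s => mix S x c s (i s)), ← Finset.compl_eq_univ_sdiff]
    congr 1
    · exact Finset.prod_congr rfl fun s hs => by simp [mix, hs]
    · exact Finset.prod_congr rfl fun s hs => by
        rw [Finset.mem_compl] at hs; simp [mix, hs]
  simp only [this]
  simp only [Finset.mul_sum]
  rw [Finset.sum_comm]
  refine Finset.sum_congr rfl fun S _ => Finset.sum_congr rfl fun i _ => ?_
  ring

lemma sum_sign (h : κ → Bool → ℝ) : ∑ ω : κ → Bool, ∏ s, h s (ω s) = ∏ s, (h s true + h s false) := by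
  have := (Finset.prod_univ_sum (fun _ : κ => (Finset.univ : Finset Bool)) h).symm
  rw [Fintype.piFinset_univ] at this
  rw [this]
  exact Finset.prod_congr rfl fun s _ => by simp

lemma prod_ite_sg (S : Finset κ) (ω : κ → Bool) : ∏ s ∈ S, sg (ω s) = ∏ s, (if s ∈ S then sg (ω s) else 1) := by
  simp [Finset.prod_ite_mem]

lemma sum_sign_one (S : Finset κ) : ∑ ω : κ → Bool, (∏ s, sg (ω s)) * ∏ s ∈ S, sg (ω s) =
    if S = Finset.univ then 2 ^ Fintype.card κ else 0 := by
  simp only [prod_ite_sg S, ← Finset.prod_mul_distrib]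
  rw [sum_sign (fun s b => sg b * if s ∈ S then sg b else 1)]
  split_ifs with h
  · subst h; simp [sg]; norm_num
  · obtain ⟨s, hs⟩ : ∃ s, s ∉ S := by
      by_contra hh; push Not at hh; exact h (Finset.eq_univ_iff_forall.mpr hh)
    apply Finset.prod_eq_zero (Finset.mem_univ s)
    simp [hs, sg]

lemma sum_sign_two (S S' : Finset κ) : ∑ ω : κ → Bool, (∏ s, sg (ω s)) * (∏ s ∈ S, sg (ω s)) * (∏ s ∈ S', sg (ω s)) =
    if S' = Sᶜ then 2 ^ Fintype.card κ else 0 := by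
  simp only [prod_ite_sg S, prod_ite_sg S', ← Finset.prod_mul_distrib]
  rw [sum_sign (fun s b => (sg b * if s ∈ S then sg b else 1) * if s ∈ S' then sg b else 1)]
  split_ifs with h
  · subst h
    rw [Finset.prod_congr rfl (g := fun _ => (2:ℝ))]
    · simp
    · intro s _
      by_cases hs : s ∈ S <;> simp [hs, sg] <;> norm_num
  · obtain ⟨s, hs⟩ : ∃ s, ¬ (s ∈ S' ↔ s ∉ S) := by
      by_contra hh; push Not at hh; apply h; ext s; rw [Finset.mem_compl]; exact hh s
    apply Finset.prod_eq_zero (Finset.mem_univ s)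
    by_cases h1 : s ∈ S <;> by_cases h2 : s ∈ S' <;> simp [h1, h2, sg] at hs ⊢

lemma polar_one (t : (κ → I) × J → ℝ) (c x : κ → I → ℝ) (j : J) :
    ∑ ω : κ → Bool, (∏ s, sg (ω s)) * ev t (vert c x ω) j = (2 * ra) ^ Fintype.card κ * ev t x j := by
  simp only [ev_vert, Finset.mul_sum]
  rw [Finset.sum_comm]
  have : ∀ S : Finset κ, ∑ ω : κ → Bool, (∏ s, sg (ω s)) * (ra ^ Fintype.card κ * ((∏ s ∈ S, sg (ω s)) * ev t (mix S x c) j)) =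
      (ra ^ Fintype.card κ * ev t (mix S x c) j) * if S = Finset.univ then 2 ^ Fintype.card κ else 0 := by
    intro S
    rw [← sum_sign_one, Finset.mul_sum]
    exact Finset.sum_congr rfl fun ω _ => by ring
  simp only [this, mul_ite, mul_zero, Finset.sum_ite_eq', Finset.mem_univ, if_true]
  have : mix Finset.univ x c = x := by funext s; simp [mix]
  rw [this, mul_pow]; ring

lemma polar_two {J' : Type} [Fintype J'] (F : (κ → I) × J → ℝ) (G : (κ → I) × J' → ℝ) (c x : κ → I → ℝ) (j : J) (j' : J') :
    ∑ ω : κ → Bool, (∏ s, sg (ω s)) * (ev F (vert c x ω) j * ev G (vert c x ω) j') =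
      ∑ S : Finset κ, ev F (mix S x c) j * ev G (mix Sᶜ x c) j' := by
  have h2 : (ra ^ Fintype.card κ * ra ^ Fintype.card κ) * 2 ^ Fintype.card κ = 1 := by
    rw [← mul_pow, ← mul_pow, ← sq, ra_sq]; norm_num
  have e : ∀ ω : κ → Bool, (∏ s, sg (ω s)) * (ev F (vert c x ω) j * ev G (vert c x ω) j') =
      ∑ S : Finset κ, ∑ S' : Finset κ, ((ra ^ Fintype.card κ * ra ^ Fintype.card κ) * (ev F (mix S x c) j * ev G (mix S' x c) j')) *
        ((∏ s, sg (ω s)) * (∏ s ∈ S, sg (ω s)) * (∏ s ∈ S', sg (ω s))) := by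
    intro ω
    simp only [ev_vert, Finset.mul_sum, Finset.sum_mul]
    rw [Finset.sum_comm]
    refine Finset.sum_congr rfl fun S _ => Finset.sum_congr rfl fun S' _ => ?_
    ring
  simp only [e]
  rw [Finset.sum_comm]
  refine Finset.sum_congr rfl fun S _ => ?_
  rw [Finset.sum_comm]
  simp only [← Finset.mul_sum, sum_sign_two, mul_ite, mul_zero, Finset.sum_ite_eq', Finset.mem_univ, if_true]
  linear_combination (ev F (mix S x c) j * ev G (mix Sᶜ x c) j') * h2

lemma two_ra_pow (m : ℕ) : 1 ≤ (2 * ra) ^ m := by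
  apply one_le_pow₀
  have := ra_sq; have := ra_pos; nlinarith

/-- norm bound for alternating sums -/
lemma nrm_alt_le {K : Type} [Fintype K] (f : (κ → Bool) → K → ℝ) {B : ℝ} (h : ∀ ω, nrm (f ω) ≤ B) :
    nrm (fun k => ∑ ω : κ → Bool, (∏ s, sg (ω s)) * f ω k) ≤ 2 ^ Fintype.card κ * B := by
  have e : (fun k => ∑ ω : κ → Bool, (∏ s, sg (ω s)) * f ω k) = ∑ ω : κ → Bool, (∏ s, sg (ω s)) • f ω := by
    funext k; simp
  rw [e]
  refine (nrm_sum_le _ _).trans ?_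
  have : ∀ ω ∈ (Finset.univ : Finset (κ → Bool)), nrm ((∏ s, sg (ω s)) • f ω) ≤ B := by
    intro ω _
    rw [nrm_smul]
    have : |∏ s, sg (ω s)| = 1 := by
      rw [Finset.abs_prod]
      apply Finset.prod_eq_one
      intro s _; cases ω s <;> simp [sg]
    rw [this, one_mul]; exact h ω
  refine (Finset.sum_le_sum this).trans ?_
  simp [Finset.card_univ]
end polar

section isprod
/-- product tensors -/
def IsProd {κ I J : Type} (t : (κ → I) × J → ℝ) : Prop :=
  ∃ (κ1 κ2 : Type) (_ : Fintype κ1) (_ : Fintype κ2) (_ : DecidableEq κ1) (_ : DecidableEq κ2)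
    (e : κ1 ⊕ κ2 ≃ κ) (_ : Nonempty κ1) (u : (κ1 → I) × Unit → ℝ) (v : (κ2 → I) × J → ℝ),
    ∀ i j, t (i, j) = u (fun a => i (e (Sum.inl a)), ()) * v (fun b => i (e (Sum.inr b)), j)

variable {κ κ1 κ2 I J : Type} [Fintype κ] [DecidableEq κ] [Fintype κ1] [DecidableEq κ1] [Fintype κ2] [DecidableEq κ2]
  [Fintype I] [Fintype J] (e : κ1 ⊕ κ2 ≃ κ)

/-- splitting index functions -/
def splitE (E : Type) (e : κ1 ⊕ κ2 ≃ κ) : (κ → E) ≃ (κ1 → E) × (κ2 → E) where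
  toFun i := (fun a => i (e (Sum.inl a)), fun b => i (e (Sum.inr b)))
  invFun z := fun s => Sum.elim z.1 z.2 (e.symm s)
  left_inv i := by
    funext s
    obtain ⟨a, rfl⟩ := e.surjective s
    cases a <;> simp
  right_inv z := by simp

lemma prod_split (f : κ → ℝ) : ∏ s, f s = (∏ a, f (e (Sum.inl a))) * ∏ b, f (e (Sum.inr b)) := by
  rw [← Equiv.prod_comp e, Fintype.prod_sum_type]

lemma isProd_ev {t : (κ → I) × J → ℝ} {u : (κ1 → I) × Unit → ℝ} {v : (κ2 → I) × J → ℝ}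
    (h : ∀ i j, t (i, j) = u (fun a => i (e (Sum.inl a)), ()) * v (fun b => i (e (Sum.inr b)), j)) (x : κ → I → ℝ) (j : J) :
    ev t x j = ev u (fun a => x (e (Sum.inl a))) () * ev v (fun b => x (e (Sum.inr b))) j := by
  simp only [ev]
  rw [← Equiv.sum_comp (splitE I e).symm, Finset.sum_mul_sum, ← Fintype.sum_prod_type']
  refine Finset.sum_congr rfl fun z _ => ?_
  rw [h, prod_split e]
  simp only [splitE, Equiv.coe_fn_symm_mk, Equiv.symm_apply_apply, Sum.elim_inl, Sum.elim_inr]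
  ring

lemma isProd_nrm {t : (κ → I) × J → ℝ} {u : (κ1 → I) × Unit → ℝ} {v : (κ2 → I) × J → ℝ}
    (h : ∀ i j, t (i, j) = u (fun a => i (e (Sum.inl a)), ()) * v (fun b => i (e (Sum.inr b)), j)) :
    nrm t = nrm u * nrm v := by
  have h0 : nrm t ^ 2 = (nrm u * nrm v) ^ 2 := by
    rw [mul_pow, nrm_sq, nrm_sq, nrm_sq, Fintype.sum_prod_type, Fintype.sum_prod_type, Fintype.sum_prod_type,
      ← Equiv.sum_comp (splitE I e).symm, Finset.sum_mul_sum, Fintype.sum_prod_type]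
    refine Finset.sum_congr rfl fun i1 _ => Finset.sum_congr rfl fun i2 _ => ?_
    simp only [Finset.univ_unique, Finset.sum_singleton, Finset.mul_sum]
    refine Finset.sum_congr rfl fun j _ => ?_
    rw [h]
    simp only [splitE, Equiv.coe_fn_symm_mk, Equiv.symm_apply_apply, Sum.elim_inl, Sum.elim_inr]
    rw [mul_pow]
  exact (pow_left_inj₀ (nrm_nonneg _) (mul_nonneg (nrm_nonneg _) (nrm_nonneg _)) two_ne_zero).mp h0

lemma isProd_smul {t : (κ → I) × J → ℝ} (h : IsProd t) (a : ℝ) : IsProd (a • t) := by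
  obtain ⟨κ1, κ2, _, _, _, _, e, hn, u, v, huv⟩ := h
  refine ⟨κ1, κ2, ‹_›, ‹_›, ‹_›, ‹_›, e, hn, u, a • v, fun i j => ?_⟩
  simp only [Pi.smul_apply, smul_eq_mul, huv]; ring

/-- partial evaluation -/
noncomputable def sl (F : (κ → I) × J → ℝ) (c : κ2 → I → ℝ) : (κ1 → I) × J → ℝ := fun z =>
  ∑ i2 : κ2 → I, F ((splitE I e).symm (z.1, i2), z.2) * ∏ b, c b (i2 b)

/-- rearranged tensor -/
def rearr (F : (κ → I) × J → ℝ) : (κ2 → I) × ((κ1 → I) × J) → ℝ := fun z => F ((splitE I e).symm (z.2.1, z.1), z.2.2)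

lemma nrm_rearr (F : (κ → I) × J → ℝ) : nrm (rearr e F) = nrm F := by
  let E : (κ2 → I) × ((κ1 → I) × J) ≃ (κ → I) × J :=
    { toFun := fun z => ((splitE I e).symm (z.2.1, z.1), z.2.2)
      invFun := fun z => ((splitE I e z.1).2, ((splitE I e z.1).1, z.2))
      left_inv := fun z => by simp
      right_inv := fun z => by simp }
  exact nrm_comp_equiv E F

lemma sl_eq (F : (κ → I) × J → ℝ) (c : κ2 → I → ℝ) : sl e F c = ev (rearr e F) c := rfl

lemma ev_sl (F : (κ → I) × J → ℝ) (c : κ2 → I → ℝ) (x : κ1 → I → ℝ) :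
    ev (sl e F c) x = ev F ((splitE (I → ℝ) e).symm (x, c)) := by
  funext j
  simp only [ev, sl, Finset.sum_mul]
  rw [← Equiv.sum_comp (splitE I e).symm, Fintype.sum_prod_type]
  refine Finset.sum_congr rfl fun i1 _ => Finset.sum_congr rfl fun i2 _ => ?_
  rw [prod_split e]
  simp only [splitE, Equiv.coe_fn_symm_mk, Equiv.symm_apply_apply, Sum.elim_inl, Sum.elim_inr]
  ring
end isprod

section tail
variable {κ κ1 I J : Type} [Fintype κ] [DecidableEq κ] [Fintype κ1] [DecidableEq κ1] [Fintype I] [Fintype J]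

lemma tail_second (f : κ1 → κ) (hf : Function.Injective f) (t : (κ1 → I) × J → ℝ) {L : ℝ} (hL : 0 < L) :
    (gamS κ I).real {x | L ≤ nrm (ev t (fun a => x (f a)))} ≤ (nrm t / L) ^ 2 := by
  have mp := mp_comp_inj (gam I) f hf
  have hm : Measurable (fun x : κ1 → I → ℝ => nrm (ev t x) ^ 2) := ((measurable_nrm.comp (measurable_ev t)).pow_const 2)
  have e : {x : κ → I → ℝ | L ≤ nrm (ev t (fun a => x (f a)))} =
      (fun x : κ → I → ℝ => fun a => x (f a)) ⁻¹' {x | L ^ 2 ≤ nrm (ev t x) ^ 2} := by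
    ext x
    simp only [Set.mem_setOf_eq, Set.mem_preimage]
    exact (pow_le_pow_iff_left₀ hL.le (nrm_nonneg _) two_ne_zero).symm
  rw [e, measureReal_def, mp.measure_preimage (measurableSet_le measurable_const hm).nullMeasurableSet, div_pow]
  exact markov (gamS κ1 I) hm (sq_nonneg _) (by positivity) (ev_second κ1 I J t).le

lemma tail_high (q : ℕ) (f : κ1 → κ) (hf : Function.Injective f) (t : (κ1 → I) × J → ℝ) {L : ℝ} (hL : 0 < L) :
    (gamS κ I).real {x | L ≤ nrm (ev t (fun a => x (f a)))} ≤ mq q ^ Fintype.card κ1 * ((nrm t / L) ^ 2) ^ q := by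
  have mp := mp_comp_inj (gam I) f hf
  have hm : Measurable (fun x : κ1 → I → ℝ => (nrm (ev t x) ^ 2) ^ q) :=
    ((measurable_nrm.comp (measurable_ev t)).pow_const 2).pow_const q
  have hm' : Measurable (fun x : κ1 → I → ℝ => nrm (ev t x)) := ((measurable_nrm.comp (measurable_ev t)))
  have e : {x : κ → I → ℝ | L ≤ nrm (ev t (fun a => x (f a)))} =
      (fun x : κ → I → ℝ => fun a => x (f a)) ⁻¹' {x | L ≤ nrm (ev t x)} := by
    ext x
    simp only [Set.mem_setOf_eq, Set.mem_preimage]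
  rw [e, measureReal_def, mp.measure_preimage (measurableSet_le measurable_const hm').nullMeasurableSet, div_pow, div_pow,
    ← mul_div_assoc]
  refine le_trans (ENNReal.toReal_mono (measure_ne_top _ _) (measure_mono (t := {x | (L ^ 2) ^ q ≤ (nrm (ev t x) ^ 2) ^ q}) ?_)) ?_
  · intro x hx
    simp only [Set.mem_setOf_eq] at hx ⊢
    gcongr
  · have hmq := mq_pos q
    refine markov (gamS κ1 I) hm (by positivity) (by positivity) ?_
    rw [ENNReal.ofReal_mul (by positivity)]
    exact ev_moment q κ1 I J t
end tail

lemma isProd_normalize {κ I J : Type} [Fintype κ] [DecidableEq κ] [Fintype I] [Fintype J] {s : (κ → I) × J → ℝ} (hs : IsProd s) :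
    ∃ (κ1 κ2 : Type) (_ : Fintype κ1) (_ : Fintype κ2) (_ : DecidableEq κ1) (_ : DecidableEq κ2)
    (e : κ1 ⊕ κ2 ≃ κ) (_ : Nonempty κ1) (u : (κ1 → I) × Unit → ℝ) (v : (κ2 → I) × J → ℝ),
    (∀ i j, s (i, j) = u (fun a => i (e (Sum.inl a)), ()) * v (fun b => i (e (Sum.inr b)), j)) ∧
    nrm u ≤ 1 ∧ nrm v ≤ nrm s := by
  obtain ⟨κ1, κ2, _, _, _, _, e, hn, u, v, huv⟩ := hs
  have hnn := isProd_nrm e huv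
  rcases eq_or_ne (nrm u) 0 with h | h
  · refine ⟨κ1, κ2, ‹_›, ‹_›, ‹_›, ‹_›, e, hn, 0, 0, fun i j => ?_, by simp, by simp [nrm_nonneg]⟩
    have := nrm_eq_zero h
    rw [huv, this]; simp
  · have hp : 0 < nrm u := lt_of_le_of_ne (nrm_nonneg _) h.symm
    refine ⟨κ1, κ2, ‹_›, ‹_›, ‹_›, ‹_›, e, hn, (nrm u)⁻¹ • u, (nrm u) • v, fun i j => ?_, ?_, ?_⟩
    · rw [huv]; simp only [Pi.smul_apply, smul_eq_mul]; field_simp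
    · rw [nrm_smul, abs_of_pos (by positivity), inv_mul_cancel₀ h]
    · rw [nrm_smul, abs_of_pos hp, hnn]

lemma alt_kill {κ κ1 κ2 : Type} [Fintype κ] [DecidableEq κ] (e : κ1 ⊕ κ2 ≃ κ) (hn : Nonempty κ1) (g : (κ → Bool) → ℝ)
    (hg : ∀ ω ω' : κ → Bool, (∀ b, ω (e (Sum.inr b)) = ω' (e (Sum.inr b))) → g ω = g ω') :
    ∑ ω : κ → Bool, (∏ s, sg (ω s)) * g ω = 0 := by
  obtain ⟨a⟩ := hn
  let fl : (κ → Bool) → (κ → Bool) := fun ω => Function.update ω (e (Sum.inl a)) (!ω (e (Sum.inl a)))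
  have hfl : ∀ ω, fl (fl ω) = ω := by
    intro ω
    simp [fl]
  let E : (κ → Bool) ≃ (κ → Bool) := ⟨fl, fl, hfl, hfl⟩
  have h1 : ∑ ω : κ → Bool, (∏ s, sg (ω s)) * g ω = ∑ ω : κ → Bool, -((∏ s, sg (ω s)) * g ω) := by
    rw [← Equiv.sum_comp E]
    refine Finset.sum_congr rfl fun ω _ => ?_
    have e1 : g (E ω) = g ω := by
      apply hg; intro b
      simp [E, fl]
    have e2 : ∏ s, sg (E ω s) = -∏ s, sg (ω s) := by
      rw [← Finset.mul_prod_erase _ _ (Finset.mem_univ (e (Sum.inl a))),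
        ← Finset.mul_prod_erase _ (fun s => sg (ω s)) (Finset.mem_univ (e (Sum.inl a))), ← neg_mul]
      congr 1
      · simp only [E, fl, Equiv.coe_fn_mk, Function.update_self]
        cases ω (e (Sum.inl a)) <;> simp [sg]
      · refine Finset.prod_congr rfl fun s hs => ?_
        rw [Finset.mem_erase] at hs
        simp [E, fl, Function.update_of_ne hs.1]
    rw [e1, e2, neg_mul]
  rw [Finset.sum_neg_distrib] at h1
  linarith

theorem pin (κ : Type) [Fintype κ] [DecidableEq κ] (N K : ℝ) (hN : 0 < N) : ∃ N' K' : ℝ, 0 < N' ∧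
    ∀ᶠ ε : ℝ in 𝓝[>] 0, ∀ (I J : Type) [Fintype I] [Fintype J] (t s : (κ → I) × J → ℝ),
      IsProd s → nrm s ≤ ε ^ (-1 : ℝ) → ε ^ N ≤ (gamS κ I).real {x | nrm (ev t x) ≤ K * ε} →
      ε ^ N' ≤ (gamS κ I).real {x | nrm (ev (t - s) x) ≤ K' * ε} := by
  set m := Fintype.card κ with hm
  refine ⟨(3 * N + 5) * 2 ^ m + 1, 2 ^ m * (K + 1), by positivity, ?_⟩
  filter_upwards [eps_pos, eps_lt_one, eps_pow 4 (by linarith : N < 2 * N + 2),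
    eps_pow 10 (by linarith : 3 * N + 4 < 3 * N + 5),
    eps_pow 2 (by linarith : (3 * N + 5) * 2 ^ m < (3 * N + 5) * 2 ^ m + 1)] with ε h0 h1 E1 E2 E3 I J _ _ t s hs hsn hP
  obtain ⟨κ1, κ2, _, _, _, _, e, hn, u, v, huv, hu1, hv1⟩ := isProd_normalize hs
  set L1 := ε ^ (-N - 1) with hL1
  set L2 := ε ^ (-N - 2) with hL2
  set w := ε ^ (N + 3) with hw
  have pL1 : 0 < L1 := Real.rpow_pos_of_pos h0 _
  have pL2 : 0 < L2 := Real.rpow_pos_of_pos h0 _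
  have pw : 0 < w := Real.rpow_pos_of_pos h0 _
  have inj1 : Function.Injective (fun a : κ1 => e (Sum.inl a)) := fun a b h => Sum.inl_injective (e.injective h)
  have inj2 : Function.Injective (fun a : κ2 => e (Sum.inr a)) := fun a b h => Sum.inr_injective (e.injective h)
  let U : (κ → I → ℝ) → ℝ := fun x => ev u (fun a => x (e (Sum.inl a))) ()
  let V : (κ → I → ℝ) → J → ℝ := fun x => ev v (fun a => x (e (Sum.inr a)))
  have mU : Measurable U := by
    have := measurable_pi_iff.mp (measurable_ev u) ()
    exact this.comp (by fun_prop)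
  have mV : Measurable V := (measurable_ev v).comp (by fun_prop)
  have nU : ∀ x, nrm (ev u (fun a => x (e (Sum.inl a)))) = |U x| := by
    intro x; simp only [nrm, Finset.univ_unique, Finset.sum_singleton, Real.sqrt_sq_eq_abs]; rfl
  let T1 : Set (κ → I → ℝ) := {x | |U x| < L1}
  let T2 : Set (κ → I → ℝ) := {x | nrm (V x) < L2}
  have mT1 : MeasurableSet T1 := measurableSet_lt (by fun_prop) measurable_const
  have mT2 : MeasurableSet T2 := measurableSet_lt (measurable_nrm.comp mV) measurable_const
  have b1 : (gamS κ I).real T1ᶜ ≤ ε ^ (2 * N + 2) := by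
    have := tail_second (fun a : κ1 => e (Sum.inl a)) inj1 u pL1
    have e1 : T1ᶜ = {x | L1 ≤ nrm (ev u (fun a => x (e (Sum.inl a))))} := by
      ext x; simp only [T1, Set.mem_compl_iff, Set.mem_setOf_eq, not_lt, nU]
    rw [e1]
    refine this.trans ?_
    calc (nrm u / L1) ^ 2 ≤ (1 / L1) ^ 2 := by have := nrm_nonneg u; gcongr
      _ = ε ^ (2 * N + 2) := by
        rw [hL1, one_div, ← Real.rpow_neg h0.le, ← Real.rpow_natCast, ← Real.rpow_mul h0.le]; congr 1; push_cast; ring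
  have b2 : (gamS κ I).real T2ᶜ ≤ ε ^ (2 * N + 2) := by
    have := tail_second (fun a : κ2 => e (Sum.inr a)) inj2 v pL2
    have e1 : T2ᶜ = {x | L2 ≤ nrm (ev v (fun a => x (e (Sum.inr a))))} := by
      ext x; simp only [T2, Set.mem_compl_iff, Set.mem_setOf_eq, not_lt, V]
    rw [e1]
    refine this.trans ?_
    calc (nrm v / L2) ^ 2 ≤ (ε ^ (-1 : ℝ) / L2) ^ 2 := by have := nrm_nonneg v; gcongr; linarith
      _ = ε ^ (2 * N + 2) := by
        rw [hL2, ← Real.rpow_sub h0, ← Real.rpow_natCast, ← Real.rpow_mul h0.le]; congr 1; push_cast; ring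
  let G0 : Set (κ → I → ℝ) := ({x | nrm (ev t x) ≤ K * ε} ∩ T1) ∩ T2
  have pG0 : ε ^ N / 2 ≤ (gamS κ I).real G0 := by
    have a1 := inter_ge (gamS κ I) mT1 hP b1
    have a2 := inter_ge (gamS κ I) mT2 a1 b2
    refine le_trans ?_ a2
    linarith
  have pN : 0 < ε ^ N := Real.rpow_pos_of_pos h0 _
  obtain ⟨x₀, hx₀, hpig⟩ := pigeon_real (gamS κ I) (ι := Unit) (G := G0) (fun x _ => U x) pw (by positivity : 0 < ε ^ N / 2)
    (fun x hx _ => (le_of_lt hx.1.2 : |U x| ≤ L1)) pL1.le pG0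
  let G : Set (κ → I → ℝ) := {x | |U x - U x₀| ≤ w} ∩ ({x | nrm (ev t x) ≤ K * ε} ∩ T2)
  have mG : MeasurableSet G := (measurableSet_le (by fun_prop) measurable_const).inter
    ((measurableSet_le (measurable_nrm.comp (measurable_ev t)) measurable_const).inter mT2)
  have pG : ε ^ (3 * N + 5) ≤ (gamS κ I).real G := by
    have sub : ({x | ∀ i : Unit, |U x - U x₀| ≤ w} ∩ G0) ⊆ G := by
      rintro x ⟨hx1, hx2⟩
      exact ⟨hx1 (), hx2.1.1, hx2.2⟩
    refine le_trans ?_ (hpig.trans (measureReal_mono sub))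
    rw [Fintype.card_unit, pow_one]
    have e1 : L1 / w = ε ^ (-2 * N - 4) := by
      rw [hL1, hw, ← Real.rpow_sub h0]; congr 1; ring
    have e2 : 1 ≤ ε ^ (-2 * N - 4) := Real.one_le_rpow_of_pos_of_le_one_of_nonpos h0 h1.le (by linarith)
    rw [e1, le_div_iff₀ (by positivity)]
    calc ε ^ (3 * N + 5) * (2 * ε ^ (-2 * N - 4) + 3) ≤ ε ^ (3 * N + 5) * (5 * ε ^ (-2 * N - 4)) := by gcongr; linarith
      _ = 10 * ε ^ (3 * N + 5) * ε ^ (-2 * N - 4) / 2 := by ring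
      _ ≤ ε ^ (3 * N + 4) * ε ^ (-2 * N - 4) / 2 := by gcongr
      _ = ε ^ N / 2 := by rw [← Real.rpow_add h0]; congr 2; ring
  have pD : 0 < ε ^ (3 * N + 5) := Real.rpow_pos_of_pos h0 _
  obtain ⟨c, -, hc⟩ := cube_choice mG MeasurableSet.univ pD pG (by simp; positivity)
  have e3 : (ε ^ (3 * N + 5)) ^ 2 ^ Fintype.card κ = ε ^ ((3 * N + 5) * 2 ^ m) := by
    rw [← Real.rpow_natCast, ← Real.rpow_mul h0.le]; push_cast; rfl
  rw [e3] at hc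
  refine le_trans (by linarith) (hc.trans (measureReal_mono ?_))
  intro x hx
  simp only [Set.mem_setOf_eq] at hx ⊢
  -- the alternating sum
  let f : (κ → Bool) → J → ℝ := fun ω j => ev t (vert c x ω) j - (U (vert c x ω) - U x₀) * V (vert c x ω) j
  have hf : ∀ ω, nrm (f ω) ≤ (K + 1) * ε := by
    intro ω
    obtain ⟨g1, g2, g3⟩ := hx ω
    have e4 : f ω = ev t (vert c x ω) - (U (vert c x ω) - U x₀) • V (vert c x ω) := by
      funext j; simp [f]
    rw [e4]
    refine (nrm_sub_le _ _).trans ?_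
    rw [nrm_smul]
    have h5 : |U (vert c x ω) - U x₀| * nrm (V (vert c x ω)) ≤ w * L2 :=
      mul_le_mul g1 (le_of_lt g3) (nrm_nonneg _) pw.le
    have h6 : w * L2 = ε := by
      rw [hw, hL2, ← Real.rpow_add h0]
      have : N + 3 + (-N - 2) = 1 := by ring
      rw [this, Real.rpow_one]
    have h7 : nrm (ev t (vert c x ω)) ≤ K * ε := g2
    linarith
  have key := nrm_alt_le f hf
  have e5 : (fun j => ∑ ω : κ → Bool, (∏ s, sg (ω s)) * f ω j) = (2 * ra) ^ m • ev (t - s) x := by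
    funext j
    have k1 := alt_kill e hn (fun ω => U x₀ * V (vert c x ω) j) (by
      intro ω ω' h
      have : (fun a => vert c x ω (e (Sum.inr a))) = (fun a => vert c x ω' (e (Sum.inr a))) := by
        funext a; simp only [vert, h a]
      simp only [V, this])
    have k2 := polar_one (t - s) c x j
    have k3 : ∀ ω, f ω j = ev (t - s) (vert c x ω) j + U x₀ * V (vert c x ω) j := by
      intro ω
      rw [ev_sub, Pi.sub_apply, isProd_ev e huv]
      simp only [f, U, V]; ring
    simp only [k3, mul_add, Finset.sum_add_distrib]
    rw [k1, k2, add_zero]; rfl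
  rw [e5, nrm_smul, abs_of_nonneg (by have := two_ra_pow m; linarith)] at key
  have h8 : nrm (ev (t - s) x) ≤ (2 * ra) ^ m * nrm (ev (t - s) x) :=
    le_mul_of_one_le_left (nrm_nonneg _) (two_ra_pow m)
  refine h8.trans (key.trans (le_of_eq ?_))
  rw [← hm]; ring

/-- the strong decomposition property -/
def Strong (κ : Type) [Fintype κ] [DecidableEq κ] : Prop :=
  ∀ c N : ℝ, 0 < c → 0 < N → ∃ k : ℕ, ∀ᶠ ε : ℝ in 𝓝[>] 0, ∀ (I J : Type) [Fintype I] [Fintype J] (t : (κ → I) × J → ℝ),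
    nrm t ≤ 1 → ε ^ N ≤ (gamS κ I).real {x | nrm (ev t x) ≤ ε} →
    ∃ l : List ((κ → I) × J → ℝ), l.length ≤ k ∧ (∀ s ∈ l, IsProd s ∧ nrm s ≤ ε ^ (-c) * nrm t) ∧
      nrm (t - l.sum) ≤ ε ^ (1 - c)

/-- the weak decomposition property -/
def Weak (κ : Type) [Fintype κ] [DecidableEq κ] : Prop :=
  ∀ N : ℝ, 0 < N → ∃ k : ℕ, ∀ᶠ ε : ℝ in 𝓝[>] 0, ∀ (I J : Type) [Fintype I] [Fintype J] (t : (κ → I) × J → ℝ),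
    nrm t ≤ 1 → ε ^ N ≤ (gamS κ I).real {x | nrm (ev t x) ≤ ε} →
    ∃ l : List ((κ → I) × J → ℝ), l.length ≤ k ∧ (∀ s ∈ l, IsProd s ∧ nrm s ≤ ε ^ (-3 : ℝ)) ∧
      nrm (t - l.sum) ≤ ε ^ (1 / 8 : ℝ)

lemma strong_empty : Strong Empty := by
  intro c N hc hN
  refine ⟨0, ?_⟩
  filter_upwards [eps_pos, eps_lt_one] with ε h0 h1 I J _ _ t ht hP
  refine ⟨[], le_rfl, by simp, ?_⟩
  have hne : {x : Empty → I → ℝ | nrm (ev t x) ≤ ε}.Nonempty := by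
    by_contra hh
    rw [Set.not_nonempty_iff_eq_empty] at hh
    rw [hh] at hP; simp at hP
    have := Real.rpow_pos_of_pos h0 N
    linarith
  obtain ⟨x, hx⟩ := hne
  simp only [Set.mem_setOf_eq, ev_empty] at hx
  simp only [List.sum_nil, sub_zero]
  refine hx.trans ?_
  conv_lhs => rw [← Real.rpow_one ε]
  exact Real.rpow_le_rpow_of_exponent_ge h0 h1.le (by linarith)

lemma small_mono {κ I J : Type} [Fintype κ] [DecidableEq κ] [Fintype I] [Fintype J] {t : (κ → I) × J → ℝ} {ε N N' K K' : ℝ}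
    (h0 : 0 < ε) (h1 : ε < 1) (hN : N ≤ N') (hK : K ≤ K') (h : ε ^ N ≤ (gamS κ I).real {x | nrm (ev t x) ≤ K * ε}) :
    ε ^ N' ≤ (gamS κ I).real {x | nrm (ev t x) ≤ K' * ε} := by
  refine (Real.rpow_le_rpow_of_exponent_ge h0 h1.le hN).trans (h.trans (measureReal_mono ?_))
  intro x hx
  simp only [Set.mem_setOf_eq] at hx ⊢
  refine hx.trans ?_
  gcongr

theorem pin_list (κ : Type) [Fintype κ] [DecidableEq κ] (k : ℕ) : ∀ (N K : ℝ), 0 < N → ∃ N' K' : ℝ, N ≤ N' ∧ K ≤ K' ∧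
    ∀ᶠ ε : ℝ in 𝓝[>] 0, ∀ (I J : Type) [Fintype I] [Fintype J] (t : (κ → I) × J → ℝ) (l : List ((κ → I) × J → ℝ)),
      l.length ≤ k → (∀ s ∈ l, IsProd s ∧ nrm s ≤ ε ^ (-1 : ℝ)) → ε ^ N ≤ (gamS κ I).real {x | nrm (ev t x) ≤ K * ε} →
      ε ^ N' ≤ (gamS κ I).real {x | nrm (ev (t - l.sum) x) ≤ K' * ε} := by
  induction k with
  | zero =>
    intro N K hN
    refine ⟨N, K, le_rfl, le_rfl, ?_⟩
    filter_upwards with ε I J _ _ t l hl hs hP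
    have : l = [] := List.length_eq_zero_iff.mp (by omega)
    subst this; simpa using hP
  | succ k ih =>
    intro N K hN
    obtain ⟨N1, K1, hN1, H1⟩ := pin κ N K hN
    obtain ⟨N2, K2, hN2, hK2, H2⟩ := ih N1 K1 hN1
    refine ⟨max N N2, max K K2, le_max_left _ _, le_max_left _ _, ?_⟩
    filter_upwards [H1, H2, eps_pos, eps_lt_one] with ε H1 H2 h0 h1 I J _ _ t l hl hs hP
    cases l with
    | nil =>
      simp only [List.sum_nil, sub_zero]
      exact small_mono h0 h1 (le_max_left _ _) (le_max_left _ _) hP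
    | cons s l =>
      have a1 := H1 I J t s (hs s (by simp)).1 (hs s (by simp)).2 hP
      have a2 := H2 I J (t - s) l (by simpa using hl) (fun s' h' => hs s' (by simp [h'])) a1
      rw [List.sum_cons, ← sub_sub]
      exact small_mono h0 h1 (le_max_right _ _) (le_max_right _ _) a2

lemma stage (κ : Type) [Fintype κ] [DecidableEq κ] (hA : Weak κ) (c N : ℝ) (hc : 0 < c) (hc1 : c < 1) (hN : 0 < N) (i : ℕ) :
    ∃ (k : ℕ) (K N' : ℝ), 0 < N' ∧ 0 < K ∧ ∀ᶠ ε : ℝ in 𝓝[>] 0, ∀ (I J : Type) [Fintype I] [Fintype J] (t : (κ → I) × J → ℝ),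
    nrm t ≤ 1 → ε ^ N ≤ (gamS κ I).real {x | nrm (ev t x) ≤ ε} →
    ∃ l : List ((κ → I) × J → ℝ), l.length ≤ k ∧ (∀ s ∈ l, IsProd s ∧ nrm s ≤ ε ^ (-c) * nrm t) ∧
      nrm (t - l.sum) ≤ nrm t ∧ (nrm (t - l.sum) ≤ ε ^ (1 - c) ∨ nrm (t - l.sum) ≤ ε ^ (i * (c / 32))) ∧
      ε ^ N' ≤ (gamS κ I).real {x | nrm (ev (t - l.sum) x) ≤ K * ε} := by
  induction i with
  | zero =>
    refine ⟨0, 1, N, hN, one_pos, ?_⟩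
    filter_upwards with ε I J _ _ t ht hP
    refine ⟨[], le_rfl, by simp, by simp, Or.inr ?_, by simpa using hP⟩
    simpa using ht
  | succ i ih =>
    obtain ⟨k, K, N1, hN1, hK, H⟩ := ih
    set ρ := c / 4 with hρ
    have ρp : 0 < ρ := by positivity
    obtain ⟨k', HA⟩ := hA (N1 / ρ) (by positivity)
    obtain ⟨N2, K2, hN2, hK2, HP⟩ := pin_list κ k' N1 K hN1
    refine ⟨k + k', K2, N2, by linarith, by linarith, ?_⟩
    filter_upwards [H, HP, eps_subst ρ ρp HA, eps_pos, eps_lt_one, eps_pow K (by linarith : ρ < c)] with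
      ε H HP HA h0 h1 E1 I J _ _ t ht hP
    obtain ⟨l, hl, hs, hle, hor, hsm⟩ := H I J t ht hP
    set T := t - l.sum with hT
    by_cases hcase : nrm T ≤ ε ^ (1 - c)
    · exact ⟨l, by omega, hs, hle, Or.inl hcase, small_mono h0 h1 hN2 hK2 hsm⟩
    · have hor' := hor.resolve_left hcase
      push Not at hcase
      have pc : 0 < ε ^ (1 - c) := Real.rpow_pos_of_pos h0 _
      set β := nrm T with hβ
      have βp : 0 < β := pc.trans hcase
      have hT1 : nrm (β⁻¹ • T) ≤ 1 := by
        rw [nrm_smul, abs_of_pos (by positivity), ← hβ, inv_mul_cancel₀ βp.ne']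
      have hP2 : (ε ^ ρ) ^ (N1 / ρ) ≤ (gamS κ I).real {x | nrm (ev (β⁻¹ • T) x) ≤ ε ^ ρ} := by
        rw [← Real.rpow_mul h0.le, mul_div_cancel₀ _ ρp.ne']
        refine hsm.trans (measureReal_mono ?_)
        intro x hx
        simp only [Set.mem_setOf_eq] at hx ⊢
        rw [ev_smul, nrm_smul, abs_of_pos (by positivity), inv_mul_le_iff₀ βp]
        refine hx.trans ?_
        calc K * ε = (K * ε ^ c) * ε ^ (1 - c) := by
              rw [mul_assoc, ← Real.rpow_add h0]; congr 1; rw [add_sub_cancel, Real.rpow_one]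
          _ ≤ ε ^ ρ * β := by gcongr
          _ = _ := mul_comm _ _
      obtain ⟨l', hl', hs', hsum'⟩ := HA I J (β⁻¹ • T) hT1 hP2
      have hsplit : ∀ s ∈ l'.map (fun s => β • s), IsProd s ∧ nrm s ≤ ε ^ (-c) * nrm t := by
        intro s hsm'
        rw [List.mem_map] at hsm'
        obtain ⟨s0, hs0, rfl⟩ := hsm'
        refine ⟨isProd_smul (hs' s0 hs0).1 β, ?_⟩
        rw [nrm_smul, abs_of_pos βp, mul_comm]
        have h3 : (ε ^ ρ) ^ (-3 : ℝ) ≤ ε ^ (-c) := by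
          rw [← Real.rpow_mul h0.le]
          exact Real.rpow_le_rpow_of_exponent_ge h0 h1.le (by rw [hρ]; linarith)
        have := (hs' s0 hs0).2.trans h3
        have hpos : 0 ≤ ε ^ (-c) := (Real.rpow_pos_of_pos h0 _).le
        exact mul_le_mul this hle βp.le hpos
      have hmapsum : ∀ L : List ((κ → I) × J → ℝ), (L.map (fun s => β • s)).sum = β • L.sum := by
        intro L; induction L with
        | nil => simp
        | cons a L ihL => simp [ihL]
      have hnew : t - (l ++ l'.map (fun s => β • s)).sum = T - (l'.map (fun s => β • s)).sum := by
        rw [List.sum_append, hT, sub_sub]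
      have hnew2 : T - (l'.map (fun s => β • s)).sum = β • (β⁻¹ • T - l'.sum) := by
        rw [hmapsum, smul_sub, smul_smul, mul_inv_cancel₀ βp.ne', one_smul]
      have hnn : nrm (T - (l'.map (fun s => β • s)).sum) ≤ β * ε ^ (c / 32) := by
        rw [hnew2, nrm_smul, abs_of_pos βp]
        refine mul_le_mul_of_nonneg_left (hsum'.trans (le_of_eq ?_)) βp.le
        rw [← Real.rpow_mul h0.le]; congr 1; rw [hρ]; ring
      have hη1 : ε ^ (c / 32) ≤ 1 := Real.rpow_le_one h0.le h1.le (by positivity)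
      have hη0 : 0 < ε ^ (c / 32) := Real.rpow_pos_of_pos h0 _
      refine ⟨l ++ l'.map (fun s => β • s), by simp; omega, ?_, ?_, ?_, ?_⟩
      · intro s hs2
        rcases List.mem_append.mp hs2 with h | h
        · exact hs s h
        · exact hsplit s h
      · rw [hnew]; refine hnn.trans (le_trans ?_ hle)
        exact mul_le_of_le_one_right βp.le hη1
      · right
        rw [hnew]; refine hnn.trans ?_
        calc β * ε ^ (c / 32) ≤ ε ^ (i * (c / 32)) * ε ^ (c / 32) := by gcongr
          _ = _ := by rw [← Real.rpow_add h0]; congr 1; push_cast; ring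
      · rw [hnew]
        refine HP I J T _ (by simpa using hl') ?_ hsm
        intro s hs2
        refine ⟨(hsplit s hs2).1, (hsplit s hs2).2.trans ?_⟩
        have h4 : ε ^ (-c) ≤ ε ^ (-1 : ℝ) := Real.rpow_le_rpow_of_exponent_ge h0 h1.le (by linarith)
        have hpos : 0 < ε ^ (-c) := (Real.rpow_pos_of_pos h0 _)
        calc ε ^ (-c) * nrm t ≤ ε ^ (-c) * 1 := by gcongr
          _ ≤ _ := by rw [mul_one]; exact h4

theorem strong_of_weak (κ : Type) [Fintype κ] [DecidableEq κ] (hA : Weak κ) : Strong κ := by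
  intro c N hc hN
  by_cases hc1 : c < 1
  · obtain ⟨i, hi⟩ := exists_nat_ge ((1 - c) / (c / 32))
    obtain ⟨k, K, N', hN', hK, H⟩ := stage κ hA c N hc hc1 hN i
    refine ⟨k, ?_⟩
    filter_upwards [H, eps_pos, eps_lt_one] with ε H h0 h1 I J _ _ t ht hP
    obtain ⟨l, hl, hs, -, hor, -⟩ := H I J t ht hP
    refine ⟨l, hl, hs, ?_⟩
    rcases hor with h | h
    · exact h
    · refine h.trans (Real.rpow_le_rpow_of_exponent_ge h0 h1.le ?_)
      rwa [div_le_iff₀ (by positivity)] at hi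
  · refine ⟨0, ?_⟩
    filter_upwards [eps_pos, eps_lt_one] with ε h0 h1 I J _ _ t ht hP
    refine ⟨[], le_rfl, by simp, ?_⟩
    simp only [List.sum_nil, sub_zero]
    exact ht.trans (Real.one_le_rpow_of_pos_of_le_one_of_nonpos h0 h1.le (by linarith))

section linalg
variable {n I J : Type} [Fintype n] [DecidableEq n] [Fintype I] [Fintype J]

/-- the tensor of minors -/
noncomputable def Phi (n : Type) [Fintype n] [DecidableEq n] (M : I × J → ℝ) : (n → J) × ((n → I) × Unit) → ℝ :=
  fun z => Matrix.det (Matrix.of fun a b => M (z.2.1 b, z.1 a))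
/-- row sketches -/
noncomputable def Wm (M : I × J → ℝ) (e : n → J → ℝ) (a : n) (i : I) : ℝ := ∑ j, e a j * M (i, j)
/-- sketched matrix -/
noncomputable def Am (M : I × J → ℝ) (e : n → J → ℝ) (f : n → I → ℝ) : Matrix n n ℝ :=
  Matrix.of fun a b => ∑ i, Wm M e a i * f b i

lemma det_expand (V : J → n → ℝ) (e : n → J → ℝ) :
    Matrix.det (Matrix.of fun a b => ∑ j, e a j * V j b) = ∑ j : n → J, Matrix.det (Matrix.of fun a b => V (j a) b) * ∏ a, e a (j a) := by
  have h := (Matrix.detRowAlternating (n := n) (R := ℝ)).toMultilinearMap.map_sum (α := fun _ => J) (fun a j => e a j • V j)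
  have e1 : (fun a => ∑ j, e a j • V j) = (Matrix.of fun a b => ∑ j, e a j * V j b : Matrix n n ℝ) := by
    funext a b; simp
  rw [e1] at h
  refine h.trans (Finset.sum_congr rfl fun j _ => ?_)
  have h2 := (Matrix.detRowAlternating (n := n) (R := ℝ)).toMultilinearMap.map_smul_univ (fun a => e a (j a)) (fun a => V (j a))
  refine h2.trans ?_
  rw [smul_eq_mul, mul_comm]; rfl

lemma ev_Phi (M : I × J → ℝ) (e : n → J → ℝ) (z : (n → I) × Unit) :
    ev (Phi n M) e z = Matrix.det (Matrix.of fun a b => Wm M e a (z.1 b)) := by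
  have := det_expand (fun j b => M (z.1 b, j)) e
  simp only [ev, Phi, Wm]
  exact this.symm

lemma ev_Psi (W : n → I → ℝ) (f : n → I → ℝ) (u : Unit) :
    ev (fun z : (n → I) × Unit => Matrix.det (Matrix.of fun a b => W a (z.1 b))) f u =
      Matrix.det (Matrix.of fun a b => ∑ i, W a i * f b i) := by
  have := det_expand (fun i a => W a i) f
  rw [← Matrix.det_transpose] 
  have e1 : (Matrix.of fun a b => ∑ i, W a i * f b i).transpose = Matrix.of fun a b => ∑ i, f a i * W b i := by
    ext a b; simp [mul_comm]
  rw [e1, this]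
  simp only [ev]
  refine Finset.sum_congr rfl fun i _ => ?_
  rw [← Matrix.det_transpose]; rfl

lemma ev_ev_Phi (M : I × J → ℝ) (e : n → J → ℝ) (f : n → I → ℝ) (u : Unit) :
    ev (ev (Phi n M) e) f u = (Am M e f).det := by
  have : ev (Phi n M) e = fun z : (n → I) × Unit => Matrix.det (Matrix.of fun a b => Wm M e a (z.1 b)) := by
    funext z; exact ev_Phi M e z
  rw [this, ev_Psi]; rfl

lemma nrm_Phi_congr {n' : Type} [Fintype n'] [DecidableEq n'] (g : n ≃ n') (M : I × J → ℝ) : nrm (Phi n M) = nrm (Phi n' M) := by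
  let E : (n → J) × ((n → I) × Unit) ≃ (n' → J) × ((n' → I) × Unit) :=
    (g.arrowCongr (Equiv.refl J)).prodCongr ((g.arrowCongr (Equiv.refl I)).prodCongr (Equiv.refl Unit))
  rw [← nrm_comp_equiv E (Phi n' M)]
  congr 1
  funext z
  simp only [Phi, E]
  rw [← Matrix.det_submatrix_equiv_self g]
  congr 1
  ext a b
  simp

/-- bordered tensor -/
noncomputable def Phib (n : Type) [Fintype n] [DecidableEq n] (M : I × J → ℝ) : (n → J) × ((n → I) × (I × J)) → ℝ :=
  fun z => Phi (n ⊕ Unit) M (Sum.elim z.1 (fun _ => z.2.2.2), (Sum.elim z.2.1 (fun _ => z.2.2.1), ()))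

lemma nrm_Phib (M : I × J → ℝ) : nrm (Phib n M) = nrm (Phi (n ⊕ Unit) M) := by
  let E : (n → J) × ((n → I) × (I × J)) ≃ (n ⊕ Unit → J) × ((n ⊕ Unit → I) × Unit) :=
    { toFun := fun z => (Sum.elim z.1 (fun _ => z.2.2.2), (Sum.elim z.2.1 (fun _ => z.2.2.1), ()))
      invFun := fun z => (fun a => z.1 (Sum.inl a), (fun a => z.2.1 (Sum.inl a), (z.2.1 (Sum.inr ()), z.1 (Sum.inr ()))))
      left_inv := fun z => by simp
      right_inv := fun z => by
        refine Prod.ext ?_ (Prod.ext ?_ rfl)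
        · funext a; rcases a with a | a <;> rfl
        · funext a; rcases a with a | a <;> rfl }
  exact nrm_comp_equiv E _

lemma sum_elim_single {E : Type} [Fintype E] [DecidableEq E] (g : (n ⊕ Unit → E) → ℝ) (e : n → E → ℝ) (j0 : E) :
    ∑ j : n ⊕ Unit → E, g j * ∏ a, (Sum.elim e (fun _ => Pi.single j0 1) : n ⊕ Unit → E → ℝ) a (j a) =
      ∑ j : n → E, g (Sum.elim j (fun _ => j0)) * ∏ a, e a (j a) := by
  rw [← Equiv.sum_comp (splitE E (Equiv.refl (n ⊕ Unit))).symm, Fintype.sum_prod_type]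
  refine Finset.sum_congr rfl fun j _ => ?_
  rw [Finset.sum_eq_single (fun _ => j0)]
  · simp [splitE]
  · intro j2 _ hj2
    have : j2 () ≠ j0 := fun h => hj2 (funext fun _ => h)
    simp [splitE, this]
  · simp

lemma ev_ev_Phib [DecidableEq I] [DecidableEq J] (M : I × J → ℝ) (e : n → J → ℝ) (f : n → I → ℝ) (i0 : I) (j0 : J) :
    ev (ev (Phib n M) e) f (i0, j0) =
      (Am M (Sum.elim e (fun _ => Pi.single j0 1) : n ⊕ Unit → J → ℝ) (Sum.elim f (fun _ => Pi.single i0 1))).det := by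
  rw [← ev_ev_Phi _ _ _ ()]
  have h1 : ∀ (i : n ⊕ Unit → I), ev (Phi (n ⊕ Unit) M) (Sum.elim e (fun _ => Pi.single j0 1)) (i, ()) =
      ∑ j : n → J, Phi (n ⊕ Unit) M (Sum.elim j (fun _ => j0), (i, ())) * ∏ a, e a (j a) := by
    intro i
    exact sum_elim_single (fun j => Phi (n ⊕ Unit) M (j, (i, ()))) e j0
  have h2 := sum_elim_single (fun i => ev (Phi (n ⊕ Unit) M) (Sum.elim e (fun _ => Pi.single j0 1)) (i, ())) f i0
  have h3 : ev (ev (Phi (n ⊕ Unit) M) (Sum.elim e (fun _ => Pi.single j0 1))) (Sum.elim f (fun _ => Pi.single i0 1)) () = _ := h2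
  rw [h3]
  rw [ev]
  refine Finset.sum_congr rfl fun i _ => ?_
  rw [h1]; rfl

/-- residual -/
noncomputable def Res (M : I × J → ℝ) (e : n → J → ℝ) (f : n → I → ℝ) : I × J → ℝ := fun z =>
  M z - ∑ a, ∑ b, (Am M e f)⁻¹ b a * (ap M (f b) z.2 * Wm M e a z.1)

lemma schur (M : I × J → ℝ) (e : n → J → ℝ) (f : n → I → ℝ) (hA : (Am M e f).det ≠ 0) :
    ev (ev (Phib n M) e) f = (Am M e f).det • Res M e f := by
  classical
  funext z
  obtain ⟨i0, j0⟩ := z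
  rw [ev_ev_Phib]
  set A := Am M e f with hAdef
  haveI : Invertible A := A.invertibleOfIsUnitDet (isUnit_iff_ne_zero.mpr hA)
  have hb : (Am M (Sum.elim e (fun _ => Pi.single j0 1) : n ⊕ Unit → J → ℝ) (Sum.elim f (fun _ => Pi.single i0 1))) =
      Matrix.fromBlocks A (Matrix.of fun a (_ : Unit) => Wm M e a i0) (Matrix.of fun (_ : Unit) b => ap M (f b) j0)
        (Matrix.of fun _ _ => M (i0, j0)) := by
    ext a b
    rcases a with a | a <;> rcases b with b | b
    · simp [Am, Wm, hAdef]
    · simp [Am, Wm, Pi.single_apply]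
    · simp [Am, Wm, ap, Pi.single_apply]
    · simp [Am, Wm, Pi.single_apply]
  rw [hb, Matrix.det_fromBlocks₁₁, Matrix.det_unique (n := Unit), Pi.smul_apply, smul_eq_mul]
  congr 1
  simp only [Res, Matrix.sub_apply, Matrix.of_apply, Matrix.mul_apply, Matrix.invOf_eq_nonsing_inv, Finset.sum_mul]
  congr 1
  refine Finset.sum_congr rfl fun a _ => Finset.sum_congr rfl fun b _ => ?_
  ring

lemma cauchy_binet (W : n → I → ℝ) :
    ∑ i : n → I, (Matrix.det (Matrix.of fun a b => W a (i b))) ^ 2 =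
      (Fintype.card n).factorial * Matrix.det (Matrix.of fun a b => ∑ i, W a i * W b i) := by
  have h1 : Matrix.det (Matrix.of fun a b => ∑ i, W a i * W b i) =
      ∑ i : n → I, Matrix.det (Matrix.of fun a b => W a (i b)) * ∏ b, W b (i b) := (ev_Psi W W ()).symm
  have h2 : ∀ σ : Equiv.Perm n, ∑ i : n → I, Matrix.det (Matrix.of fun a b => W a (i b)) * ((Equiv.Perm.sign σ : ℤ) * ∏ b, W (σ b) (i b)) =
      ∑ i : n → I, Matrix.det (Matrix.of fun a b => W a (i b)) * ∏ b, W b (i b) := by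
    intro σ
    rw [← Equiv.sum_comp (σ.arrowCongr (Equiv.refl I)).symm]
    refine Finset.sum_congr rfl fun i _ => ?_
    have e1 : (Matrix.of fun a b => W a (((σ.arrowCongr (Equiv.refl I)).symm i) b)) =
        (Matrix.of fun a b => W a (i b)).submatrix id σ := by
      ext a b; simp [Equiv.arrowCongr]
    have e2 : ∏ b, W (σ b) (((σ.arrowCongr (Equiv.refl I)).symm i) b) = ∏ b, W b (i b) := by
      rw [← Equiv.prod_comp σ (fun b => W b (i b))]
      exact Finset.prod_congr rfl fun b _ => by simp [Equiv.arrowCongr]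
    rw [e1, e2, Matrix.det_permute']
    have : ((Equiv.Perm.sign σ : ℤ) : ℝ) * ((Equiv.Perm.sign σ : ℤ) : ℝ) = 1 := by
      rcases Int.units_eq_one_or (Equiv.Perm.sign σ) with h | h <;> simp [h]
    linear_combination (Matrix.det (Matrix.of fun a b => W a (i b)) * ∏ b, W b (i b)) * this
  have h3 : ∀ i : n → I, (Matrix.det (Matrix.of fun a b => W a (i b))) ^ 2 =
      ∑ σ : Equiv.Perm n, Matrix.det (Matrix.of fun a b => W a (i b)) * ((Equiv.Perm.sign σ : ℤ) * ∏ b, W (σ b) (i b)) := by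
    intro i
    rw [sq, ← Finset.mul_sum]
    congr 1
    rw [Matrix.det_apply']; rfl
  simp only [h3]
  rw [Finset.sum_comm]
  simp only [h2]
  rw [h1, Finset.sum_const, Finset.card_univ, Fintype.card_perm, nsmul_eq_mul]
end linalg

section smallball
variable {n I J : Type} [Fintype n] [DecidableEq n] [Fintype I] [Fintype J]

lemma gauss_le_vol : gaussianReal 0 1 ≤ (volume : Measure ℝ) := by
  rw [gaussianReal_of_var_ne_zero _ one_ne_zero]
  refine (withDensity_mono (g := 1) (Eventually.of_forall fun x => ?_)).trans (by rw [withDensity_one])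
  simp only [gaussianPDF, Pi.one_apply]
  rw [← ENNReal.ofReal_one]
  apply ENNReal.ofReal_le_ofReal
  unfold gaussianPDFReal
  have h1 : Real.exp (-(x - 0) ^ 2 / (2 * ((1:NNReal) : ℝ))) ≤ 1 := by
    apply Real.exp_le_one_iff.mpr
    have := sq_nonneg (x - 0)
    simp only [NNReal.coe_one]; linarith
  have h2 : (√(2 * Real.pi * ((1:NNReal) : ℝ)))⁻¹ ≤ 1 := by
    apply inv_le_one_of_one_le₀
    rw [Real.one_le_sqrt]
    have := Real.pi_gt_three
    simp only [NNReal.coe_one]; linarith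
  exact mul_le_one₀ h2 (Real.exp_pos _).le h1

lemma gam_le_vol : gam I ≤ (volume : Measure (I → ℝ)) := by
  rw [volume_pi]
  have h : (gam I).toOuterMeasure ≤ OuterMeasure.pi fun i : I => (volume : Measure ℝ).toOuterMeasure := by
    rw [OuterMeasure.le_pi]
    intro s hs
    have : (gam I) (Set.univ.pi s) ≤ ∏ i, volume (s i) := by
      rw [Measure.pi_pi]
      exact Finset.prod_le_prod' fun i _ => gauss_le_vol (s i)
    exact this
  refine Measure.le_iff.mpr fun s hs => ?_
  rw [Measure.pi, toMeasure_apply _ _ hs]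
  exact h s

open scoped MatrixOrder in
lemma small_ball (W : n → I → ℝ) {η : ℝ} (hη : 0 ≤ η) :
    (gam I).real {y | ∀ a, |∑ i, W a i * y i| ≤ η} * Real.sqrt (Matrix.det (Matrix.of fun a b => ∑ i, W a i * W b i)) ≤ (2 * η) ^ Fintype.card n := by
  classical
  set Wm' : Matrix n I ℝ := Matrix.of W with hW
  set G : Matrix n n ℝ := Matrix.of fun a b => ∑ i, W a i * W b i with hG
  have hGW : G = Wm' * Wm'.transpose := by ext a b; simp [hG, hW, Matrix.mul_apply]
  have hpsd : G.PosSemidef := by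
    rw [hGW]; have := Matrix.posSemidef_self_mul_conjTranspose Wm'
    rwa [Matrix.conjTranspose_eq_transpose_of_trivial] at this
  set S := CFC.sqrt G with hS
  have hSS : S * S = G := CFC.sqrt_mul_sqrt_self G (Matrix.nonneg_iff_posSemidef.mpr hpsd)
  have hSh : S.transpose = S := by
    have : S.IsHermitian := (Matrix.nonneg_iff_posSemidef.mp (CFC.sqrt_nonneg G)).1
    rwa [Matrix.IsHermitian, Matrix.conjTranspose_eq_transpose_of_trivial] at this
  have hdet : S.det * S.det = G.det := by rw [← Matrix.det_mul, hSS]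
  have hsq : Real.sqrt G.det = |S.det| := by rw [← hdet, Real.sqrt_mul_self_eq_abs]
  rw [hsq]
  by_cases h0 : S.det = 0
  · rw [h0, abs_zero, mul_zero]; positivity
  let L1 : (I → ℝ) →L[ℝ] (n → ℝ) := (Matrix.toLin' Wm').toContinuousLinearMap
  let L2 : (n → ℝ) →L[ℝ] (n → ℝ) := (Matrix.toLin' S).toContinuousLinearMap
  have hmap : (gam I).map L1 = (gam n).map L2 := by
    apply gam_map_eq
    intro L
    have hL : ∀ v : n → ℝ, L v = ∑ a, L (Pi.single a 1) * v a := by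
      intro v
      conv_lhs => rw [show v = ∑ a, v a • (Pi.single a 1 : n → ℝ) by
        funext b; simp [Finset.sum_apply, Pi.single_apply]]
      rw [map_sum]; exact Finset.sum_congr rfl fun a _ => by rw [map_smul, smul_eq_mul, mul_comm]
    have key : ∀ (K : Type) [Fintype K] [DecidableEq K] (T : Matrix n K ℝ), ∑ k, (L ((Matrix.toLin' T) (Pi.single k 1))) ^ 2 =
        ∑ a, ∑ b, L (Pi.single a 1) * L (Pi.single b 1) * (T * T.transpose) a b := by
      intro K _ _ T
      have : ∀ k, L ((Matrix.toLin' T) (Pi.single k 1)) = ∑ a, L (Pi.single a 1) * T a k := by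
        intro k; rw [hL]; simp
      simp_rw [this, sq, Finset.sum_mul_sum, Matrix.mul_apply, Finset.mul_sum, Matrix.transpose_apply]
      rw [Finset.sum_comm]
      refine Finset.sum_congr rfl fun a _ => ?_
      rw [Finset.sum_comm]
      exact Finset.sum_congr rfl fun b _ => Finset.sum_congr rfl fun k _ => by ring
    have k1 := key I Wm'
    have k2 := key n S
    rw [hSh, hSS] at k2
    rw [← hGW] at k1
    exact k1.trans k2.symm
  let B : Set (n → ℝ) := Set.univ.pi fun _ => Set.Icc (-η) η
  have hB : MeasurableSet B := MeasurableSet.univ_pi fun _ => measurableSet_Icc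
  have e1 : {y : I → ℝ | ∀ a, |∑ i, W a i * y i| ≤ η} = L1 ⁻¹' B := by
    ext y
    simp only [Set.mem_setOf_eq, Set.mem_preimage, B, Set.mem_univ_pi, Set.mem_Icc, abs_le]
    rfl
  have e2 : (gam I) {y : I → ℝ | ∀ a, |∑ i, W a i * y i| ≤ η} ≤ ENNReal.ofReal ((2 * η) ^ Fintype.card n / |S.det|) := by
    rw [e1, ← Measure.map_apply L1.continuous.measurable hB, hmap, Measure.map_apply L2.continuous.measurable hB]
    refine (gam_le_vol _).trans ?_
    have e3 : (volume : Measure (n → ℝ)) (L2 ⁻¹' B) = (Measure.map (Matrix.toLin' S) volume) B :=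
      (Measure.map_apply L2.continuous.measurable hB).symm
    rw [e3, Real.map_matrix_volume_pi_eq_smul_volume_pi h0, Measure.smul_apply, smul_eq_mul, volume_pi, Measure.pi_pi]
    simp only [Real.volume_Icc, Finset.prod_const, Finset.card_univ]
    rw [← ENNReal.ofReal_pow (by linarith), ← ENNReal.ofReal_mul (abs_nonneg _)]
    apply ENNReal.ofReal_le_ofReal
    rw [abs_inv]
    apply le_of_eq
    rw [div_eq_mul_inv, mul_comm]; congr 2; ring
  have e4 := ENNReal.toReal_mono ENNReal.ofReal_ne_top e2
  rw [ENNReal.toReal_ofReal (by positivity)] at e4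
  rw [← le_div_iff₀ (abs_pos.mpr h0)]
  exact e4
end smallball

section twostage
variable {n I J K : Type} [Fintype n] [DecidableEq n] [Fintype I] [Fintype J] [Fintype K]

lemma continuous_ev2 (t : (n → J) × ((n → I) × K) → ℝ) : Continuous fun z : (n → J → ℝ) × (n → I → ℝ) => ev (ev t z.1) z.2 := by
  unfold ev; fun_prop

lemma measurable_ev2 (t : (n → J) × ((n → I) × K) → ℝ) : Measurable fun z : (n → J → ℝ) × (n → I → ℝ) => ev (ev t z.1) z.2 := by
  unfold ev; fun_prop

lemma ev2_moment (q : ℕ) (t : (n → J) × ((n → I) × K) → ℝ) :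
    ∫⁻ z, ENNReal.ofReal ((nrm (ev (ev t z.1) z.2) ^ 2) ^ q) ∂((gamS n J).prod (gamS n I)) ≤
      ENNReal.ofReal (mq q ^ Fintype.card n * mq q ^ Fintype.card n * (nrm t ^ 2) ^ q) := by
  rw [lintegral_prod _ (by have h : Measurable fun z : (n → J → ℝ) × (n → I → ℝ) => nrm (ev (ev t z.1) z.2) := measurable_nrm.comp (measurable_ev2 t); exact ((h.pow_const 2).pow_const q).ennreal_ofReal.aemeasurable)]
  calc _ ≤ ∫⁻ e, ENNReal.ofReal (mq q ^ Fintype.card n) * ENNReal.ofReal ((nrm (ev t e) ^ 2) ^ q) ∂(gamS n J) :=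
        lintegral_mono fun e => ev_moment q n I K (ev t e)
    _ = ENNReal.ofReal (mq q ^ Fintype.card n) * ∫⁻ e, ENNReal.ofReal ((nrm (ev t e) ^ 2) ^ q) ∂(gamS n J) :=
        lintegral_const_mul _ (by fun_prop)
    _ ≤ ENNReal.ofReal (mq q ^ Fintype.card n) * (ENNReal.ofReal (mq q ^ Fintype.card n) * ENNReal.ofReal ((nrm t ^ 2) ^ q)) := by
        gcongr; exact ev_moment q n _ _ t
    _ = _ := by
        have := mq_pos q
        rw [ENNReal.ofReal_mul (by positivity), ENNReal.ofReal_mul (by positivity), mul_assoc]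

lemma ev2_second (t : (n → J) × ((n → I) × K) → ℝ) :
    ∫⁻ z, ENNReal.ofReal (nrm (ev (ev t z.1) z.2) ^ 2) ∂((gamS n J).prod (gamS n I)) = ENNReal.ofReal (nrm t ^ 2) := by
  rw [lintegral_prod _ (by have h : Measurable fun z : (n → J → ℝ) × (n → I → ℝ) => nrm (ev (ev t z.1) z.2) := measurable_nrm.comp (measurable_ev2 t); exact (h.pow_const 2).ennreal_ofReal.aemeasurable)]
  rw [← ev_second n J _ t]
  exact lintegral_congr fun e => ev_second n I K (ev t e)

end twostage

section upper
variable {n I J : Type} [Fintype n] [DecidableEq n] [Fintype I] [Fintype J]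

lemma ev_unit (v : J → ℝ) (x : Unit → J → ℝ) :
    ev (fun z : (Unit → J) × Unit => v (z.1 ())) x () = ∑ j, x () j * v j := by
  simp only [ev]
  rw [← Equiv.sum_comp (Equiv.funUnique Unit J).symm]
  refine Finset.sum_congr rfl fun j _ => ?_
  simp [mul_comm]

lemma nrm_unit_fun (v : J → ℝ) : nrm (fun z : (Unit → J) × Unit => v (z.1 ())) = nrm v := by
  have := nrm_comp_equiv ((Equiv.prodUnique (Unit → J) Unit).trans (Equiv.funUnique Unit J)) v
  exact this

lemma nrm_unit (v : Unit → ℝ) : nrm v = |v ()| := by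
  simp [nrm, Real.sqrt_sq_eq_abs]

lemma row_tail (v : J → ℝ) (a : n) {L : ℝ} (hL : 0 < L) :
    (gamS n J).real {e | L ≤ |∑ j, e a j * v j|} ≤ (nrm v / L) ^ 2 := by
  have := tail_second (κ := n) (I := J) (fun _ : Unit => a) (fun _ _ _ => rfl) (fun z : (Unit → J) × Unit => v (z.1 ())) hL
  rw [nrm_unit_fun] at this
  simpa only [nrm_unit, ev_unit] using this

lemma Wm_ap (M : I × J → ℝ) (e : n → J → ℝ) (a : n) (y : I → ℝ) :
    ∑ i, Wm M e a i * y i = ∑ j, e a j * ap M y j := by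
  simp only [Wm, ap, Finset.sum_mul, Finset.mul_sum]
  rw [Finset.sum_comm]
  exact Finset.sum_congr rfl fun j _ => Finset.sum_congr rfl fun i _ => by ring

lemma nrm_ev_Phi (M : I × J → ℝ) (e : n → J → ℝ) : nrm (ev (Phi n M) e) ^ 2 =
    (Fintype.card n).factorial * Matrix.det (Matrix.of fun a b => ∑ i, Wm M e a i * Wm M e b i) := by
  rw [← cauchy_binet, nrm_sq, Fintype.sum_prod_type]
  refine Finset.sum_congr rfl fun i _ => ?_
  simp [ev_Phi]

lemma measurable_Wm (M : I × J → ℝ) (a : n) (i : I) : Measurable fun e : n → J → ℝ => Wm M e a i := by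
  unfold Wm; fun_prop

theorem D_upper (n : Type) [Fintype n] [DecidableEq n] : ∃ C : ℝ, 0 < C ∧ ∀ (I J : Type) [Fintype I] [Fintype J] (M : I × J → ℝ) (ε δ : ℝ),
    0 < ε → 0 < δ → δ ≤ (gam I).real {y | nrm (ap M y) ≤ ε} → nrm (Phi n M) ≤ C * ε ^ Fintype.card n / δ := by
  set R := Fintype.card n with hR
  set K : ℝ := mq 2 ^ R with hK
  have hKpos : 0 < K := pow_pos (mq_pos 2) _
  set p0 : ℝ := 1 / (4 * K) with hp0
  have hp0pos : 0 < p0 := by positivity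
  set Λ : ℝ := Real.sqrt ((2 * R + 1) / p0) with hΛ
  have hΛpos : 0 < Λ := Real.sqrt_pos.mpr (by positivity)
  have hΛsq : Λ ^ 2 = (2 * R + 1) / p0 := Real.sq_sqrt (by positivity)
  refine ⟨(2 * Λ) ^ R * Real.sqrt (2 * R.factorial) * (2 / p0), by positivity, ?_⟩
  intro I J _ _ M ε δ hε hδ h
  set D := nrm (Phi n M) with hD
  by_cases hD0 : D = 0
  · rw [hD0]; positivity
  have hDpos : 0 < D := lt_of_le_of_ne (nrm_nonneg _) (Ne.symm hD0)
  have hPZ : p0 ≤ (gamS n J).real {e | D ^ 2 / 2 ≤ nrm (ev (Phi n M) e) ^ 2} := by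
    refine paley_zygmund (gamS n J) (by fun_prop) (fun e => by positivity) (by positivity) hKpos (ev_second n J _ _) ?_
    have := ev_moment 2 n J _ (Phi n M)
    refine this.trans ?_
    rw [← ENNReal.ofReal_mul (by positivity)]
  let S : Set ((I → ℝ) × (n → J → ℝ)) := {z | D ^ 2 / 2 ≤ nrm (ev (Phi n M) z.2) ^ 2 ∧ ∀ a, |∑ i, Wm M z.2 a i * z.1 i| ≤ Λ * ε}
  have hS : MeasurableSet S := by
    have h1 : Measurable fun z : (I → ℝ) × (n → J → ℝ) => nrm (ev (Phi n M) z.2) ^ 2 := by fun_prop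
    have h2 : ∀ a, Measurable fun z : (I → ℝ) × (n → J → ℝ) => |∑ i, Wm M z.2 a i * z.1 i| := by
      intro a; unfold Wm; fun_prop
    refine (measurableSet_le measurable_const h1).inter ?_
    have : {z : (I → ℝ) × (n → J → ℝ) | ∀ a, |∑ i, Wm M z.2 a i * z.1 i| ≤ Λ * ε} = ⋂ a, {z | |∑ i, Wm M z.2 a i * z.1 i| ≤ Λ * ε} := by
      ext z; simp
    change MeasurableSet {z : (I → ℝ) × (n → J → ℝ) | ∀ a, |∑ i, Wm M z.2 a i * z.1 i| ≤ Λ * ε}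
    rw [this]
    exact MeasurableSet.iInter fun a => measurableSet_le (h2 a) measurable_const
  obtain ⟨e, he⟩ := fubini_choice (gam I) (gamS n J) hS (p := p0 / 2) (δ := δ) (by positivity) hδ (by
    refine h.trans (measureReal_mono ?_ )
    intro y hy
    simp only [Set.mem_setOf_eq] at hy ⊢
    let T : Set (n → J → ℝ) := {e | ∀ a, |∑ j, e a j * ap M y j| < Λ * ε}
    have hT : MeasurableSet T := by
      have : T = ⋂ a, {e : n → J → ℝ | |∑ j, e a j * ap M y j| < Λ * ε} := by ext z; simp [T]
      rw [this]
      exact MeasurableSet.iInter fun a => measurableSet_lt (by fun_prop) measurable_const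
    have hTb : (gamS n J).real Tᶜ ≤ p0 / 2 := by
      have hsub : Tᶜ ⊆ ⋃ a ∈ (Finset.univ : Finset n), {e : n → J → ℝ | Λ * ε ≤ |∑ j, e a j * ap M y j|} := by
        intro e he
        simp only [T, Set.mem_compl_iff, Set.mem_setOf_eq, not_forall, not_lt] at he
        obtain ⟨a, ha⟩ := he
        simp only [Set.mem_iUnion]; exact ⟨a, Finset.mem_univ _, ha⟩
      refine (measureReal_mono hsub (measure_ne_top _ _)).trans ((measureReal_biUnion_finset_le _ _).trans ?_)
      calc _ ≤ ∑ a : n, 1 / Λ ^ 2 := by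
            refine Finset.sum_le_sum fun a _ => (row_tail (ap M y) a (by positivity)).trans ?_
            have : nrm (ap M y) / (Λ * ε) ≤ 1 / Λ := by
              rw [div_le_div_iff₀ (by positivity) hΛpos]
              nlinarith
            calc _ ≤ (1 / Λ) ^ 2 := by
                  have h0 : 0 ≤ nrm (ap M y) / (Λ * ε) := div_nonneg (nrm_nonneg _) (by positivity)
                  gcongr
              _ = _ := by rw [div_pow, one_pow]
        _ = R / Λ ^ 2 := by simp [hR, div_eq_mul_inv]
        _ ≤ p0 / 2 := by
            rw [hΛsq, div_div_eq_mul_div, div_le_div_iff₀ (by positivity) (by positivity)]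
            nlinarith
    have := inter_ge (gamS n J) hT hPZ hTb
    refine le_trans (by linarith) (this.trans (measureReal_mono ?_))
    rintro e ⟨he1, he2⟩
    refine ⟨he1, fun a => ?_⟩
    rw [Wm_ap]
    exact (he2 a).le)
  have hne : {y | (y, e) ∈ S}.Nonempty := by
    rw [Set.nonempty_iff_ne_empty]
    intro h0
    rw [h0, measureReal_empty] at he
    have : 0 < p0 / 2 * δ := by positivity
    linarith
  obtain ⟨y0, hy0⟩ := hne
  have h1 : D ^ 2 / 2 ≤ nrm (ev (Phi n M) e) ^ 2 := hy0.1
  rw [nrm_ev_Phi, ← hR] at h1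
  have hsb := small_ball (fun a i => Wm M e a i) (η := Λ * ε) (by positivity)
  set dt := Matrix.det (Matrix.of fun a b => ∑ i, Wm M e a i * Wm M e b i) with hdt
  have h2 : p0 / 2 * δ * Real.sqrt dt ≤ (2 * (Λ * ε)) ^ R := by
    refine le_trans ?_ hsb
    gcongr
    refine he.trans (measureReal_mono fun y hy => ?_)
    exact hy.2
  have hDle : D ≤ Real.sqrt (2 * R.factorial) * Real.sqrt dt := by
    rw [← Real.sqrt_mul (by positivity)]
    apply Real.le_sqrt_of_sq_le
    linarith
  rw [le_div_iff₀ hδ]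
  calc D * δ ≤ Real.sqrt (2 * R.factorial) * Real.sqrt dt * δ := by gcongr
    _ = Real.sqrt (2 * R.factorial) * (2 / p0) * (p0 / 2 * δ * Real.sqrt dt) := by field_simp
    _ ≤ Real.sqrt (2 * R.factorial) * (2 / p0) * (2 * (Λ * ε)) ^ R := by gcongr
    _ = _ := by rw [← mul_assoc 2 Λ ε, mul_pow (2 * Λ)]; ring
end upper

section sk
variable {n I J : Type} [Fintype n] [DecidableEq n] [Fintype I] [Fintype J]

lemma nrm_ev_ev_Phi (M : I × J → ℝ) (e : n → J → ℝ) (f : n → I → ℝ) : nrm (ev (ev (Phi n M) e) f) = |(Am M e f).det| := by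
  rw [nrm_unit, ev_ev_Phi]

lemma measurable_detAm (M : I × J → ℝ) : Measurable fun z : (n → J → ℝ) × (n → I → ℝ) => (Am M z.1 z.2).det := by
  have h := measurable_ev2 (Phi n M)
  have h2 : (fun z : (n → J → ℝ) × (n → I → ℝ) => (Am M z.1 z.2).det) = fun z => ev (ev (Phi n M) z.1) z.2 () := by
    funext z; rw [ev_ev_Phi]
  rw [h2]
  exact (measurable_pi_iff.mp h) ()

lemma det_event (M : I × J → ℝ) (hD : 0 < nrm (Phi n M)) :
    1 / (4 * (mq 2 ^ Fintype.card n * mq 2 ^ Fintype.card n)) ≤ ((gamS n J).prod (gamS n I)).real {z | nrm (Phi n M) ^ 2 / 2 ≤ (Am M z.1 z.2).det ^ 2} := by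
  have hp := mq_pos 2
  have h1 := ev2_second (Phi n M)
  have h2 := ev2_moment 2 (Phi n M)
  simp only [nrm_ev_ev_Phi, sq_abs] at h1 h2
  exact paley_zygmund _ ((measurable_detAm M).pow_const 2) (fun z => sq_nonneg _) (by positivity) (by positivity) h1 h2

lemma det_tail (M : I × J → ℝ) {L : ℝ} (hL : 0 < L) :
    ((gamS n J).prod (gamS n I)).real {z | L ≤ |(Am M z.1 z.2).det|} ≤ (nrm (Phi n M) / L) ^ 2 := by
  have h1 := ev2_second (Phi n M)
  simp only [nrm_ev_ev_Phi, sq_abs] at h1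
  have := markov ((gamS n J).prod (gamS n I)) ((measurable_detAm M).pow_const 2) (B := nrm (Phi n M) ^ 2) (L := L ^ 2) (by positivity) (by positivity) h1.le
  rw [div_pow]
  refine le_trans (le_of_eq ?_) this
  congr 1
  ext z
  simp only [Set.mem_setOf_eq]
  rw [← sq_abs (Am M z.1 z.2).det]
  exact (pow_le_pow_iff_left₀ hL.le (abs_nonneg _) two_ne_zero).symm

lemma bord_tail (M : I × J → ℝ) {L : ℝ} (hL : 0 < L) :
    ((gamS n J).prod (gamS n I)).real {z | L ≤ nrm (ev (ev (Phib n M) z.1) z.2)} ≤ (nrm (Phi (n ⊕ Unit) M) / L) ^ 2 := by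
  have h1 := ev2_second (Phib n M)
  have hm : Measurable fun z : (n → J → ℝ) × (n → I → ℝ) => nrm (ev (ev (Phib n M) z.1) z.2) := measurable_nrm.comp (measurable_ev2 _)
  rw [nrm_Phib] at h1
  have := markov ((gamS n J).prod (gamS n I)) (hm.pow_const 2) (B := nrm (Phi (n ⊕ Unit) M) ^ 2) (L := L ^ 2) (by positivity) (by positivity) h1.le
  rw [div_pow]
  refine le_trans (le_of_eq ?_) this
  congr 1
  ext z
  simp only [Set.mem_setOf_eq]
  exact (pow_le_pow_iff_left₀ hL.le (nrm_nonneg _) two_ne_zero).symm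

lemma adj_tail (s : ℕ) (M : I × J → ℝ) (a b : Fin (s + 1)) {L : ℝ} (hL : 0 < L) :
    ((gamS (Fin (s + 1)) J).prod (gamS (Fin (s + 1)) I)).real {z | L ≤ |(Am M z.1 z.2).adjugate b a|} ≤ (nrm (Phi (Fin s) M) / L) ^ 2 := by
  have mp := (mp_comp_inj (gam J) a.succAbove Fin.succAbove_right_injective).prod (mp_comp_inj (gam I) b.succAbove Fin.succAbove_right_injective)
  refine le_trans (le_of_eq ?_) (det_tail (n := Fin s) M hL)
  have hm : MeasurableSet {z : (Fin s → J → ℝ) × (Fin s → I → ℝ) | L ≤ |(Am M z.1 z.2).det|} :=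
    measurableSet_le measurable_const (measurable_detAm M).abs
  rw [measureReal_def, measureReal_def, ← mp.measure_preimage hm.nullMeasurableSet]
  congr 2
  ext z
  simp only [Set.mem_setOf_eq, Set.mem_preimage, Matrix.adjugate_fin_succ_eq_det_submatrix, abs_mul, abs_pow, abs_neg, abs_one, one_pow, one_mul]
  rfl

theorem gap_event (r : ℕ) : ∃ C p : ℝ, 0 < C ∧ 0 < p ∧ ∀ (I J : Type) [Fintype I] [Fintype J] (M : I × J → ℝ) (τ : ℝ), 0 < τ →
    0 < nrm (Phi (Fin r) M) → nrm (Phi (Fin (r + 1)) M) ≤ τ * nrm (Phi (Fin r) M) →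
    (∀ s, r = s + 1 → τ * nrm (Phi (Fin s) M) ≤ nrm (Phi (Fin r) M)) →
    p ≤ ((gamS (Fin r) J).prod (gamS (Fin r) I)).real {z | (∀ a b, |(Am M z.1 z.2)⁻¹ b a| ≤ C / τ) ∧ nrm (Res M z.1 z.2) ≤ C * τ} := by
  have hp := mq_pos 2
  set p1 : ℝ := 1 / (4 * (mq 2 ^ Fintype.card (Fin r) * mq 2 ^ Fintype.card (Fin r))) with hp1
  have hp1pos : 0 < p1 := by positivity
  set Λ : ℝ := Real.sqrt (2 * (r * r + 1) / p1) with hΛ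
  have hΛpos : 0 < Λ := Real.sqrt_pos.mpr (by positivity)
  have hΛsq : Λ ^ 2 = 2 * (r * r + 1) / p1 := Real.sq_sqrt (by positivity)
  refine ⟨2 * Λ, p1 / 2, by positivity, by positivity, ?_⟩
  intro I J _ _ M τ hτ hD h1 h2
  set D := nrm (Phi (Fin r) M) with hDdef
  let μ := (gamS (Fin r) J).prod (gamS (Fin r) I)
  have hdet := det_event M hD
  let T1 : Set ((Fin r → J → ℝ) × (Fin r → I → ℝ)) := {z | Λ * (τ * D) ≤ nrm (ev (ev (Phib (Fin r) M) z.1) z.2)}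
  let T2 : Fin r × Fin r → Set ((Fin r → J → ℝ) × (Fin r → I → ℝ)) := fun ab => {z | Λ * (D / τ) ≤ |(Am M z.1 z.2).adjugate ab.2 ab.1|}
  let T := (T1 ∪ ⋃ ab ∈ (Finset.univ : Finset (Fin r × Fin r)), T2 ab)
  have hT1m : MeasurableSet T1 := measurableSet_le measurable_const (measurable_nrm.comp (measurable_ev2 _))
  have hT2m : ∀ ab, MeasurableSet (T2 ab) := by
    intro ab
    refine measurableSet_le measurable_const ?_
    rcases r with _ | s
    · exact ab.1.elim0
    simp only [Matrix.adjugate_fin_succ_eq_det_submatrix]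
    refine Measurable.abs (Measurable.const_mul ?_ _)
    have := (measurable_detAm (n := Fin s) M).comp ((mp_comp_inj (gam J) ab.1.succAbove Fin.succAbove_right_injective).prod (mp_comp_inj (gam I) ab.2.succAbove Fin.succAbove_right_injective)).measurable
    exact this
  have hTm : MeasurableSet T := hT1m.union (Finset.measurableSet_biUnion _ fun ab _ => hT2m ab)
  have b1 : μ.real T1 ≤ 1 / Λ ^ 2 := by
    refine (bord_tail M (by positivity)).trans ?_
    rw [nrm_Phi_congr (finSumFinEquiv.symm.trans (Equiv.sumCongr (Equiv.refl (Fin r)) finOneEquiv)).symm M]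
    rw [div_pow, div_le_div_iff₀ (by positivity) (by positivity), mul_pow]
    have : nrm (Phi (Fin (r + 1)) M) ^ 2 ≤ (τ * D) ^ 2 := by
      have := nrm_nonneg (Phi (Fin (r + 1)) M); gcongr
    have h0 : 0 < Λ ^ 2 := by positivity
    nlinarith
  have b2 : ∀ ab, μ.real (T2 ab) ≤ 1 / Λ ^ 2 := by
    intro ab
    rcases r with _ | s
    · exact ab.1.elim0
    refine (adj_tail s M ab.1 ab.2 (by positivity)).trans ?_
    have h3 : nrm (Phi (Fin s) M) ≤ D / τ := by rw [le_div_iff₀ hτ]; linarith [h2 s rfl]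
    rw [div_pow, div_le_div_iff₀ (by positivity) (by positivity), mul_pow]
    have : nrm (Phi (Fin s) M) ^ 2 ≤ (D / τ) ^ 2 := by
      have := nrm_nonneg (Phi (Fin s) M); gcongr
    have h0 : 0 < Λ ^ 2 := by positivity
    nlinarith
  have hTb : μ.real Tᶜᶜ ≤ p1 / 2 := by
    rw [compl_compl]
    calc μ.real T ≤ μ.real T1 + μ.real (⋃ ab ∈ (Finset.univ : Finset (Fin r × Fin r)), T2 ab) := measureReal_union_le _ _
      _ ≤ 1 / Λ ^ 2 + ∑ ab : Fin r × Fin r, 1 / Λ ^ 2 := by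
          refine add_le_add b1 ((measureReal_biUnion_finset_le _ _).trans (Finset.sum_le_sum fun ab _ => b2 ab))
      _ = (r * r + 1) / Λ ^ 2 := by simp; ring
      _ ≤ p1 / 2 := by
          rw [hΛsq]; apply le_of_eq; field_simp
  have hfin := inter_ge μ hTm.compl hdet hTb
  refine le_trans (by linarith) (hfin.trans (measureReal_mono ?_))
  rintro z ⟨hz1, hz2⟩
  simp only [T, Set.mem_compl_iff, Set.mem_union, Set.mem_iUnion, not_or, not_exists, T1, T2, Set.mem_setOf_eq, not_le] at hz1 hz2
  obtain ⟨hz3, hz4⟩ := hz2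
  set dt := (Am M z.1 z.2).det with hdt
  have hdl : D / 2 ≤ |dt| := by
    apply abs_le_of_sq_le_sq' _ (abs_nonneg _) |>.2
    rw [sq_abs]; nlinarith
  have hdt0 : dt ≠ 0 := by
    intro h0; rw [h0, abs_zero] at hdl; linarith
  have hdtpos : 0 < |dt| := abs_pos.mpr hdt0
  constructor
  · intro a b
    rw [Matrix.inv_def, Matrix.smul_apply, smul_eq_mul, Ring.inverse_eq_inv', abs_mul, abs_inv]
    rw [inv_mul_le_iff₀ hdtpos]
    refine (hz4 (a, b) (Finset.mem_univ _)).le.trans ?_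
    calc Λ * (D / τ) = (D / 2) * (2 * Λ / τ) := by ring
      _ ≤ _ := by gcongr
  · have hs := schur M z.1 z.2 hdt0
    rw [hs, nrm_smul] at hz3
    have : D / 2 * nrm (Res M z.1 z.2) ≤ Λ * (τ * D) := le_trans (by have := nrm_nonneg (Res M z.1 z.2); gcongr) hz3.le
    have h5 : D * nrm (Res M z.1 z.2) ≤ D * (2 * Λ * τ) := by linarith
    exact le_of_mul_le_mul_left h5 hD
end sk

theorem sketch (N : ℝ) : ∃ (R : ℕ) (p : ℕ → ℝ), (∀ r, 0 < p r) ∧ ∀ᶠ ε : ℝ in 𝓝[>] 0,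
    ∀ (I J : Type) [Fintype I] [Fintype J] (M : I × J → ℝ), ε ^ N ≤ (gam I).real {y | nrm (ap M y) ≤ ε} →
    ∃ r ∈ Finset.range R, p r ≤ ((gamS (Fin r) J).prod (gamS (Fin r) I)).real
      {z | (∀ a b, |(Am M z.1 z.2)⁻¹ b a| ≤ ε ^ (-(51/100) : ℝ)) ∧ nrm (Res M z.1 z.2) ≤ ε ^ (49/100 : ℝ)} := by
  choose C p hC hp hgap using gap_event
  obtain ⟨R, hR⟩ := exists_nat_gt (2 * N)
  obtain ⟨C0, hC0, hup⟩ := D_upper (Fin R)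
  refine ⟨R, p, hp, ?_⟩
  have hlt : (R:ℝ) / 2 < (R:ℝ) - N := by linarith
  have ev1 : ∀ᶠ ε : ℝ in 𝓝[>] 0, ∀ r ∈ Finset.range R, C r * ε ^ (-(1/2):ℝ) ≤ ε ^ (-(51/100) : ℝ) := by
    rw [Filter.eventually_all_finset]
    intro r _; exact eps_pow (C r) (by norm_num)
  have ev2 : ∀ᶠ ε : ℝ in 𝓝[>] 0, ∀ r ∈ Finset.range R, C r * ε ^ (1/2:ℝ) ≤ ε ^ (49/100 : ℝ) := by
    rw [Filter.eventually_all_finset]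
    intro r _; exact eps_pow (C r) (by norm_num)
  filter_upwards [ev1, ev2, eps_pow (2 * C0) hlt, eps_pos] with ε h1 h2 h3 hε I J _ _ M hM
  set τ : ℝ := ε ^ (1/2:ℝ) with hτ
  have hτpos : 0 < τ := Real.rpow_pos_of_pos hε _
  set D : ℕ → ℝ := fun r => nrm (Phi (Fin r) M) with hD
  have hD0 : D 0 = 1 := by
    simp [hD, nrm, Phi]
  have hex : ∃ r, r < R ∧ D (r + 1) < τ * D r := by
    by_contra hcon
    push Not at hcon
    have hind : ∀ r, r ≤ R → τ ^ r ≤ D r := by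
      intro r
      induction r with
      | zero => intro _; simp [hD0]
      | succ r ih =>
        intro hr
        have := hcon r (by omega)
        have h5 := ih (by omega)
        rw [pow_succ']
        nlinarith
    have h4 := hup I J M ε (ε ^ N) hε (Real.rpow_pos_of_pos hε _) hM
    rw [Fintype.card_fin] at h4
    have h5 := hind R le_rfl
    have h6 : C0 * ε ^ R / ε ^ N = C0 * ε ^ ((R:ℝ) - N) := by
      rw [Real.rpow_sub hε, Real.rpow_natCast]; ring
    have h7 : τ ^ R = ε ^ ((R:ℝ)/2) := by
      rw [hτ, ← Real.rpow_natCast, ← Real.rpow_mul hε.le]; congr 1; ring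
    rw [h6] at h4
    rw [h7] at h5
    have h8 : 0 < C0 * ε ^ ((R:ℝ) - N) := by positivity
    have h9 : D R ≤ C0 * ε ^ ((R:ℝ) - N) := h4
    linarith
  classical
  let r := Nat.find hex
  have hr : r < R ∧ D (r + 1) < τ * D r := Nat.find_spec hex
  have hmin : ∀ s, s < r → τ * D s ≤ D (s + 1) := by
    intro s hs
    have := Nat.find_min hex hs
    push Not at this
    exact this (by omega)
  have hpos : ∀ s, s ≤ r → 0 < D s := by
    intro s
    induction s with
    | zero => intro _; rw [hD0]; norm_num
    | succ s ih =>
      intro hs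
      have := ih (by omega)
      have h5 := hmin s (by omega)
      have : 0 < τ * D s := by positivity
      linarith
  have hrR : r ∈ Finset.range R := Finset.mem_range.mpr hr.1
  refine ⟨r, hrR, ?_⟩
  refine (hgap r I J M τ hτpos (hpos r le_rfl) hr.2.le (fun s hs => ?_)).trans (measureReal_mono ?_)
  · have := hmin s (by omega)
    have h5 : D (s + 1) = D r := by rw [hs]
    rw [h5] at this
    exact this
  · rintro z ⟨hz1, hz2⟩
    refine ⟨fun a b => (hz1 a b).trans ?_, hz2.trans (h2 r hrR)⟩
    refine le_trans (le_of_eq ?_) (h1 r hrR)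
    rw [hτ, Real.rpow_neg hε.le]; rfl

section slices
variable {κ I J : Type} [Fintype κ] [DecidableEq κ] [Fintype I] [Fintype J]

/-- splitting by a subset -/
def eS (S : Finset κ) : {s // s ∈ S} ⊕ {s // s ∉ S} ≃ κ := Equiv.sumCompl (· ∈ S)
/-- splitting by a subset, second form -/
def eS' (S : Finset κ) : {s // s ∈ S} ⊕ {s // s ∈ Sᶜ} ≃ κ :=
  (Equiv.sumCongr (Equiv.refl _) (Equiv.subtypeEquivRight fun s => Finset.mem_compl)).trans (eS S)

lemma eS_inl (S : Finset κ) (a : {s // s ∈ S}) : eS S (Sum.inl a) = a.1 := rfl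
lemma eS_inr (S : Finset κ) (a : {s // s ∉ S}) : eS S (Sum.inr a) = a.1 := rfl
lemma eS'_inl (S : Finset κ) (a : {s // s ∈ S}) : eS' S (Sum.inl a) = a.1 := rfl
lemma eS'_inr (S : Finset κ) (a : {s // s ∈ Sᶜ}) : eS' S (Sum.inr a) = a.1 := rfl

/-- slices -/
noncomputable def slS (S : Finset κ) (F : (κ → I) × J → ℝ) (c : κ → I → ℝ) : ({s // s ∈ S} → I) × J → ℝ :=
  sl (eS S) F (fun b => c b.1)

lemma ev_mix (S : Finset κ) (F : (κ → I) × J → ℝ) (c x : κ → I → ℝ) :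
    ev F (mix S x c) = ev (slS S F c) (fun a => x a.1) := by
  rw [slS, ev_sl]
  congr 1
  funext s
  by_cases h : s ∈ S
  · have : (eS S).symm s = Sum.inl ⟨s, h⟩ := by rw [Equiv.symm_apply_eq]; rfl
    simp [splitE, this, mix, h]
  · have : (eS S).symm s = Sum.inr ⟨s, h⟩ := by rw [Equiv.symm_apply_eq]; rfl
    simp [splitE, this, mix, h]

lemma slS_tail (q : ℕ) (S : Finset κ) (F : (κ → I) × J → ℝ) {L : ℝ} (hL : 0 < L) :
    (gamS κ I).real {c | L ≤ nrm (slS S F c)} ≤ mq q ^ Fintype.card {s // s ∉ S} * ((nrm F / L) ^ 2) ^ q := by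
  have := tail_high q (fun b : {s // s ∉ S} => b.1) Subtype.val_injective (rearr (eS S) F) hL
  rw [nrm_rearr] at this
  exact this

lemma measurable_slS (S : Finset κ) (F : (κ → I) × J → ℝ) : Measurable fun c : κ → I → ℝ => nrm (slS S F c) := by
  have h : Measurable fun c : κ → I → ℝ => fun b : {s // s ∉ S} => c b.1 := by fun_prop
  exact measurable_nrm.comp ((measurable_ev (rearr (eS S) F)).comp h)

/-- the product term -/
noncomputable def Qt (S : Finset κ) (F : (κ → I) × J → ℝ) (W : (κ → I) × I → ℝ) (c : κ → I → ℝ) : (Option κ → I) × J → ℝ :=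
  fun z => slS S F c (fun a => z.1 (some a.1), z.2) * slS Sᶜ W c (fun a => z.1 (some a.1), z.1 none)

lemma ev_cur_Qt (S : Finset κ) (F : (κ → I) × J → ℝ) (W : (κ → I) × I → ℝ) (c x : κ → I → ℝ) (z : I × J) :
    ev (cur (Qt S F W c)) x z = ev F (mix S x c) z.2 * ev W (mix Sᶜ x c) z.1 := by
  rw [ev_mix, ev_mix]
  simp only [ev]
  rw [← Equiv.sum_comp (splitE I (eS' S)).symm, Finset.sum_mul_sum, ← Fintype.sum_prod_type']
  refine Finset.sum_congr rfl fun w _ => ?_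
  rw [prod_split (eS' S)]
  have h1 : ∀ a : {s // s ∈ S}, (splitE I (eS' S)).symm w a.1 = w.1 a := by
    intro a; rw [← eS'_inl]; simp [splitE]
  have h2 : ∀ a : {s // s ∈ Sᶜ}, (splitE I (eS' S)).symm w a.1 = w.2 a := by
    intro a; rw [← eS'_inr]; simp [splitE]
  simp only [cur, Qt, ocons_some, ocons_none, h1, h2, eS'_inl, eS'_inr]
  ring

/-- equivalence used for the product term -/
def eO {κ1 κ2 : Type} (e : κ2 ⊕ κ1 ≃ κ) : Option κ1 ⊕ κ2 ≃ Option κ where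
  toFun := Sum.elim (fun o => o.elim none (fun a => some (e (Sum.inr a)))) (fun b => some (e (Sum.inl b)))
  invFun o := o.elim (Sum.inl none) (fun s => Sum.elim (fun b => Sum.inr b) (fun a => Sum.inl (some a)) (e.symm s))
  left_inv x := by rcases x with (_ | a) | b <;> simp
  right_inv o := by
    rcases o with _ | s
    · rfl
    · obtain ⟨w, rfl⟩ := e.surjective s
      rcases w with b | a <;> simp

lemma isProd_Qt (S : Finset κ) (F : (κ → I) × J → ℝ) (W : (κ → I) × I → ℝ) (c : κ → I → ℝ) :
    IsProd (Qt S F W c) ∧ nrm (Qt S F W c) = nrm (slS Sᶜ W c) * nrm (slS S F c) := by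
  let u : (Option {s // s ∈ Sᶜ} → I) × Unit → ℝ := fun z => slS Sᶜ W c (fun a => z.1 (some a), z.1 none)
  let v := slS S F c
  have huv : ∀ i j, Qt S F W c (i, j) = u (fun a => i (eO (eS' S) (Sum.inl a)), ()) * v (fun b => i (eO (eS' S) (Sum.inr b)), j) := by
    intro i j
    simp only [Qt, u, v]
    rw [mul_comm]; rfl
  refine ⟨⟨Option {s // s ∈ Sᶜ}, {s // s ∈ S}, inferInstance, inferInstance, inferInstance, inferInstance, eO (eS' S), inferInstance, u, v, huv⟩, ?_⟩
  rw [isProd_nrm (eO (eS' S)) huv]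
  congr 1
  let E : (Option {s // s ∈ Sᶜ} → I) × Unit ≃ ({s // s ∈ Sᶜ} → I) × I :=
    { toFun := fun z => (fun a => z.1 (some a), z.1 none)
      invFun := fun z => (ocons z.2 z.1, ())
      left_inv := fun z => by refine Prod.ext ?_ rfl; funext o; cases o <;> rfl
      right_inv := fun z => rfl }
  exact nrm_comp_equiv E (slS Sᶜ W c)

/-- inverse of `cur` -/
def unc (s : (κ → I) × (I × J) → ℝ) : (Option κ → I) × J → ℝ := fun z => s (fun a => z.1 (some a), (z.1 none, z.2))

lemma cur_unc (s : (κ → I) × (I × J) → ℝ) : cur (unc s) = s := rfl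
lemma unc_cur (s : (Option κ → I) × J → ℝ) : unc (cur s) = s := by
  funext z
  exact congrArg s (curE.right_inv z)
lemma nrm_unc (s : (κ → I) × (I × J) → ℝ) : nrm (unc s) = nrm s := by rw [← nrm_cur, cur_unc]

/-- equivalence used for uncurrying -/
def eO2 {κ1 κ2 : Type} (e : κ1 ⊕ κ2 ≃ κ) : κ1 ⊕ Option κ2 ≃ Option κ where
  toFun := Sum.elim (fun a => some (e (Sum.inl a))) (fun o => o.elim none (fun b => some (e (Sum.inr b))))
  invFun o := o.elim (Sum.inr none) (fun s => Sum.elim (fun a => Sum.inl a) (fun b => Sum.inr (some b)) (e.symm s))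
  left_inv x := by rcases x with a | (_ | b) <;> simp
  right_inv o := by
    rcases o with _ | s
    · rfl
    · obtain ⟨w, rfl⟩ := e.surjective s
      rcases w with b | a <;> simp

lemma isProd_unc {s : (κ → I) × (I × J) → ℝ} (h : IsProd s) : IsProd (unc s) := by
  obtain ⟨κ1, κ2, _, _, _, _, e, hn, u, v, huv⟩ := h
  refine ⟨κ1, Option κ2, inferInstance, inferInstance, inferInstance, inferInstance, eO2 e, hn, u, unc v, fun i j => ?_⟩
  simp only [unc, huv]
  rfl

lemma cur_sub (s t : (Option κ → I) × J → ℝ) : cur (s - t) = cur s - cur t := rfl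
end slices

lemma rev_markov {X Y : Type} [MeasurableSpace X] [MeasurableSpace Y] (ν : Measure Y) (μ : Measure X) [IsProbabilityMeasure μ]
    [IsProbabilityMeasure ν] {S : Set (Y × X)} (hS : MeasurableSet S) {η : ℝ} (hη : 0 ≤ η) (h : 2 * η ≤ (ν.prod μ).real S) :
    η ≤ μ.real {x | η ≤ ν.real {y | (y, x) ∈ S}} := by
  set G := {x | η ≤ ν.real {y | (y, x) ∈ S}} with hG
  have hm : Measurable fun x => ν {y | (y, x) ∈ S} := measurable_measure_prodMk_right hS
  have hGm : MeasurableSet G := measurableSet_le measurable_const hm.ennreal_toReal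
  have h1 : (ν.prod μ) S ≤ μ G + ENNReal.ofReal η := by
    rw [Measure.prod_apply_symm hS]
    calc _ ≤ ∫⁻ x, (G.indicator 1 x + ENNReal.ofReal η) ∂μ := by
          refine lintegral_mono fun x => ?_
          by_cases hx : x ∈ G
          · simp only [hx, Set.indicator_of_mem, Pi.one_apply]
            exact prob_le_one.trans le_self_add
          · simp only [hx, not_false_eq_true, Set.indicator_of_notMem, zero_add]
            simp only [hG, Set.mem_setOf_eq, not_le] at hx
            rw [ENNReal.le_ofReal_iff_toReal_le (measure_ne_top _ _) hη]
            exact hx.le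
      _ = _ := by
          rw [lintegral_add_right _ measurable_const, lintegral_indicator_one hGm]; simp
  have h2 := ENNReal.toReal_mono (by finiteness) h1
  rw [ENNReal.toReal_add (measure_ne_top _ _) ENNReal.ofReal_ne_top, ENNReal.toReal_ofReal hη] at h2
  simp only [measureReal_def] at h ⊢
  linarith

section stepA
variable {n κ I J : Type} [Fintype n] [DecidableEq n] [Fintype κ] [DecidableEq κ] [Fintype I] [Fintype J]

/-- column sketch tensor -/
noncomputable def Ft (T : (κ → I) × (I × J) → ℝ) (f : I → ℝ) : (κ → I) × J → ℝ := fun z => ∑ ii, T (z.1, (ii, z.2)) * f ii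
/-- row sketch tensor -/
noncomputable def Wt (T : (κ → I) × (I × J) → ℝ) (e : J → ℝ) : (κ → I) × I → ℝ := fun z => ∑ j, T (z.1, (z.2, j)) * e j

lemma ev_Ft (T : (κ → I) × (I × J) → ℝ) (f : I → ℝ) (x : κ → I → ℝ) (j : J) : ev (Ft T f) x j = ap (ev T x) f j := by
  simp only [ev, Ft, ap, Finset.sum_mul]
  rw [Finset.sum_comm]
  exact Finset.sum_congr rfl fun i _ => Finset.sum_congr rfl fun k _ => by ring
lemma ev_Wt (T : (κ → I) × (I × J) → ℝ) (e : n → J → ℝ) (a : n) (x : κ → I → ℝ) (i : I) : ev (Wt T (e a)) x i = Wm (ev T x) e a i := by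
  simp only [ev, Wt, Wm, Finset.sum_mul, Finset.mul_sum]
  rw [Finset.sum_comm]
  exact Finset.sum_congr rfl fun i _ => Finset.sum_congr rfl fun k _ => by ring

lemma Ft_tail (T : (κ → I) × (I × J) → ℝ) (b : n) {L : ℝ} (hL : 0 < L) :
    (gamS n I).real {f | L ≤ nrm (Ft T (f b))} ≤ (nrm T / L) ^ 2 := by
  let T' : (Unit → I) × ((κ → I) × J) → ℝ := fun z => T (z.2.1, (z.1 (), z.2.2))
  have h := tail_second (κ := n) (I := I) (fun _ : Unit => b) (fun _ _ _ => rfl) T' hL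
  let E : (Unit → I) × ((κ → I) × J) ≃ (κ → I) × (I × J) :=
    { toFun := fun z => (z.2.1, (z.1 (), z.2.2))
      invFun := fun z => (fun _ => z.2.1, (z.1, z.2.2))
      left_inv := fun z => rfl
      right_inv := fun z => rfl }
  have h1 : nrm T' = nrm T := nrm_comp_equiv E T
  have h2 : ∀ f : n → I → ℝ, ev T' (fun _ : Unit => f b) = Ft T (f b) := by
    intro f; funext z
    simp only [ev, Ft]
    rw [← Equiv.sum_comp (Equiv.funUnique Unit I).symm]
    refine Finset.sum_congr rfl fun j _ => ?_
    simp [T']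
  rw [h1] at h
  simpa only [h2] using h

lemma Wt_tail (T : (κ → I) × (I × J) → ℝ) (b : n) {L : ℝ} (hL : 0 < L) :
    (gamS n J).real {f | L ≤ nrm (Wt T (f b))} ≤ (nrm T / L) ^ 2 := by
  let T' : (Unit → J) × ((κ → I) × I) → ℝ := fun z => T (z.2.1, (z.2.2, z.1 ()))
  have h := tail_second (κ := n) (I := J) (fun _ : Unit => b) (fun _ _ _ => rfl) T' hL
  let E : (Unit → J) × ((κ → I) × I) ≃ (κ → I) × (I × J) :=
    { toFun := fun z => (z.2.1, (z.2.2, z.1 ()))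
      invFun := fun z => (fun _ => z.2.2, (z.1, z.2.1))
      left_inv := fun z => rfl
      right_inv := fun z => rfl }
  have h1 : nrm T' = nrm T := nrm_comp_equiv E T
  have h2 : ∀ f : n → J → ℝ, ev T' (fun _ : Unit => f b) = Wt T (f b) := by
    intro f; funext z
    simp only [ev, Wt]
    rw [← Equiv.sum_comp (Equiv.funUnique Unit J).symm]
    refine Finset.sum_congr rfl fun j _ => ?_
    simp [T']
  rw [h1] at h
  simpa only [h2] using h

lemma measurable_Ft (T : (κ → I) × (I × J) → ℝ) : Measurable (Ft T) := by unfold Ft; fun_prop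
lemma measurable_Wt (T : (κ → I) × (I × J) → ℝ) : Measurable (Wt T) := by unfold Wt; fun_prop

/-- bad events for the sketch tensors -/
lemma E0_bound (T : (κ → I) × (I × J) → ℝ) {L : ℝ} (hL : 0 < L) :
    ((gamS n J).prod (gamS n I)).real {z | ∀ a, nrm (Ft T (z.2 a)) < L ∧ nrm (Wt T (z.1 a)) < L}ᶜ ≤ 2 * Fintype.card n * (nrm T / L) ^ 2 := by
  have hsub : {z : (n → J → ℝ) × (n → I → ℝ) | ∀ a, nrm (Ft T (z.2 a)) < L ∧ nrm (Wt T (z.1 a)) < L}ᶜ ⊆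
      ⋃ a ∈ (Finset.univ : Finset n), (Prod.snd ⁻¹' {f | L ≤ nrm (Ft T (f a))} ∪ Prod.fst ⁻¹' {e | L ≤ nrm (Wt T (e a))}) := by
    intro z hz
    simp only [Set.mem_compl_iff, Set.mem_setOf_eq, not_forall, not_and_or, not_lt] at hz
    obtain ⟨a, ha⟩ := hz
    simp only [Set.mem_iUnion]
    exact ⟨a, Finset.mem_univ _, ha⟩
  refine (measureReal_mono hsub (measure_ne_top _ _)).trans ((measureReal_biUnion_finset_le _ _).trans ?_)
  have : ∀ a ∈ (Finset.univ : Finset n), ((gamS n J).prod (gamS n I)).real (Prod.snd ⁻¹' {f | L ≤ nrm (Ft T (f a))} ∪ Prod.fst ⁻¹' {e | L ≤ nrm (Wt T (e a))}) ≤ 2 * (nrm T / L) ^ 2 := by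
    intro a _
    refine (measureReal_union_le _ _).trans ?_
    have m1 : MeasurableSet {f : n → I → ℝ | L ≤ nrm (Ft T (f a))} :=
      measurableSet_le measurable_const (measurable_nrm.comp ((measurable_Ft T).comp (measurable_pi_apply a)))
    have m2 : MeasurableSet {f : n → J → ℝ | L ≤ nrm (Wt T (f a))} :=
      measurableSet_le measurable_const (measurable_nrm.comp ((measurable_Wt T).comp (measurable_pi_apply a)))
    rw [measureReal_def, measureReal_def, (measurePreserving_snd (μ := gamS n J) (ν := gamS n I)).measure_preimage m1.nullMeasurableSet,
      (measurePreserving_fst (μ := gamS n J) (ν := gamS n I)).measure_preimage m2.nullMeasurableSet]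
    have := Ft_tail T a hL
    have := Wt_tail T a hL
    simp only [measureReal_def] at *
    linarith
  refine (Finset.sum_le_sum this).trans (le_of_eq ?_)
  simp [Finset.card_univ]; ring

lemma measurable_Aminv (T : (κ → I) × (I × J) → ℝ) (a b : n) :
    Measurable fun w : (κ → I → ℝ) × ((n → J → ℝ) × (n → I → ℝ)) => (Am (ev T w.1) w.2.1 w.2.2)⁻¹ b a := by
  have hc : Continuous fun w : (κ → I → ℝ) × ((n → J → ℝ) × (n → I → ℝ)) => Am (ev T w.1) w.2.1 w.2.2 := by
    refine continuous_matrix fun i j => ?_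
    simp only [Am, Wm, ev, Matrix.of_apply]
    fun_prop
  simp only [Matrix.inv_def, Matrix.smul_apply, smul_eq_mul, Ring.inverse_eq_inv']
  have h1 := hc.matrix_det.measurable
  have h2 := (hc.matrix_adjugate.matrix_elem b a).measurable
  exact h1.inv.mul h2

lemma measurable_Res (T : (κ → I) × (I × J) → ℝ) :
    Measurable fun w : (κ → I → ℝ) × ((n → J → ℝ) × (n → I → ℝ)) => Res (ev T w.1) w.2.1 w.2.2 := by
  refine measurable_pi_iff.mpr fun z => ?_
  simp only [Res]
  refine Measurable.sub ?_ (Finset.measurable_sum _ fun a _ => Finset.measurable_sum _ fun b _ => (measurable_Aminv T a b).mul ?_)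
  · simp only [ev]; fun_prop
  · simp only [ev, ap, Wm]; fun_prop

end stepA

theorem stepA (κ : Type) [Fintype κ] [DecidableEq κ] (N σ : ℝ) (hN : 0 < N) (hσ : 0 < σ) : ∃ R : ℕ, ∀ᶠ ε : ℝ in 𝓝[>] 0,
    ∀ (I J : Type) [Fintype I] [Fintype J] (t : (Option κ → I) × J → ℝ), nrm t ≤ 1 →
    ε ^ N ≤ (gamS (Option κ) I).real {x | nrm (ev t x) ≤ ε} →
    ∃ r < R, ∃ (e : Fin r → J → ℝ) (f : Fin r → I → ℝ), (∀ a, nrm (Ft (cur t) (f a)) ≤ ε ^ (-σ)) ∧ (∀ a, nrm (Wt (cur t) (e a)) ≤ ε ^ (-σ)) ∧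
      ε ^ (N + 2) ≤ (gamS κ I).real {x | (∀ a b, |(Am (ev (cur t) x) e f)⁻¹ b a| ≤ ε ^ (-(51/100) : ℝ)) ∧ nrm (Res (ev (cur t) x) e f) ≤ ε ^ (49/100 : ℝ)} := by
  obtain ⟨R, p, hp, hsk⟩ := sketch (N + 1)
  refine ⟨R, ?_⟩
  have ev1 : ∀ᶠ ε : ℝ in 𝓝[>] 0, ∀ r ∈ Finset.range R, (4 * r / p r) * ε ^ (2 * σ) ≤ ε ^ (0:ℝ) := by
    rw [Filter.eventually_all_finset]
    intro r _; exact eps_pow _ (by linarith)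
  have ev2 : ∀ᶠ ε : ℝ in 𝓝[>] 0, ∀ r ∈ Finset.range R, (2 * R / p r) * ε ^ (1:ℝ) ≤ ε ^ (0 : ℝ) := by
    rw [Filter.eventually_all_finset]
    intro r _; exact eps_pow _ (by norm_num)
  filter_upwards [ev1, ev2, hsk, eps_pow 2 (show (0:ℝ) < 1 by norm_num), eps_pos] with ε h1 h2 hsk h3 hε I J _ _ t ht hP
  rw [Real.rpow_one, Real.rpow_zero] at h3
  set T := cur t with hT
  have hTn : nrm T ≤ 1 := by rw [hT, nrm_cur]; exact ht
  have eN : ε ^ (N + 1) = ε ^ N * ε := by rw [Real.rpow_add hε, Real.rpow_one]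
  have eN2 : ε ^ (N + 2) = ε ^ (N + 1) * ε := by rw [← Real.rpow_add_one hε.ne']; congr 1; ring
  have hεN : 0 < ε ^ N := Real.rpow_pos_of_pos hε _
  have hεN1 : 0 < ε ^ (N + 1) := Real.rpow_pos_of_pos hε _
  -- pull back
  let S0 : Set ((I → ℝ) × (κ → I → ℝ)) := {w | nrm (ap (ev T w.2) w.1) ≤ ε}
  have hS0 : MeasurableSet S0 := by
    have h : Measurable fun w : (I → ℝ) × (κ → I → ℝ) => ap (ev T w.2) w.1 := by unfold ap ev; fun_prop
    exact measurableSet_le (measurable_nrm.comp h) measurable_const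
  have hP' : ε ^ N ≤ ((gam I).prod (gamS κ I)).real S0 := by
    refine hP.trans (le_of_eq ?_)
    have hm : MeasurableSet {x : Option κ → I → ℝ | nrm (ev t x) ≤ ε} := measurableSet_le (by fun_prop) measurable_const
    rw [measureReal_def, measureReal_def, ← (mp_ocons (gam I) (κ := κ)).measure_preimage hm.nullMeasurableSet]
    congr 2
    ext w
    simp only [Set.mem_preimage, Set.mem_setOf_eq, ev_ocons, S0, hT]
  have hG := rev_markov (gam I) (gamS κ I) hS0 hεN1.le (by rw [eN]; nlinarith)
  set G := {x : κ → I → ℝ | ε ^ (N + 1) ≤ (gam I).real {y | (y, x) ∈ S0}} with hGdef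
  -- the good relation
  let good : ∀ r, Set ((κ → I → ℝ) × ((Fin r → J → ℝ) × (Fin r → I → ℝ))) := fun r =>
    {w | (∀ a b, |(Am (ev T w.1) w.2.1 w.2.2)⁻¹ b a| ≤ ε ^ (-(51/100) : ℝ)) ∧ nrm (Res (ev T w.1) w.2.1 w.2.2) ≤ ε ^ (49/100 : ℝ)}
  have hgm : ∀ r, MeasurableSet (good r) := by
    intro r
    have e1 : good r = (⋂ a, ⋂ b, {w | |(Am (ev T w.1) w.2.1 w.2.2)⁻¹ b a| ≤ ε ^ (-(51/100) : ℝ)}) ∩ {w | nrm (Res (ev T w.1) w.2.1 w.2.2) ≤ ε ^ (49/100 : ℝ)} := by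
      ext w; simp [good]
    rw [e1]
    refine MeasurableSet.inter (MeasurableSet.iInter fun a => MeasurableSet.iInter fun b => ?_) ?_
    · exact measurableSet_le (measurable_Aminv T a b).abs measurable_const
    · exact measurableSet_le (measurable_nrm.comp (measurable_Res T)) measurable_const
  let A : ℕ → Set (κ → I → ℝ) := fun r => {x | p r ≤ ((gamS (Fin r) J).prod (gamS (Fin r) I)).real {z | (x, z) ∈ good r}}
  obtain ⟨r, hr, hAr⟩ := pigeon (gamS κ I) (Finset.range R) (G := G) A (by
    intro x hx
    obtain ⟨r, hr, h⟩ := hsk I J (ev T x) hx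
    simp only [Set.mem_iUnion]
    exact ⟨r, hr, h⟩) hεN1 hG
  have hrR : r < R := Finset.mem_range.mp hr
  have hRpos : (0:ℝ) < R := by exact_mod_cast (by omega : 0 < R)
  rw [Finset.card_range] at hAr
  let E0 : Set ((Fin r → J → ℝ) × (Fin r → I → ℝ)) := {z | ∀ a, nrm (Ft T (z.2 a)) < ε ^ (-σ) ∧ nrm (Wt T (z.1 a)) < ε ^ (-σ)}
  have hE0m : MeasurableSet E0 := by
    have e1 : E0 = ⋂ a, ({z | nrm (Ft T (z.2 a)) < ε ^ (-σ)} ∩ {z | nrm (Wt T (z.1 a)) < ε ^ (-σ)}) := by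
      ext z; simp [E0]
    rw [e1]
    refine MeasurableSet.iInter fun a => MeasurableSet.inter ?_ ?_
    · exact measurableSet_lt (measurable_nrm.comp ((measurable_Ft T).comp ((measurable_pi_apply a).comp measurable_snd))) measurable_const
    · exact measurableSet_lt (measurable_nrm.comp ((measurable_Wt T).comp ((measurable_pi_apply a).comp measurable_fst))) measurable_const
  have hE0 : ((gamS (Fin r) J).prod (gamS (Fin r) I)).real E0ᶜ ≤ p r / 2 := by
    have hLp : 0 < ε ^ (-σ) := Real.rpow_pos_of_pos hε _
    refine (E0_bound T hLp).trans ?_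
    rw [Fintype.card_fin]
    have h4 := h1 r hr
    rw [Real.rpow_zero] at h4
    have h5 : (nrm T / ε ^ (-σ)) ^ 2 ≤ ε ^ (2 * σ) := by
      have : nrm T / ε ^ (-σ) ≤ ε ^ σ := by
        rw [Real.rpow_neg hε.le, div_inv_eq_mul]
        have : 0 < ε ^ σ := Real.rpow_pos_of_pos hε _
        nlinarith
      calc _ ≤ (ε ^ σ) ^ 2 := by
            have := nrm_nonneg T; gcongr
        _ = _ := by rw [← Real.rpow_natCast, ← Real.rpow_mul hε.le]; congr 1; push_cast; ring
    have hpr := hp r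
    rw [div_mul_eq_mul_div, div_le_one hpr] at h4
    calc 2 * (r:ℝ) * (nrm T / ε ^ (-σ)) ^ 2 ≤ 2 * (r:ℝ) * ε ^ (2 * σ) := by gcongr
      _ ≤ _ := by linarith
  let S : Set ((κ → I → ℝ) × ((Fin r → J → ℝ) × (Fin r → I → ℝ))) := good r ∩ Prod.snd ⁻¹' E0
  have hSm : MeasurableSet S := (hgm r).inter (measurable_snd hE0m)
  have hpr := hp r
  obtain ⟨z, hz⟩ := fubini_choice (gamS κ I) ((gamS (Fin r) J).prod (gamS (Fin r) I)) hSm (p := p r / 2) (δ := ε ^ (N + 1) / R) (by positivity) (by positivity) (by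
    refine hAr.trans (measureReal_mono ?_)
    rintro x ⟨hx, -⟩
    have := inter_ge _ hE0m hx hE0
    refine le_trans (by linarith) this)
  have hzpos : ε ^ (N + 2) ≤ p r / 2 * (ε ^ (N + 1) / R) := by
    have h4 := h2 r hr
    rw [Real.rpow_zero, Real.rpow_one, div_mul_eq_mul_div, div_le_one hpr] at h4
    rw [eN2]
    have e1 : p r / 2 * (ε ^ (N + 1) / R) = ε ^ (N + 1) * (p r / (2 * R)) := by field_simp
    rw [e1]
    gcongr
    rw [le_div_iff₀ (by positivity)]; linarith
  have hne : {x | (x, z) ∈ S}.Nonempty := by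
    rw [Set.nonempty_iff_ne_empty]
    intro h0
    rw [h0, measureReal_empty] at hz
    have : 0 < p r / 2 * (ε ^ (N + 1) / R) := by positivity
    linarith
  obtain ⟨x0, hx0⟩ := hne
  have hzE : z ∈ E0 := hx0.2
  refine ⟨r, hrR, z.1, z.2, fun a => (hzE a).1.le, fun a => (hzE a).2.le, ?_⟩
  refine hzpos.trans (hz.trans (measureReal_mono ?_))
  intro x hx
  exact hx.1

section stepB
variable {κ I J : Type} [Fintype κ] [DecidableEq κ] [Fintype I] [Fintype J]

/-- model residual with frozen coefficient matrix -/
noncomputable def Mres {r : ℕ} (T : (κ → I) × (I × J) → ℝ) (F : Fin r → (κ → I) × J → ℝ) (W : Fin r → (κ → I) × I → ℝ)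
    (B : Fin r → Fin r → ℝ) (x : κ → I → ℝ) : I × J → ℝ :=
  fun z => ev T x z - ∑ a, ∑ b, B b a * (ev (F b) x z.2 * ev (W a) x z.1)

lemma measurable_Mres {r : ℕ} (T : (κ → I) × (I × J) → ℝ) (F : Fin r → (κ → I) × J → ℝ) (W : Fin r → (κ → I) × I → ℝ)
    (B : Fin r → Fin r → ℝ) : Measurable (fun x => nrm (Mres T F W B x)) := by
  refine measurable_nrm.comp ?_
  unfold Mres ev; fun_prop

lemma Mres_diff {r : ℕ} (T : (κ → I) × (I × J) → ℝ) (F : Fin r → (κ → I) × J → ℝ) (W : Fin r → (κ → I) × I → ℝ)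
    (B B' : Fin r → Fin r → ℝ) (x : κ → I → ℝ) {w L : ℝ} (hw : 0 ≤ w) (hL : 0 ≤ L) (h : ∀ a b, |B' b a - B b a| ≤ w)
    (hF : ∀ a, nrm (ev (F a) x) ≤ L) (hW : ∀ a, nrm (ev (W a) x) ≤ L) :
    nrm (Mres T F W B x) ≤ nrm (Mres T F W B' x) + (r:ℝ) ^ 2 * (w * L ^ 2) := by
  have e : Mres T F W B x = Mres T F W B' x + ∑ a, ∑ b, (B' b a - B b a) • fun z : I × J => ev (W a) x z.1 * ev (F b) x z.2 := by
    funext z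
    simp only [Mres, Pi.add_apply, Finset.sum_apply, Pi.smul_apply, smul_eq_mul]
    have : ∀ a b, (B' b a - B b a) * (ev (W a) x z.1 * ev (F b) x z.2) = B' b a * (ev (F b) x z.2 * ev (W a) x z.1) - B b a * (ev (F b) x z.2 * ev (W a) x z.1) := by
      intro a b; ring
    simp only [this, Finset.sum_sub_distrib]; ring
  rw [e]
  refine (nrm_add_le _ _).trans ?_
  gcongr
  refine (nrm_sum_le _ _).trans ?_
  calc _ ≤ ∑ a : Fin r, ∑ b : Fin r, w * L ^ 2 := by
        refine Finset.sum_le_sum fun a _ => (nrm_sum_le _ _).trans (Finset.sum_le_sum fun b _ => ?_)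
        rw [nrm_smul, nrm_mul]
        have := hF b; have := hW a; have := h a b
        have := nrm_nonneg (ev (F b) x); have := nrm_nonneg (ev (W a) x)
        rw [pow_two]
        gcongr <;> assumption
    _ = _ := by simp; ring

lemma Mres_eq_Res {r : ℕ} (T : (κ → I) × (I × J) → ℝ) (e : Fin r → J → ℝ) (f : Fin r → I → ℝ) (x : κ → I → ℝ) :
    Mres T (fun b => Ft T (f b)) (fun a => Wt T (e a)) (fun b a => (Am (ev T x) e f)⁻¹ b a) x = Res (ev T x) e f := by
  funext z
  simp only [Mres, Res, ev_Ft, ev_Wt]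
end stepB

theorem stepB (κ : Type) [Fintype κ] [DecidableEq κ] (N σ : ℝ) (hN : 0 < N) (hσ : 0 < σ) (hσ1 : σ ≤ 1) : ∃ (R : ℕ) (N3 : ℝ), 0 < N3 ∧ ∀ᶠ ε : ℝ in 𝓝[>] 0,
    ∀ (I J : Type) [Fintype I] [Fintype J] (t : (Option κ → I) × J → ℝ), nrm t ≤ 1 →
    ε ^ N ≤ (gamS (Option κ) I).real {x | nrm (ev t x) ≤ ε} →
    ∃ r < R, ∃ (F : Fin r → (κ → I) × J → ℝ) (W : Fin r → (κ → I) × I → ℝ) (B : Fin r → Fin r → ℝ),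
      (∀ a b, |B b a| ≤ ε ^ (-(51/100) : ℝ)) ∧ (∀ a, nrm (F a) ≤ ε ^ (-σ)) ∧ (∀ a, nrm (W a) ≤ ε ^ (-σ)) ∧
      ε ^ N3 ≤ (gamS κ I).real {x | nrm (Mres (cur t) F W B x) ≤ ε ^ (48/100 : ℝ)} := by
  obtain ⟨R, hA⟩ := stepA κ N σ hN hσ
  set L : ℝ := N + 4 with hL
  refine ⟨R, N + 3 + (2 * L + 2) * (R ^ 2 : ℕ), by positivity, ?_⟩
  filter_upwards [hA, eps_pos, eps_lt_one, eps_pow (4 * R) (show N + 2 < 2 * N + 6 by linarith), eps_pow 2 (show N + 2 < N + 3 by linarith),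
    eps_pow 5 (show -(2 * L + 2) < -(2 * L + 1 + 51 / 100) by linarith), eps_pow ((R:ℝ) ^ 2) (show (49/100 : ℝ) < 1 by norm_num),
    eps_pow 2 (show (48/100 : ℝ) < 49/100 by norm_num)] with ε hA h0 h1 e1 e2 e3 e4 e5 I J _ _ t ht hP
  obtain ⟨r, hr, e, f, hF, hW, hG⟩ := hA I J t ht hP
  set T := cur t with hT
  set F : Fin r → (κ → I) × J → ℝ := fun b => Ft T (f b) with hFd
  set W : Fin r → (κ → I) × I → ℝ := fun b => Wt T (e b) with hWd
  have hrR : (r:ℝ) ≤ R := by exact_mod_cast hr.le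
  set G := {x | (∀ a b, |(Am (ev T x) e f)⁻¹ b a| ≤ ε ^ (-(51/100) : ℝ)) ∧ nrm (Res (ev T x) e f) ≤ ε ^ (49/100 : ℝ)} with hGd
  let TT : Set (κ → I → ℝ) := {x | ∀ a, nrm (ev (F a) x) < ε ^ (-L) ∧ nrm (ev (W a) x) < ε ^ (-L)}
  have hTTm : MeasurableSet TT := by
    have e1 : TT = ⋂ a, ({x | nrm (ev (F a) x) < ε ^ (-L)} ∩ {x | nrm (ev (W a) x) < ε ^ (-L)}) := by ext z; simp [TT]
    rw [e1]
    refine MeasurableSet.iInter fun a => MeasurableSet.inter ?_ ?_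
    · exact measurableSet_lt (measurable_nrm.comp (measurable_ev _)) measurable_const
    · exact measurableSet_lt (measurable_nrm.comp (measurable_ev _)) measurable_const
  have hLp : 0 < ε ^ (-L) := Real.rpow_pos_of_pos h0 _
  have hq : ∀ y : ℝ, 0 ≤ y → y ≤ ε ^ (-σ) → (y / ε ^ (-L)) ^ 2 ≤ ε ^ (2 * N + 6) := by
    intro y hy hy2
    calc (y / ε ^ (-L)) ^ 2 ≤ (ε ^ (-σ) / ε ^ (-L)) ^ 2 := by gcongr
      _ = ε ^ (2 * (L - σ)) := by rw [← Real.rpow_sub h0, ← Real.rpow_natCast, ← Real.rpow_mul h0.le]; congr 1; push_cast; ring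
      _ ≤ _ := Real.rpow_le_rpow_of_exponent_ge h0 h1.le (by linarith)
  have hTT : (gamS κ I).real TTᶜ ≤ 2 * R * ε ^ (2 * N + 6) := by
    have hsub : TTᶜ ⊆ ⋃ a ∈ (Finset.univ : Finset (Fin r)), ({x | ε ^ (-L) ≤ nrm (ev (F a) x)} ∪ {x | ε ^ (-L) ≤ nrm (ev (W a) x)}) := by
      intro x hx
      simp only [TT, Set.mem_compl_iff, Set.mem_setOf_eq, not_forall, not_and_or, not_lt] at hx
      obtain ⟨a, ha⟩ := hx
      simp only [Set.mem_iUnion]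
      exact ⟨a, Finset.mem_univ _, ha⟩
    refine (measureReal_mono hsub (measure_ne_top _ _)).trans ((measureReal_biUnion_finset_le _ _).trans ?_)
    calc _ ≤ ∑ a : Fin r, 2 * ε ^ (2 * N + 6) := by
          refine Finset.sum_le_sum fun a _ => (measureReal_union_le _ _).trans ?_
          have h2 := tail_second (κ := κ) (I := I) id Function.injective_id (F a) hLp
          have h3 := tail_second (κ := κ) (I := I) id Function.injective_id (W a) hLp
          have h4 := hq _ (nrm_nonneg _) (hF a)
          have h5 := hq _ (nrm_nonneg _) (hW a)
          simp only [id] at h2 h3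
          refine (add_le_add (h2.trans h4) (h3.trans h5)).trans (le_of_eq (by ring))
      _ = 2 * r * ε ^ (2 * N + 6) := by simp; ring
      _ ≤ _ := by have := Real.rpow_pos_of_pos h0 (2 * N + 6); gcongr
  have hGT : ε ^ (N + 3) ≤ (gamS κ I).real (G ∩ TT) := by
    refine le_trans ?_ (inter_ge _ hTTm hG hTT)
    linarith
  have hw : 0 < ε ^ (2 * L + 1) := Real.rpow_pos_of_pos h0 _
  obtain ⟨x0, hx0, hpg⟩ := pigeon_real (gamS κ I) (ι := Fin r × Fin r) (G := G ∩ TT) (fun x ab => (Am (ev T x) e f)⁻¹ ab.2 ab.1)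
    hw (Real.rpow_pos_of_pos h0 _) (fun x hx ab => hx.1.1 ab.1 ab.2) (Real.rpow_pos_of_pos h0 _).le hGT
  refine ⟨r, hr, F, W, fun b a => (Am (ev T x0) e f)⁻¹ b a, fun a b => hx0.1.1 a b, hF, hW, ?_⟩
  refine le_trans ?_ (hpg.trans (measureReal_mono ?_))
  · rw [← Real.rpow_sub h0]
    have hy : 1 ≤ ε ^ (-(51/100) - (2 * L + 1)) := Real.one_le_rpow_of_pos_of_le_one_of_nonpos h0 h1.le (by linarith)
    have e6 : (-(51/100) - (2 * L + 1)) = -(2 * L + 1 + 51 / 100) := by ring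
    rw [e6] at hy ⊢
    rw [Real.rpow_add h0]
    rw [div_eq_mul_inv]
    gcongr
    have hz : 0 < ε ^ (2 * L + 2) := Real.rpow_pos_of_pos h0 _
    rw [Real.rpow_mul h0.le, Real.rpow_natCast]
    have hz1 : ε ^ (2 * L + 2) ≤ 1 := Real.rpow_le_one h0.le h1.le (by linarith)
    have hb : 2 * ε ^ (-(2 * L + 1 + 51 / 100)) + 3 ≤ (ε ^ (2 * L + 2))⁻¹ := by
      rw [← Real.rpow_neg h0.le]; linarith
    have hcard : Fintype.card (Fin r × Fin r) ≤ R ^ 2 := by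
      rw [Fintype.card_prod, Fintype.card_fin]; nlinarith
    calc (ε ^ (2 * L + 2)) ^ (R ^ 2) ≤ (ε ^ (2 * L + 2)) ^ (Fintype.card (Fin r × Fin r)) := pow_le_pow_of_le_one hz.le hz1 hcard
      _ = (((ε ^ (2 * L + 2))⁻¹) ^ (Fintype.card (Fin r × Fin r)))⁻¹ := by rw [inv_pow, inv_inv]
      _ ≤ _ := by
        apply inv_anti₀ (by positivity)
        gcongr
  · rintro x ⟨hx1, hx2⟩
    have := Mres_diff T F W (fun b a => (Am (ev T x0) e f)⁻¹ b a) (fun b a => (Am (ev T x) e f)⁻¹ b a) x hw.le hLp.le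
      (fun a b => hx1 (a, b)) (fun a => (hx2.2 a).1.le) (fun a => (hx2.2 a).2.le)
    rw [Mres_eq_Res] at this
    refine this.trans ?_
    have h6 : ε ^ (2 * L + 1) * (ε ^ (-L)) ^ 2 = ε ^ (1:ℝ) := by
      rw [← Real.rpow_natCast, ← Real.rpow_mul h0.le, ← Real.rpow_add h0]; congr 1; push_cast; ring
    rw [h6]
    have h7 : (r:ℝ) ^ 2 * ε ^ (1:ℝ) ≤ (R:ℝ) ^ 2 * ε ^ (1:ℝ) := by
      have := Real.rpow_pos_of_pos h0 (1:ℝ)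
      gcongr
    have := hx2.1.2
    linarith

lemma cur_sum {κ I J ι : Type} (s : Finset ι) (f : ι → (Option κ → I) × J → ℝ) : cur (∑ i ∈ s, f i) = ∑ i ∈ s, cur (f i) := by
  funext z; simp [cur]

lemma ev_sum {κ I J ι : Type} [Fintype κ] [Fintype I] [DecidableEq κ] [Fintype J] (s : Finset ι) (f : ι → (κ → I) × J → ℝ) (x : κ → I → ℝ) : ev (∑ i ∈ s, f i) x = ∑ i ∈ s, ev (f i) x := by
  classical
  induction s using Finset.induction_on with
  | empty => funext j; simp [ev]
  | insert a s ha ih => rw [Finset.sum_insert ha, Finset.sum_insert ha, ev_add, ih]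

theorem stepC (κ : Type) [Fintype κ] [DecidableEq κ] (N : ℝ) (hN : 0 < N) : ∃ (k : ℕ) (N4 : ℝ), 0 < N4 ∧ ∀ᶠ ε : ℝ in 𝓝[>] 0,
    ∀ (I J : Type) [Fintype I] [Fintype J] (t : (Option κ → I) × J → ℝ), nrm t ≤ 1 →
    ε ^ N ≤ (gamS (Option κ) I).real {x | nrm (ev t x) ≤ ε} →
    ∃ l : List ((Option κ → I) × J → ℝ), l.length ≤ k ∧ (∀ s ∈ l, IsProd s ∧ nrm s ≤ ε ^ (-(52/100) : ℝ)) ∧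
      ε ^ N4 ≤ (gamS κ I).real {x | nrm (ev (cur (t - l.sum)) x) ≤ ε ^ (47/100 : ℝ)} := by
  obtain ⟨R, N3, hN3, hB⟩ := stepB κ N (1/1000) hN (by norm_num) (by norm_num)
  set m := Fintype.card κ with hm
  obtain ⟨q, hq⟩ := exists_nat_gt (N3 * (2:ℝ) ^ m * 1000)
  let K : ℝ := ∑ S : Finset κ, mq q ^ Fintype.card {s // s ∉ S}
  have hK : 0 ≤ K := Finset.sum_nonneg fun S _ => by have := mq_pos q; positivity
  refine ⟨R * R * 2 ^ m, N3 * (2:ℝ) ^ m + 1, by positivity, ?_⟩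
  filter_upwards [hB, eps_pos, eps_lt_one, eps_pow (4 * R * K) (show N3 * (2:ℝ) ^ m < 2 * (1/1000) * q by linarith [Nat.cast_nonneg (α := ℝ) q]),
    eps_pow 2 (show N3 * (2:ℝ) ^ m < N3 * (2:ℝ) ^ m + 1 by linarith), eps_pow (2 ^ m) (show (47/100 : ℝ) < 48/100 by norm_num)] with ε hB h0 h1 e1 e2 e3 I J _ _ t ht hP
  obtain ⟨r, hr, F, W, B, hBb, hF, hW, hG⟩ := hB I J t ht hP
  set T := cur t with hT
  have hrR : (r:ℝ) ≤ R := by exact_mod_cast hr.le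
  have hLp : 0 < ε ^ (-(2/1000) : ℝ) := Real.rpow_pos_of_pos h0 _
  let G' : Set (κ → I → ℝ) := {c | ∀ (a : Fin r) (S : Finset κ), nrm (slS S (F a) c) < ε ^ (-(2/1000) : ℝ) ∧ nrm (slS S (W a) c) < ε ^ (-(2/1000) : ℝ)}
  have hG'm : MeasurableSet G' := by
    have e1 : G' = ⋂ a, ⋂ S, ({c | nrm (slS S (F a) c) < ε ^ (-(2/1000) : ℝ)} ∩ {c | nrm (slS S (W a) c) < ε ^ (-(2/1000) : ℝ)}) := by ext z; simp [G']
    rw [e1]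
    refine MeasurableSet.iInter fun a => MeasurableSet.iInter fun S => MeasurableSet.inter ?_ ?_
    · exact measurableSet_lt (measurable_slS _ _) measurable_const
    · exact measurableSet_lt (measurable_slS _ _) measurable_const
  have hqq : ∀ y : ℝ, 0 ≤ y → y ≤ ε ^ (-(1/1000) : ℝ) → ((y / ε ^ (-(2/1000) : ℝ)) ^ 2) ^ q ≤ ε ^ (2 * (1/1000) * q : ℝ) := by
    intro y hy hy2
    calc ((y / ε ^ (-(2/1000) : ℝ)) ^ 2) ^ q ≤ ((ε ^ (-(1/1000) : ℝ) / ε ^ (-(2/1000) : ℝ)) ^ 2) ^ q := by gcongr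
      _ = _ := by rw [← Real.rpow_sub h0, ← Real.rpow_natCast, ← Real.rpow_natCast, ← Real.rpow_mul h0.le, ← Real.rpow_mul h0.le]; congr 1; push_cast; ring
  have hδ : 0 < ε ^ N3 := Real.rpow_pos_of_pos h0 _
  have hD : (ε ^ N3) ^ (2 ^ m) = ε ^ (N3 * (2:ℝ) ^ m) := by
    rw [← Real.rpow_natCast, ← Real.rpow_mul h0.le]; push_cast; rfl
  have hG' : (gamS κ I).real G'ᶜ ≤ (ε ^ N3) ^ (2 ^ m) / 2 := by
    have hsub : G'ᶜ ⊆ ⋃ z ∈ (Finset.univ : Finset (Fin r × Finset κ)), ({c | ε ^ (-(2/1000) : ℝ) ≤ nrm (slS z.2 (F z.1) c)} ∪ {c | ε ^ (-(2/1000) : ℝ) ≤ nrm (slS z.2 (W z.1) c)}) := by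
      intro x hx
      simp only [G', Set.mem_compl_iff, Set.mem_setOf_eq, not_forall, not_and_or, not_lt] at hx
      obtain ⟨a, S, ha⟩ := hx
      simp only [Set.mem_iUnion]
      exact ⟨(a, S), Finset.mem_univ _, ha⟩
    refine (measureReal_mono hsub (measure_ne_top _ _)).trans ((measureReal_biUnion_finset_le _ _).trans ?_)
    have hb : 0 ≤ ε ^ (2 * (1/1000) * q : ℝ) := (Real.rpow_pos_of_pos h0 _).le
    calc _ ≤ ∑ z : Fin r × Finset κ, 2 * (mq q ^ Fintype.card {s // s ∉ z.2} * ε ^ (2 * (1/1000) * q : ℝ)) := by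
          refine Finset.sum_le_sum fun z _ => (measureReal_union_le _ _).trans ?_
          have h2 := slS_tail q z.2 (F z.1) hLp
          have h3 := slS_tail q z.2 (W z.1) hLp
          have h4 := hqq _ (nrm_nonneg _) (hF z.1)
          have h5 := hqq _ (nrm_nonneg _) (hW z.1)
          have := mq_pos q
          rw [two_mul]
          refine add_le_add (h2.trans ?_) (h3.trans ?_) <;> gcongr
      _ = 2 * r * K * ε ^ (2 * (1/1000) * q : ℝ) := by
          rw [Fintype.sum_prod_type]
          simp only [← Finset.mul_sum, ← Finset.sum_mul]
          change 2 * ((∑ i : Fin r, K) * _) = _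
          rw [Finset.sum_const, Finset.card_univ, Fintype.card_fin, nsmul_eq_mul]
          ring
      _ ≤ 2 * R * K * ε ^ (2 * (1/1000) * q : ℝ) := by gcongr
      _ ≤ _ := by rw [hD]; linarith
  obtain ⟨c, hc, hcube⟩ := cube_choice (measurableSet_le (measurable_Mres T F W B) measurable_const) hG'm hδ hG hG'
  have hra := two_ra_pow m
  set ρ : ℝ := (2 * ra) ^ m with hρ
  have hρ0 : 0 < ρ := by linarith
  let term : Fin r × Fin r × Finset κ → (Option κ → I) × J → ℝ := fun z => (ρ⁻¹ * B z.2.1 z.1) • Qt z.2.2 (F z.2.1) (W z.1) c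
  refine ⟨Finset.univ.toList.map term, ?_, ?_, ?_⟩
  · rw [List.length_map, Finset.length_toList, Finset.card_univ, Fintype.card_prod, Fintype.card_prod, Fintype.card_fin, Fintype.card_finset, ← mul_assoc]
    gcongr
  · intro s hs
    rw [List.mem_map] at hs
    obtain ⟨z, -, rfl⟩ := hs
    obtain ⟨i1, i2⟩ := isProd_Qt z.2.2 (F z.2.1) (W z.1) c
    refine ⟨isProd_smul i1 _, ?_⟩
    simp only [term, nrm_smul, i2, abs_mul, abs_inv, abs_of_pos hρ0]
    have h2 := (hc z.2.1 z.2.2).1.le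
    have h3 := (hc z.1 z.2.2ᶜ).2.le
    have h4 := hBb z.1 z.2.1
    have h5 : ρ⁻¹ ≤ 1 := inv_le_one_of_one_le₀ hra
    have := nrm_nonneg (slS z.2.2 (F z.2.1) c)
    have := nrm_nonneg (slS z.2.2ᶜ (W z.1) c)
    have hp := Real.rpow_pos_of_pos h0 (-(51/100) : ℝ)
    calc _ ≤ (1 * ε ^ (-(51/100) : ℝ)) * (ε ^ (-(2/1000) : ℝ) * ε ^ (-(2/1000) : ℝ)) := by gcongr
      _ = ε ^ (-(514/1000) : ℝ) := by rw [one_mul, ← Real.rpow_add h0, ← Real.rpow_add h0]; norm_num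
      _ ≤ _ := Real.rpow_le_rpow_of_exponent_ge h0 h1.le (by norm_num)
  · rw [Finset.sum_map_toList]
    refine le_trans ?_ (hcube.trans (measureReal_mono ?_))
    · rw [hD]; linarith
    · intro x hx
      simp only [Set.mem_setOf_eq] at hx ⊢
      have key : (fun z => ∑ ω : κ → Bool, (∏ s, sg (ω s)) * Mres T F W B (vert c x ω) z) = ρ • ev (cur (t - ∑ z, term z)) x := by
        funext z
        have h2 : ∀ ω : κ → Bool, (∏ s, sg (ω s)) * Mres T F W B (vert c x ω) z =
          (∏ s, sg (ω s)) * ev T (vert c x ω) z - ∑ a, ∑ b, B b a * ((∏ s, sg (ω s)) * (ev (F b) (vert c x ω) z.2 * ev (W a) (vert c x ω) z.1)) := by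
          intro ω
          simp only [Mres, mul_sub, Finset.mul_sum]
          congr 1
          exact Finset.sum_congr rfl fun a _ => Finset.sum_congr rfl fun b _ => by ring
        simp only [h2, Finset.sum_sub_distrib, polar_one]
        rw [Finset.sum_comm]
        have h3 : ∀ a, ∑ ω : κ → Bool, ∑ b, B b a * ((∏ s, sg (ω s)) * (ev (F b) (vert c x ω) z.2 * ev (W a) (vert c x ω) z.1)) =
          ∑ b, B b a * ∑ S : Finset κ, ev (F b) (mix S x c) z.2 * ev (W a) (mix Sᶜ x c) z.1 := by
          intro a
          rw [Finset.sum_comm]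
          refine Finset.sum_congr rfl fun b _ => ?_
          rw [← Finset.mul_sum, polar_two]
        simp only [h3]
        rw [cur_sub, ev_sub, cur_sum, ev_sum]
        simp only [Pi.smul_apply, Pi.sub_apply, smul_eq_mul, Finset.sum_apply, mul_sub]
        rw [Fintype.sum_prod_type]
        simp only [Fintype.sum_prod_type, Finset.mul_sum]
        congr 1
        refine Finset.sum_congr rfl fun a _ => Finset.sum_congr rfl fun b _ => Finset.sum_congr rfl fun S _ => ?_
        have h4 : ev (cur (term (a, b, S))) x z = (ρ⁻¹ * B b a) * (ev (F b) (mix S x c) z.2 * ev (W a) (mix Sᶜ x c) z.1) := by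
          have : cur (term (a, b, S)) = (ρ⁻¹ * B b a) • cur (Qt S (F b) (W a) c) := rfl
          rw [this, ev_smul, Pi.smul_apply, ev_cur_Qt, smul_eq_mul]
        rw [h4]
        field_simp
      have h5 := nrm_alt_le (fun ω => Mres T F W B (vert c x ω)) hx
      rw [key, nrm_smul, abs_of_pos hρ0] at h5
      have := nrm_nonneg (ev (cur (t - ∑ z, term z)) x)
      nlinarith

theorem weak_option (κ : Type) [Fintype κ] [DecidableEq κ] (hS : Strong κ) : Weak (Option κ) := by
  intro N hN
  obtain ⟨k, N4, hN4, hC⟩ := stepC κ N hN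
  obtain ⟨k2, hD⟩ := hS (1/10) N4 (by norm_num) hN4
  refine ⟨k + k2, ?_⟩
  filter_upwards [hC, hD, eps_pos, eps_lt_one, eps_pow (1 + k) (show (-(53/100):ℝ) < -(52/100) by norm_num)] with ε hC hD h0 h1 e1 I J _ _ t ht hP
  obtain ⟨l, hl, hl2, hG⟩ := hC I J t ht hP
  set t' := cur (t - l.sum) with ht'
  have hsum : ∀ l : List ((Option κ → I) × J → ℝ), (∀ s ∈ l, nrm s ≤ ε ^ (-(52/100) : ℝ)) → nrm l.sum ≤ l.length * ε ^ (-(52/100) : ℝ) := by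
    intro l
    induction l with
    | nil => intro _; simp [nrm]
    | cons a l ih =>
      intro h
      rw [List.sum_cons, List.length_cons]
      refine (nrm_add_le _ _).trans ?_
      have := h a (by simp)
      have := ih fun s hs => h s (by simp [hs])
      push_cast; linarith
  have hp52 := Real.rpow_pos_of_pos h0 (-(52/100) : ℝ)
  have hp53 := Real.rpow_pos_of_pos h0 (53/100 : ℝ)
  have hp53' := Real.rpow_pos_of_pos h0 (-(53/100) : ℝ)
  have h153 : ε ^ (53/100 : ℝ) * ε ^ (-(53/100) : ℝ) = 1 := by rw [← Real.rpow_add h0]; norm_num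
  have hn : nrm t' ≤ ε ^ (-(53/100) : ℝ) := by
    rw [ht', nrm_cur]
    refine (nrm_sub_le _ _).trans ?_
    have h2 := hsum l fun s hs => (hl2 s hs).2
    have h3 : (l.length : ℝ) * ε ^ (-(52/100) : ℝ) ≤ k * ε ^ (-(52/100) : ℝ) := by gcongr
    have h4 : 1 ≤ ε ^ (-(52/100) : ℝ) := Real.one_le_rpow_of_pos_of_le_one_of_nonpos h0 h1.le (by norm_num)
    linarith
  have hn2 : nrm (ε ^ (53/100 : ℝ) • t') ≤ 1 := by
    rw [nrm_smul, abs_of_pos hp53, ← h153]; gcongr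
  obtain ⟨l2, hk2, hl3, herr⟩ := hD I (I × J) (ε ^ (53/100 : ℝ) • t') hn2 (by
    refine hG.trans (measureReal_mono ?_)
    intro x hx
    simp only [Set.mem_setOf_eq] at hx ⊢
    rw [ev_smul, nrm_smul, abs_of_pos hp53]
    calc _ ≤ ε ^ (53/100 : ℝ) * ε ^ (47/100 : ℝ) := by gcongr
      _ = ε := by rw [← Real.rpow_add h0]; norm_num)
  refine ⟨l ++ l2.map (fun s => unc (ε ^ (-(53/100) : ℝ) • s)), ?_, ?_, ?_⟩
  · rw [List.length_append, List.length_map]; omega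
  · intro s hs
    rw [List.mem_append, List.mem_map] at hs
    rcases hs with hs | ⟨s', hs', rfl⟩
    · refine ⟨(hl2 s hs).1, (hl2 s hs).2.trans (Real.rpow_le_rpow_of_exponent_ge h0 h1.le (by norm_num))⟩
    · obtain ⟨i1, i2⟩ := hl3 s' hs'
      refine ⟨isProd_unc (isProd_smul i1 _), ?_⟩
      rw [nrm_unc, nrm_smul, abs_of_pos hp53']
      have hp1 := Real.rpow_pos_of_pos h0 (-(1/10) : ℝ)
      calc _ ≤ ε ^ (-(53/100) : ℝ) * (ε ^ (-(1/10) : ℝ) * 1) := by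
            gcongr; exact i2.trans (by gcongr)
        _ = ε ^ (-(63/100) : ℝ) := by rw [mul_one, ← Real.rpow_add h0]; norm_num
        _ ≤ _ := Real.rpow_le_rpow_of_exponent_ge h0 h1.le (by norm_num)
  · have hs2 : ∀ l2 : List ((κ → I) × (I × J) → ℝ), (l2.map (fun s => unc (ε ^ (-(53/100) : ℝ) • s))).sum = unc (ε ^ (-(53/100) : ℝ) • l2.sum) := by
      intro l2
      induction l2 with
      | nil => funext z; simp [unc]
      | cons a l ih => rw [List.map_cons, List.sum_cons, ih, List.sum_cons]; funext z; simp [unc, mul_add]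
    rw [List.sum_append, hs2, ← nrm_cur]
    have e2 : cur (t - (l.sum + unc (ε ^ (-(53/100) : ℝ) • l2.sum))) = ε ^ (-(53/100) : ℝ) • (ε ^ (53/100 : ℝ) • t' - l2.sum) := by
      rw [← sub_sub, cur_sub, cur_unc, smul_sub, smul_smul, mul_comm, h153, one_smul]
    rw [e2, nrm_smul, abs_of_pos hp53']
    calc _ ≤ ε ^ (-(53/100) : ℝ) * ε ^ (1 - 1/10 : ℝ) := by gcongr
      _ = ε ^ (37/100 : ℝ) := by rw [← Real.rpow_add h0]; norm_num
      _ ≤ _ := Real.rpow_le_rpow_of_exponent_ge h0 h1.le (by norm_num)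

theorem strong_all (m : ℕ) : ∃ (κ : Type) (_ : Fintype κ) (_ : DecidableEq κ), Fintype.card κ = m ∧ Strong κ := by
  induction m with
  | zero => exact ⟨Empty, inferInstance, inferInstance, rfl, strong_empty⟩
  | succ m ih =>
    obtain ⟨κ, i1, i2, hc, hS⟩ := ih
    refine ⟨Option κ, inferInstance, inferInstance, by rw [Fintype.card_option, hc], ?_⟩
    exact strong_of_weak _ (weak_option κ hS)

lemma poly_integrable (f : Polynomial ℝ) : Integrable (fun x => f.eval x) (gaussianReal 0 1) := by
  induction f using Polynomial.induction_on' with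
  | add p q hp hq => simp only [Polynomial.eval_add]; exact hp.add hq
  | monomial n a =>
    simp only [Polynomial.eval_monomial]
    refine Integrable.const_mul ?_ a
    rcases Nat.eq_zero_or_pos n with rfl | hn
    · simp
    have h := (memLp_id_gaussianReal (μ := 0) (v := 1) (n : NNReal))
    have h2 := h.integrable_norm_pow (by positivity)
    refine (integrable_norm_iff (by fun_prop)).mp ?_
    simpa using h2

lemma poly_pdf_integrable (f : Polynomial ℝ) : Integrable (fun x => gaussianPDFReal 0 1 x * f.eval x) := by
  have h := poly_integrable f
  rw [gaussianReal_of_var_ne_zero _ one_ne_zero, integrable_withDensity_iff_integrable_smul' (measurable_gaussianPDF _ _)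
    (ae_of_all _ fun _ => gaussianPDF_lt_top)] at h
  simpa using h

lemma stein (f : Polynomial ℝ) : ∫ x, x * f.eval x ∂(gaussianReal 0 1) = ∫ x, f.derivative.eval x ∂(gaussianReal 0 1) := by
  have hx : ∀ x : ℝ, x * f.eval x = (Polynomial.X * f).eval x := by intro x; simp
  simp only [hx]
  rw [← sub_eq_zero, ← integral_sub (poly_integrable _) (poly_integrable _), integral_gaussianReal_eq_integral_smul one_ne_zero]
  have hd : ∀ x, HasDerivAt (fun x => -(gaussianPDFReal 0 1 x * f.eval x)) (gaussianPDFReal 0 1 x • ((Polynomial.X * f).eval x - f.derivative.eval x)) x := by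
    intro x
    have h1 : HasDerivAt (fun x => gaussianPDFReal 0 1 x) (gaussianPDFReal 0 1 x * (-x)) x := by
      simp only [gaussianPDFReal]
      have h2 : HasDerivAt (fun x : ℝ => -(x - 0) ^ 2 / (2 * ((1 : NNReal) : ℝ))) (-x) x := by
        have := (((hasDerivAt_id x).sub_const 0).pow 2).neg.div_const (2 * ((1 : NNReal) : ℝ))
        simp at this
        convert! this using 1
        · funext y; simp
        · ring
      have := (h2.exp).const_mul ((Real.sqrt (2 * Real.pi * ((1:NNReal):ℝ)))⁻¹)
      convert! this using 1; ring
    have := (h1.mul (f.hasDerivAt x)).neg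
    convert! this using 1
    simp; ring
  refine integral_eq_zero_of_hasDerivAt_of_integrable hd ?_ (poly_pdf_integrable f).neg
  have := poly_pdf_integrable (Polynomial.X * f - f.derivative)
  simpa using this

/-- real Hermite polynomial -/
noncomputable def hR (n : ℕ) : Polynomial ℝ := (Polynomial.hermite n).map (Int.castRingHom ℝ)

lemma hR_eval (n : ℕ) (x : ℝ) : (hR n).eval x = Polynomial.aeval x (Polynomial.hermite n) := by
  rw [hR, Polynomial.aeval_def, Polynomial.eval₂_eq_eval_map]; rfl
lemma hR_succ (n : ℕ) : hR (n+1) = Polynomial.X * hR n - (hR n).derivative := by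
  simp [hR, Polynomial.hermite_succ, Polynomial.derivative_map]
lemma hR_zero : hR 0 = 1 := by simp [hR]
lemma hR_monic (n : ℕ) : (hR n).Monic := (Polynomial.hermite_monic n).map _
lemma hR_natDegree (n : ℕ) : (hR n).natDegree = n := by
  rw [hR, (Polynomial.hermite_monic n).natDegree_map, Polynomial.natDegree_hermite]

lemma hR_int (n : ℕ) : ∀ (f : Polynomial ℝ), ∫ x, (hR n).eval x * f.eval x ∂(gaussianReal 0 1) =
    ∫ x, (Polynomial.derivative^[n] f).eval x ∂(gaussianReal 0 1) := by
  induction n with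
  | zero => intro f; simp [hR_zero]
  | succ n ih =>
    intro f
    have h1 : ∀ x : ℝ, (hR (n+1)).eval x * f.eval x = x * (hR n * f).eval x - ((hR n).derivative * f).eval x := by
      intro x; rw [hR_succ]; simp; ring
    simp only [h1]
    have h2 : ∀ x : ℝ, x * (hR n * f).eval x = (Polynomial.X * (hR n * f)).eval x := by intro x; simp
    rw [integral_sub (by simp only [h2]; exact poly_integrable _) (poly_integrable _), stein, ← integral_sub (poly_integrable _) (poly_integrable _)]
    rw [Function.iterate_succ_apply, ← ih]
    refine integral_congr_ae (ae_of_all _ fun x => ?_)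
    simp [Polynomial.derivative_mul]

lemma hR_int_top (n : ℕ) (f : Polynomial ℝ) (hf : f.natDegree ≤ n) :
    ∫ x, (hR n).eval x * f.eval x ∂(gaussianReal 0 1) = n.factorial * f.coeff n := by
  rw [hR_int]
  have : Polynomial.derivative^[n] f = Polynomial.C (n.factorial * f.coeff n) := by
    ext k
    rw [Polynomial.coeff_iterate_derivative, Polynomial.coeff_C]
    rcases k with _ | k
    · simp [Nat.descFactorial_self]
    · rw [Polynomial.coeff_eq_zero_of_natDegree_lt (by omega)]; simp
  rw [this]; simp

lemma hR_orth (n m : ℕ) : ∫ x, (hR n).eval x * (hR m).eval x ∂(gaussianReal 0 1) = if n = m then (n.factorial : ℝ) else 0 := by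
  rcases lt_trichotomy n m with h | h | h
  · simp only [mul_comm ((hR n).eval _)]
    rw [hR_int_top m _ (by rw [hR_natDegree]; omega), Polynomial.coeff_eq_zero_of_natDegree_lt (by rw [hR_natDegree]; omega), if_neg h.ne]; simp
  · subst h
    rw [hR_int_top n _ (by rw [hR_natDegree])]
    have := hR_monic n
    rw [Polynomial.Monic, Polynomial.leadingCoeff, hR_natDegree] at this
    simp [this]
  · rw [hR_int_top n _ (by rw [hR_natDegree]; omega), Polynomial.coeff_eq_zero_of_natDegree_lt (by rw [hR_natDegree]; omega), if_neg h.ne']; simp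

lemma hR_pow (n b : ℕ) (h : b ≤ n) : ∫ x, (hR n).eval x * x ^ b ∂(gaussianReal 0 1) = if n = b then (n.factorial : ℝ) else 0 := by
  have := hR_int_top n (Polynomial.X ^ b) (by rw [Polynomial.natDegree_X_pow]; exact h)
  simp only [Polynomial.eval_pow, Polynomial.eval_X, Polynomial.coeff_X_pow] at this
  rw [this]; split_ifs <;> simp

section mv
variable {n : ℕ}

/-- multi-index factorial -/
noncomputable def fct (α : Fin n →₀ ℕ) : ℝ := ∏ k, ((α k).factorial : ℝ)
lemma fct_pos (α : Fin n →₀ ℕ) : 0 < fct α := Finset.prod_pos fun k _ => by positivity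

/-- multivariate Hermite polynomial -/
noncomputable def HeP (α : Fin n →₀ ℕ) : MvPolynomial (Fin n) ℝ := ∏ k, Polynomial.aeval (MvPolynomial.X k) (hR (α k))

lemma eval_aeval_X (x : Fin n → ℝ) (k : Fin n) (f : Polynomial ℝ) :
    MvPolynomial.eval x (Polynomial.aeval (MvPolynomial.X k : MvPolynomial (Fin n) ℝ) f) = f.eval (x k) := by
  induction f using Polynomial.induction_on' with
  | add p q hp hq => simp [hp, hq]
  | monomial m a => simp [Polynomial.aeval_monomial]

lemma eval_HeP (α : Fin n →₀ ℕ) (x : Fin n → ℝ) : MvPolynomial.eval x (HeP α) = ∏ k, (hR (α k)).eval (x k) := by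
  simp [HeP, map_prod, eval_aeval_X]

lemma mv_integrable (p : MvPolynomial (Fin n) ℝ) : Integrable (fun x => MvPolynomial.eval x p) (gam (Fin n)) := by
  simp only [MvPolynomial.eval_eq']
  refine integrable_finsetSum _ fun b _ => Integrable.const_mul ?_ _
  refine Integrable.fintype_prod (f := fun (i : Fin n) (y : ℝ) => y ^ b i) fun i => ?_
  simpa using poly_integrable (Polynomial.X ^ b i)

lemma HeP_orth (α β : Fin n →₀ ℕ) : ∫ x, MvPolynomial.eval x (HeP α) * MvPolynomial.eval x (HeP β) ∂(gam (Fin n)) = if α = β then fct α else 0 := by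
  simp only [eval_HeP, ← Finset.prod_mul_distrib]
  rw [integral_fintype_prod_eq_prod (fun (k : Fin n) (y : ℝ) => (hR (α k)).eval y * (hR (β k)).eval y)]
  simp only [hR_orth]
  split_ifs with h
  · subst h; simp [fct]
  · obtain ⟨k, hk⟩ := DFunLike.ne_iff.mp h
    exact Finset.prod_eq_zero (Finset.mem_univ k) (if_neg hk)

lemma HeP_mon (α b : Fin n →₀ ℕ) (hb : b.degree ≤ α.degree) : ∫ x, MvPolynomial.eval x (HeP α) * ∏ k, x k ^ b k ∂(gam (Fin n)) = if α = b then fct α else 0 := by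
  simp only [eval_HeP, ← Finset.prod_mul_distrib]
  rw [integral_fintype_prod_eq_prod (fun (k : Fin n) (y : ℝ) => (hR (α k)).eval y * y ^ b k)]
  split_ifs with h
  · subst h; rw [fct]; refine Finset.prod_congr rfl fun k _ => ?_
    rw [hR_pow _ _ le_rfl, if_pos rfl]
  · have : ∃ k, b k < α k := by
      by_contra hcon
      push Not at hcon
      apply h
      rw [Finsupp.degree_eq_sum, Finsupp.degree_eq_sum] at hb
      have h2 : ∑ i, α i = ∑ i, b i := le_antisymm (Finset.sum_le_sum fun i _ => hcon i) hb
      have := (Finset.sum_eq_sum_iff_of_le fun i _ => hcon i).mp h2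
      ext k; exact this k (Finset.mem_univ k)
    obtain ⟨k, hk⟩ := this
    refine Finset.prod_eq_zero (Finset.mem_univ k) ?_
    rw [hR_pow _ _ hk.le, if_neg hk.ne']

lemma HeP_top (p : MvPolynomial (Fin n) ℝ) (α : Fin n →₀ ℕ) (h : p.totalDegree ≤ α.degree) :
    ∫ x, MvPolynomial.eval x p * MvPolynomial.eval x (HeP α) ∂(gam (Fin n)) = fct α * p.coeff α := by
  have e : ∀ x, MvPolynomial.eval x p * MvPolynomial.eval x (HeP α) = ∑ b ∈ p.support, p.coeff b * (MvPolynomial.eval x (HeP α) * ∏ k, x k ^ b k) := by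
    intro x
    rw [MvPolynomial.eval_eq' x p, Finset.sum_mul]
    exact Finset.sum_congr rfl fun b _ => by ring
  simp only [e]
  have hintg : ∀ b : Fin n →₀ ℕ, Integrable (fun x => MvPolynomial.eval x (HeP α) * ∏ k, x k ^ b k) (gam (Fin n)) := by
    intro b
    have := mv_integrable (HeP α * MvPolynomial.monomial b 1)
    simpa [MvPolynomial.eval_monomial, Finsupp.prod_fintype] using this
  rw [integral_finsetSum _ fun b _ => (hintg b).const_mul _]
  simp only [integral_const_mul]
  have h2 : ∀ b ∈ p.support, p.coeff b * ∫ x, MvPolynomial.eval x (HeP α) * ∏ k, x k ^ b k ∂(gam (Fin n)) = if α = b then fct α * p.coeff α else 0 := by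
    intro b hb
    have hbd : b.degree ≤ α.degree := le_trans (MvPolynomial.le_totalDegree hb) h
    rw [HeP_mon α b hbd]
    split_ifs with h3
    · subst h3; ring
    · simp
  rw [Finset.sum_congr rfl h2, Finset.sum_ite_eq]
  split_ifs with h3
  · rfl
  · rw [MvPolynomial.notMem_support_iff.mp h3, mul_zero]

/-- function to finsupp -/
noncomputable def fs (a : Fin n → ℕ) : Fin n →₀ ℕ := Finsupp.equivFunOnFinite.symm a
lemma fs_apply (a : Fin n → ℕ) (k : Fin n) : fs a k = a k := rfl
lemma fs_coe (α : Fin n →₀ ℕ) : fs α = α := by ext k; rfl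
lemma fs_degree (a : Fin n → ℕ) : (fs a).degree = ∑ k, a k := by rw [Finsupp.degree_eq_sum]; rfl
lemma fs_inj {a b : Fin n → ℕ} : fs a = fs b ↔ a = b := by
  constructor
  · intro h; funext k; exact DFunLike.congr_fun h k
  · rintro rfl; rfl

lemma hermiteFun_eq (a : Fin n → ℕ) (x : Fin n → ℝ) : hermiteFun a x = MvPolynomial.eval x (HeP (fs a)) / Real.sqrt (fct (fs a)) := by
  rw [hermiteFun, eval_HeP, Finset.prod_div_distrib, fct, Real.sqrt_prod _ (fun _ _ => by positivity)]
  simp only [hR_eval, fs_apply]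

lemma hermiteCoeff_eq (p : MvPolynomial (Fin n) ℝ) (a : Fin n → ℕ) : hermiteCoeff p a = (∫ x, MvPolynomial.eval x p * MvPolynomial.eval x (HeP (fs a)) ∂(gam (Fin n))) / Real.sqrt (fct (fs a)) := by
  rw [hermiteCoeff, ← integral_div]
  simp only [hermiteFun_eq, mul_div_assoc]
  rfl

lemma hermiteCoeff_sq (p : MvPolynomial (Fin n) ℝ) (a : Fin n → ℕ) (h : p.totalDegree ≤ ∑ k, a k) :
    hermiteCoeff p a ^ 2 = fct (fs a) * p.coeff (fs a) ^ 2 := by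
  have hp := fct_pos (fs a)
  rw [hermiteCoeff_eq, HeP_top p _ (by rwa [fs_degree]), div_pow, Real.sq_sqrt hp.le]
  field_simp

lemma harmonicNorm_sq (p : MvPolynomial (Fin n) ℝ) (d : ℕ) (h : p.totalDegree ≤ d) :
    harmonicNorm p d ^ 2 = ∑ a ∈ Finset.Nat.antidiagonalTuple n d, fct (fs a) * p.coeff (fs a) ^ 2 := by
  rw [harmonicNorm, Real.sq_sqrt (Finset.sum_nonneg fun _ _ => sq_nonneg _)]
  refine Finset.sum_congr rfl fun a ha => ?_
  rw [Finset.Nat.mem_antidiagonalTuple] at ha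
  exact hermiteCoeff_sq p a (by rw [ha]; exact h)

lemma gaussL2_sq (p : MvPolynomial (Fin n) ℝ) : gaussL2 p ^ 2 = ∫ x, (MvPolynomial.eval x p) ^ 2 ∂(gam (Fin n)) := by
  rw [gaussL2, Real.sq_sqrt (integral_nonneg fun _ => sq_nonneg _)]; rfl

lemma bessel (p : MvPolynomial (Fin n) ℝ) (d : ℕ) : harmonicNorm p d ≤ gaussL2 p := by
  apply Real.sqrt_le_sqrt
  set A := Finset.Nat.antidiagonalTuple n d
  let HP : (Fin n → ℕ) → MvPolynomial (Fin n) ℝ := fun a => MvPolynomial.C ((Real.sqrt (fct (fs a)))⁻¹) * HeP (fs a)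
  have hHP : ∀ a b, ∫ x, MvPolynomial.eval x (HP a * HP b) ∂(gam (Fin n)) = if a = b then 1 else 0 := by
    intro a b
    simp only [HP, map_mul, MvPolynomial.eval_C]
    have : ∀ x, (Real.sqrt (fct (fs a)))⁻¹ * MvPolynomial.eval x (HeP (fs a)) * ((Real.sqrt (fct (fs b)))⁻¹ * MvPolynomial.eval x (HeP (fs b))) =
      (Real.sqrt (fct (fs a)))⁻¹ * (Real.sqrt (fct (fs b)))⁻¹ * (MvPolynomial.eval x (HeP (fs a)) * MvPolynomial.eval x (HeP (fs b))) := by intro x; ring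
    simp only [this]
    rw [integral_const_mul, HeP_orth]
    simp only [fs_inj]
    split_ifs with h
    · subst h
      have hp := fct_pos (fs a)
      rw [← mul_inv, Real.mul_self_sqrt hp.le]; field_simp
    · simp
  have hc : ∀ a, ∫ x, MvPolynomial.eval x (p * HP a) ∂(gam (Fin n)) = hermiteCoeff p a := by
    intro a
    rw [hermiteCoeff_eq, ← integral_div]
    refine integral_congr_ae (ae_of_all _ fun x => ?_)
    simp [HP]; ring
  set c := fun a => hermiteCoeff p a
  let Q := ∑ a ∈ A, MvPolynomial.C (c a) * HP a
  have hpQ : ∫ x, MvPolynomial.eval x (p * Q) ∂(gam (Fin n)) = ∑ a ∈ A, c a ^ 2 := by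
    have : ∀ x, MvPolynomial.eval x (p * Q) = ∑ a ∈ A, c a * MvPolynomial.eval x (p * HP a) := by
      intro x; simp only [Q, map_mul, map_sum, MvPolynomial.eval_C, Finset.mul_sum]
      exact Finset.sum_congr rfl fun _ _ => by ring
    simp only [this]
    rw [integral_finsetSum _ fun a _ => (mv_integrable _).const_mul _]
    simp only [integral_const_mul, hc]
    exact Finset.sum_congr rfl fun _ _ => by ring
  have hQQ : ∫ x, MvPolynomial.eval x (Q * Q) ∂(gam (Fin n)) = ∑ a ∈ A, c a ^ 2 := by
    have : ∀ x, MvPolynomial.eval x (Q * Q) = ∑ a ∈ A, ∑ b ∈ A, (c a * c b) * MvPolynomial.eval x (HP a * HP b) := by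
      intro x; simp only [Q, map_mul, map_sum, MvPolynomial.eval_C, Finset.sum_mul_sum]
      exact Finset.sum_congr rfl fun _ _ => Finset.sum_congr rfl fun _ _ => by ring
    simp only [this]
    rw [integral_finsetSum _ fun a _ => integrable_finsetSum _ fun b _ => (mv_integrable _).const_mul _]
    refine Finset.sum_congr rfl fun a ha => ?_
    rw [integral_finsetSum _ fun b _ => (mv_integrable _).const_mul _]
    simp only [integral_const_mul, hHP, mul_ite, mul_zero, mul_one, Finset.sum_ite_eq, if_pos ha]
    ring
  have h0 : 0 ≤ ∫ x, (MvPolynomial.eval x (p - Q)) ^ 2 ∂(gam (Fin n)) := integral_nonneg fun _ => sq_nonneg _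
  have e : ∀ x, (MvPolynomial.eval x (p - Q)) ^ 2 = MvPolynomial.eval x p ^ 2 - 2 * MvPolynomial.eval x (p * Q) + MvPolynomial.eval x (Q * Q) := by
    intro x; simp; ring
  have hpp : Integrable (fun x => MvPolynomial.eval x p ^ 2) (gam (Fin n)) := by
    have := mv_integrable (p ^ 2); simpa using this
  simp only [e] at h0
  have hi : Integrable (fun x => MvPolynomial.eval x p ^ 2 - 2 * MvPolynomial.eval x (p * Q)) (gam (Fin n)) := hpp.sub ((mv_integrable _).const_mul _)
  rw [integral_add hi (mv_integrable _), integral_sub hpp ((mv_integrable (p * Q)).const_mul 2), integral_const_mul, hpQ, hQQ] at h0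
  change _ ≤ ∫ x, MvPolynomial.eval x p ^ 2 ∂(gam (Fin n))
  linarith
end mv

section words
variable {n : ℕ} {κ : Type} [Fintype κ] [DecidableEq κ]

/-- type (content) of a word -/
noncomputable def typ (w : κ → Fin n) : Fin n →₀ ℕ := ∑ s, Finsupp.single (w s) 1

lemma typ_degree (w : κ → Fin n) : (typ w).degree = Fintype.card κ := by
  simp [typ, map_sum, Finsupp.degree_single]

lemma typ_ocons (k : Fin n) (w : κ → Fin n) : typ (ocons k w) = typ w + Finsupp.single k 1 := by
  simp [typ, Fintype.sum_option, add_comm]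

lemma typ_equiv {κ' : Type} [Fintype κ'] [DecidableEq κ'] (e : κ' ≃ κ) (w : κ → Fin n) : typ (fun s => w (e s)) = typ w := by
  unfold typ; exact Equiv.sum_comp e (fun s => Finsupp.single (w s) 1)

lemma fct_add_single (α : Fin n →₀ ℕ) (k : Fin n) : fct (α + Finsupp.single k 1) = (α k + 1) * fct α := by
  unfold fct
  rw [← Finset.mul_prod_erase _ _ (Finset.mem_univ k), ← Finset.mul_prod_erase _ (fun k => ((α k).factorial : ℝ)) (Finset.mem_univ k)]
  have : ∏ x ∈ Finset.univ.erase k, (((α + Finsupp.single k 1 : Fin n →₀ ℕ) x).factorial : ℝ) = ∏ x ∈ Finset.univ.erase k, ((α x).factorial : ℝ) := by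
    refine Finset.prod_congr rfl fun x hx => ?_
    have : x ≠ k := Finset.ne_of_mem_erase hx
    simp [Finsupp.single_apply, this.symm]
  rw [this]
  simp [Nat.factorial_succ]; ring

/-- words on an extended slot set -/
def oconsE (κ E : Type) : E × (κ → E) ≃ (Option κ → E) where
  toFun z := ocons z.1 z.2
  invFun w := (w none, fun s => w (some s))
  left_inv z := rfl
  right_inv w := by funext o; cases o <;> rfl

lemma sum_ocons {E : Type} [Fintype E] (f : (Option κ → E) → ℝ) : ∑ w, f w = ∑ k, ∑ w : κ → E, f (ocons k w) := by
  rw [← Equiv.sum_comp (oconsE κ E) f, Fintype.sum_prod_type]; rfl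

theorem count_words (κ : Type) [Fintype κ] [DecidableEq κ] : ∀ (n : ℕ) (α : Fin n →₀ ℕ), α.degree = Fintype.card κ →
    ∑ w : κ → Fin n, (if typ w = α then fct α else 0) = ((Fintype.card κ).factorial : ℝ) := by
  refine slot_induction (fun κ => ∀ (n : ℕ) (α : Fin n →₀ ℕ), α.degree = Fintype.card κ →
    ∑ w : κ → Fin n, (if typ w = α then fct α else 0) = ((Fintype.card κ).factorial : ℝ)) ?_ ?_ ?_ κ
  · intro κ κ' _ _ _ _ e ih n α h
    rw [Fintype.card_congr e.symm] at h ⊢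
    rw [← ih n α h, ← Equiv.sum_comp (Equiv.arrowCongr e (Equiv.refl (Fin n)))]
    refine Finset.sum_congr rfl fun w _ => ?_
    have : typ ((Equiv.arrowCongr e (Equiv.refl (Fin n))) w) = typ w := typ_equiv e.symm w
    rw [this]
  · intro n α h
    have h0 : α = 0 := by rw [← Finsupp.degree_eq_zero_iff]; simpa using h
    subst h0
    simp [typ, fct]
  · intro κ _ _ ih n α h
    rw [sum_ocons]
    have hk : ∀ k : Fin n, ∑ w : κ → Fin n, (if typ (ocons k w) = α then fct α else 0) = (α k : ℝ) * ((Fintype.card κ).factorial : ℝ) := by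
      intro k
      by_cases h0 : α k = 0
      · rw [h0, Nat.cast_zero, zero_mul]
        refine Finset.sum_eq_zero fun w _ => if_neg fun h1 => ?_
        rw [← h1, typ_ocons] at h0; simp at h0
      · obtain ⟨β, rfl⟩ : ∃ β : Fin n →₀ ℕ, α = β + Finsupp.single k 1 := by
          refine ⟨α - Finsupp.single k 1, ?_⟩
          rw [tsub_add_cancel_of_le]
          rw [Finsupp.single_le_iff]; omega
        have hβ : β.degree = Fintype.card κ := by
          simp [map_add, Finsupp.degree_single] at h; exact h
        rw [← ih n β hβ, Finset.mul_sum]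
        refine Finset.sum_congr rfl fun w _ => ?_
        simp only [typ_ocons, add_left_inj, fct_add_single]
        split_ifs <;> simp
    simp only [hk]
    rw [← Finset.sum_mul]
    have : (∑ k, (α k : ℝ)) = (Fintype.card κ + 1 : ℕ) := by
      rw [← Nat.cast_sum, ← Finsupp.degree_eq_sum, h, Fintype.card_option]
    rw [this, Fintype.card_option, Nat.factorial_succ]; push_cast; ring

/-- homogeneous polynomial of a tensor -/
noncomputable def hom (τ : (κ → Fin n) → ℝ) : MvPolynomial (Fin n) ℝ := ∑ w, MvPolynomial.monomial (typ w) (τ w)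
/-- Wick-ordered polynomial of a tensor -/
noncomputable def Wick (τ : (κ → Fin n) → ℝ) : MvPolynomial (Fin n) ℝ := ∑ w, MvPolynomial.C (τ w) * HeP (typ w)

lemma coeff_hom (τ : (κ → Fin n) → ℝ) (α : Fin n →₀ ℕ) : (hom τ).coeff α = ∑ w, if typ w = α then τ w else 0 := by
  simp [hom, MvPolynomial.coeff_sum, MvPolynomial.coeff_monomial]

lemma hom_homog (τ : (κ → Fin n) → ℝ) : (hom τ).IsHomogeneous (Fintype.card κ) :=
  MvPolynomial.IsHomogeneous.sum _ _ _ fun w _ => MvPolynomial.isHomogeneous_monomial _ (typ_degree w)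

lemma sum_typ_tuple (f : (κ → Fin n) → ℝ) :
    ∑ a ∈ Finset.Nat.antidiagonalTuple n (Fintype.card κ), ∑ w, (if typ w = fs a then f w else 0) = ∑ w, f w := by
  rw [Finset.sum_comm]
  refine Finset.sum_congr rfl fun w _ => ?_
  rw [Finset.sum_eq_single_of_mem (fun k => typ w k)]
  · rw [if_pos]; ext k; rfl
  · rw [Finset.Nat.mem_antidiagonalTuple, ← Finsupp.degree_eq_sum, typ_degree]
  · intro b _ hb
    rw [if_neg]; intro h; apply hb; rw [h]; rfl

lemma hom_bound (τ : (κ → Fin n) → ℝ) :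
    ∑ a ∈ Finset.Nat.antidiagonalTuple n (Fintype.card κ), fct (fs a) * (hom τ).coeff (fs a) ^ 2 ≤ (Fintype.card κ).factorial * nrm τ ^ 2 := by
  rw [nrm_sq, ← sum_typ_tuple (fun w => τ w ^ 2), Finset.mul_sum]
  refine Finset.sum_le_sum fun a ha => ?_
  rw [Finset.Nat.mem_antidiagonalTuple] at ha
  rw [← count_words κ n (fs a) (by rw [fs_degree, ha]), coeff_hom]
  have hcs := Finset.sum_mul_sq_le_sq_mul_sq Finset.univ (fun w : κ → Fin n => if typ w = fs a then (1:ℝ) else 0) (fun w => if typ w = fs a then τ w else 0)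
  have e1 : ∀ w : κ → Fin n, (if typ w = fs a then (1:ℝ) else 0) * (if typ w = fs a then τ w else 0) = if typ w = fs a then τ w else 0 := by
    intro w; split_ifs <;> simp
  have e2 : ∀ w : κ → Fin n, (if typ w = fs a then (1:ℝ) else 0) ^ 2 = if typ w = fs a then (1:ℝ) else 0 := by
    intro w; split_ifs <;> simp
  have e3 : ∀ w : κ → Fin n, (if typ w = fs a then τ w else 0) ^ 2 = if typ w = fs a then τ w ^ 2 else 0 := by
    intro w; split_ifs <;> simp
  simp only [e1, e2, e3] at hcs
  have e4 : ∑ w : κ → Fin n, (if typ w = fs a then fct (fs a) else 0) = fct (fs a) * ∑ w : κ → Fin n, (if typ w = fs a then (1:ℝ) else 0) := by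
    rw [Finset.mul_sum]; exact Finset.sum_congr rfl fun w _ => by split_ifs <;> simp
  rw [e4, mul_assoc]
  exact mul_le_mul_of_nonneg_left hcs (fct_pos _).le

lemma wick_bound (τ : (κ → Fin n) → ℝ) : gaussL2 (Wick τ) ^ 2 ≤ (Fintype.card κ).factorial * nrm τ ^ 2 := by
  rw [gaussL2_sq]
  have e : ∀ x, MvPolynomial.eval x (Wick τ) ^ 2 = ∑ w : κ → Fin n, ∑ w' : κ → Fin n, (τ w * τ w') * (MvPolynomial.eval x (HeP (typ w)) * MvPolynomial.eval x (HeP (typ w'))) := by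
    intro x
    rw [sq]; simp only [Wick, map_sum, map_mul, MvPolynomial.eval_C, Finset.sum_mul_sum]
    exact Finset.sum_congr rfl fun _ _ => Finset.sum_congr rfl fun _ _ => by ring
  have hintg : ∀ w w' : κ → Fin n, Integrable (fun x => MvPolynomial.eval x (HeP (typ w)) * MvPolynomial.eval x (HeP (typ w'))) (gam (Fin n)) := by
    intro w w'
    have := mv_integrable (HeP (typ w) * HeP (typ w')); simpa using this
  simp only [e]
  rw [integral_finsetSum _ fun w _ => integrable_finsetSum _ fun w' _ => (hintg w w').const_mul _]
  have e2 : ∀ w : κ → Fin n, ∫ x, ∑ w' : κ → Fin n, (τ w * τ w') * (MvPolynomial.eval x (HeP (typ w)) * MvPolynomial.eval x (HeP (typ w'))) ∂(gam (Fin n)) =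
      ∑ w' : κ → Fin n, (τ w * τ w') * (if typ w = typ w' then fct (typ w) else 0) := by
    intro w
    rw [integral_finsetSum _ fun w' _ => (hintg w w').const_mul _]
    simp only [integral_const_mul, HeP_orth]
  simp only [e2]
  have h1 : ∑ w : κ → Fin n, ∑ w' : κ → Fin n, (τ w * τ w') * (if typ w = typ w' then fct (typ w) else 0) ≤
      ∑ w : κ → Fin n, ∑ w' : κ → Fin n, (τ w ^ 2 / 2 + τ w' ^ 2 / 2) * (if typ w = typ w' then fct (typ w) else 0) := by
    refine Finset.sum_le_sum fun w _ => Finset.sum_le_sum fun w' _ => mul_le_mul_of_nonneg_right ?_ ?_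
    · nlinarith [sq_nonneg (τ w - τ w')]
    · split_ifs
      · exact (fct_pos _).le
      · exact le_rfl
  refine h1.trans (le_of_eq ?_)
  have hc : ∀ w : κ → Fin n, ∑ w' : κ → Fin n, (if typ w' = typ w then fct (typ w) else 0) = ((Fintype.card κ).factorial : ℝ) :=
    fun w => count_words κ n (typ w) (typ_degree w)
  have hA : ∑ w : κ → Fin n, ∑ w' : κ → Fin n, (τ w ^ 2 / 2) * (if typ w = typ w' then fct (typ w) else 0) = ((Fintype.card κ).factorial : ℝ) * nrm τ ^ 2 / 2 := by
    rw [nrm_sq, Finset.mul_sum, Finset.sum_div]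
    refine Finset.sum_congr rfl fun w _ => ?_
    rw [← Finset.mul_sum]
    simp only [eq_comm (a := typ w)]
    rw [hc]; ring
  have hB : ∑ w : κ → Fin n, ∑ w' : κ → Fin n, (τ w' ^ 2 / 2) * (if typ w = typ w' then fct (typ w) else 0) = ((Fintype.card κ).factorial : ℝ) * nrm τ ^ 2 / 2 := by
    rw [Finset.sum_comm, ← hA]
    refine Finset.sum_congr rfl fun w _ => Finset.sum_congr rfl fun w' _ => ?_
    by_cases h : typ w = typ w'
    · rw [if_pos h, if_pos h.symm, h]
    · rw [if_neg h, if_neg (Ne.symm h)]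
  simp only [add_mul, Finset.sum_add_distrib]
  rw [hA, hB]; ring
end words

section top
variable {n : ℕ}
/-- `H` is the degree `m` part of `P`, which has degree at most `m` -/
def IsTopD (P H : MvPolynomial (Fin n) ℝ) (m : ℕ) : Prop :=
  H.IsHomogeneous m ∧ ∀ β : Fin n →₀ ℕ, m ≤ β.degree → P.coeff β = H.coeff β

lemma IsTopD.zero_of_gt {P H : MvPolynomial (Fin n) ℝ} {m : ℕ} (h : IsTopD P H m) {β : Fin n →₀ ℕ} (hβ : m < β.degree) :
    P.coeff β = 0 ∧ H.coeff β = 0 := by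
  have : H.coeff β = 0 := h.1.coeff_eq_zero hβ.ne'
  exact ⟨by rw [h.2 β hβ.le, this], this⟩

lemma IsTopD.mul {P H P' H' : MvPolynomial (Fin n) ℝ} {m m' : ℕ} (h : IsTopD P H m) (h' : IsTopD P' H' m') :
    IsTopD (P * P') (H * H') (m + m') := by
  refine ⟨h.1.mul h'.1, fun β hβ => ?_⟩
  rw [MvPolynomial.coeff_mul, MvPolynomial.coeff_mul]
  refine Finset.sum_congr rfl fun z hz => ?_
  rw [Finset.HasAntidiagonal.mem_antidiagonal] at hz
  have hd : z.1.degree + z.2.degree = β.degree := by rw [← hz, map_add]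
  rcases lt_or_ge m z.1.degree with h1 | h1
  · rw [(h.zero_of_gt h1).1, (h.zero_of_gt h1).2]; simp
  rcases lt_or_ge m' z.2.degree with h2 | h2
  · rw [(h'.zero_of_gt h2).1, (h'.zero_of_gt h2).2]; simp
  rw [h.2 _ (by omega), h'.2 _ (by omega)]

lemma IsTopD.sum {ι : Type} (s : Finset ι) (P H : ι → MvPolynomial (Fin n) ℝ) (m : ℕ) (h : ∀ i ∈ s, IsTopD (P i) (H i) m) :
    IsTopD (∑ i ∈ s, P i) (∑ i ∈ s, H i) m := by
  refine ⟨MvPolynomial.IsHomogeneous.sum _ _ _ fun i hi => (h i hi).1, fun β hβ => ?_⟩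
  rw [MvPolynomial.coeff_sum, MvPolynomial.coeff_sum]
  exact Finset.sum_congr rfl fun i hi => (h i hi).2 β hβ

lemma IsTopD.C_mul {P H : MvPolynomial (Fin n) ℝ} {m : ℕ} (h : IsTopD P H m) (a : ℝ) :
    IsTopD (MvPolynomial.C a * P) (MvPolynomial.C a * H) m := by
  refine ⟨h.1.C_mul a, fun β hβ => ?_⟩
  rw [MvPolynomial.coeff_C_mul, MvPolynomial.coeff_C_mul, h.2 β hβ]

lemma IsTopD.prod {ι : Type} (s : Finset ι) (P H : ι → MvPolynomial (Fin n) ℝ) (m : ι → ℕ) (h : ∀ i ∈ s, IsTopD (P i) (H i) (m i)) :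
    IsTopD (∏ i ∈ s, P i) (∏ i ∈ s, H i) (∑ i ∈ s, m i) := by
  classical
  induction s using Finset.induction_on with
  | empty => simp only [Finset.prod_empty, Finset.sum_empty]; exact ⟨MvPolynomial.isHomogeneous_one _ _, fun _ _ => rfl⟩
  | insert a s ha ih =>
    rw [Finset.prod_insert ha, Finset.prod_insert ha, Finset.sum_insert ha]
    exact (h a (Finset.mem_insert_self a s)).mul (ih fun i hi => h i (Finset.mem_insert_of_mem hi))

lemma isTop_low {P : MvPolynomial (Fin n) ℝ} {i m : ℕ} (h : P.IsHomogeneous i) (him : i < m) : IsTopD P 0 m := by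
  refine ⟨MvPolynomial.isHomogeneous_zero _ _ _, fun β hβ => ?_⟩
  rw [h.coeff_eq_zero (by omega)]; simp

lemma isTop_hR (k : Fin n) (j : ℕ) : IsTopD (Polynomial.aeval (MvPolynomial.X k : MvPolynomial (Fin n) ℝ) (hR j)) (MvPolynomial.X k ^ j) j := by
  rw [Polynomial.aeval_eq_sum_range, hR_natDegree, Finset.sum_range_succ]
  have h1 : (hR j).coeff j = 1 := by
    have := hR_monic j; rw [Polynomial.Monic, Polynomial.leadingCoeff, hR_natDegree] at this; exact this
  rw [h1, one_smul]
  have hX : ∀ i, (MvPolynomial.X k ^ i : MvPolynomial (Fin n) ℝ).IsHomogeneous i := fun i => MvPolynomial.isHomogeneous_X_pow k i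
  have h2 : IsTopD (∑ i ∈ Finset.range j, (hR j).coeff i • (MvPolynomial.X k ^ i : MvPolynomial (Fin n) ℝ)) (∑ i ∈ Finset.range j, 0) j := by
    refine IsTopD.sum _ _ _ _ fun i hi => ?_
    rw [MvPolynomial.smul_eq_C_mul]
    exact isTop_low ((hX i).C_mul _) (Finset.mem_range.mp hi)
  refine ⟨hX j, fun β hβ => ?_⟩
  rw [MvPolynomial.coeff_add, h2.2 β hβ]; simp

lemma isTop_HeP (α : Fin n →₀ ℕ) : IsTopD (HeP α) (MvPolynomial.monomial α 1) α.degree := by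
  have := IsTopD.prod Finset.univ _ _ _ (fun k _ => isTop_hR k (α k))
  rw [Finsupp.degree_eq_sum]
  convert this using 1
  · rfl
  rw [MvPolynomial.monomial_eq, Finsupp.prod_fintype _ _ (by simp)]; simp

variable {κ : Type} [Fintype κ] [DecidableEq κ]
lemma isTop_Wick (τ : (κ → Fin n) → ℝ) : IsTopD (Wick τ) (hom τ) (Fintype.card κ) := by
  unfold Wick hom
  refine IsTopD.sum _ _ _ _ fun w _ => ?_
  have := (isTop_HeP (typ w)).C_mul (τ w)
  rw [typ_degree, MvPolynomial.C_mul_monomial, mul_one] at this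
  exact this

lemma IsTopD.le {P H : MvPolynomial (Fin n) ℝ} {m : ℕ} (h : IsTopD P H m) : P.totalDegree ≤ m := by
  rw [MvPolynomial.totalDegree]
  refine Finset.sup_le fun β hβ => ?_
  by_contra hcon
  push Not at hcon
  exact (MvPolynomial.mem_support_iff.mp hβ) (h.zero_of_gt hcon).1

lemma IsTopD.eq {P H : MvPolynomial (Fin n) ℝ} {m : ℕ} (h : IsTopD P H m) (hH : H ≠ 0) : P.totalDegree = m := by
  refine le_antisymm h.le ?_
  obtain ⟨β, hβ⟩ := MvPolynomial.ne_zero_iff.mp hH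
  have hd : β.degree = m := by
    by_contra hcon; exact hβ (h.1.coeff_eq_zero hcon)
  rw [← hd]
  refine MvPolynomial.le_totalDegree (MvPolynomial.mem_support_iff.mpr ?_)
  rw [h.2 β hd.ge]; exact hβ

/-- flatten the output slot into the word -/
def fl (t : (κ → Fin n) × Fin n → ℝ) : (Option κ → Fin n) → ℝ := fun w => t (fun s => w (some s), w none)

lemma nrm_fl (t : (κ → Fin n) × Fin n → ℝ) : nrm (fl t) = nrm t :=
  nrm_comp_equiv ((oconsE κ (Fin n)).symm.trans (Equiv.prodComm _ _)) t

lemma hom_fl (t : (κ → Fin n) × Fin n → ℝ) : hom (fl t) = ∑ i : κ → Fin n, ∑ j, MvPolynomial.monomial (typ i + Finsupp.single j 1) (t (i, j)) := by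
  rw [hom, ← Equiv.sum_comp (oconsE κ (Fin n)), Fintype.sum_prod_type, Finset.sum_comm]
  refine Finset.sum_congr rfl fun i _ => Finset.sum_congr rfl fun j _ => ?_
  have e : (oconsE κ (Fin n)) (j, i) = ocons j i := rfl
  rw [e, typ_ocons]; rfl

lemma hom_fl_sub (t t' : (κ → Fin n) × Fin n → ℝ) : hom (fl (t - t')) = hom (fl t) - hom (fl t') := by
  simp [hom_fl, Finset.sum_sub_distrib]
lemma hom_fl_add (t t' : (κ → Fin n) × Fin n → ℝ) : hom (fl (t + t')) = hom (fl t) + hom (fl t') := by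
  simp [hom_fl, Finset.sum_add_distrib]
lemma hom_fl_zero : hom (fl (0 : (κ → Fin n) × Fin n → ℝ)) = 0 := by
  simp [hom_fl]
lemma hom_fl_smul (a : ℝ) (t : (κ → Fin n) × Fin n → ℝ) : hom (fl (a • t)) = MvPolynomial.C a * hom (fl t) := by
  simp [hom_fl, Finset.mul_sum, MvPolynomial.C_mul_monomial]

variable {κ1 κ2 : Type} [Fintype κ1] [DecidableEq κ1] [Fintype κ2] [DecidableEq κ2]

lemma typ_split (e : κ1 ⊕ κ2 ≃ κ) (i : κ → Fin n) :
    typ i = typ (fun a => i (e (Sum.inl a))) + typ (fun b => i (e (Sum.inr b))) := by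
  unfold typ; rw [← Equiv.sum_comp e, Fintype.sum_sum_type]

lemma hom_prod (e : κ1 ⊕ κ2 ≃ κ) {t : (κ → Fin n) × Fin n → ℝ} {u : (κ1 → Fin n) × Unit → ℝ} {v : (κ2 → Fin n) × Fin n → ℝ}
    (h : ∀ i j, t (i, j) = u (fun a => i (e (Sum.inl a)), ()) * v (fun b => i (e (Sum.inr b)), j)) :
    hom (fl t) = hom (fun w => u (w, ())) * hom (fl v) := by
  rw [hom_fl, hom_fl, hom, Finset.sum_mul_sum, ← Equiv.sum_comp (splitE (Fin n) e).symm, Fintype.sum_prod_type]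
  refine Finset.sum_congr rfl fun z1 _ => Finset.sum_congr rfl fun z2 _ => ?_
  rw [Finset.mul_sum]
  refine Finset.sum_congr rfl fun j _ => ?_
  rw [h, typ_split e, MvPolynomial.monomial_mul]
  simp only [splitE, Equiv.coe_fn_symm_mk, Equiv.symm_apply_apply, Sum.elim_inl, Sum.elim_inr, add_assoc]

/-- derivative tensor -/
noncomputable def Tq (q : MvPolynomial (Fin n) ℝ) (w : κ → Fin n) : ℝ := fct (typ w) * q.coeff (typ w)

/-- derivative tensor of the gradient -/
noncomputable def Tt (κ : Type) [Fintype κ] (p : MvPolynomial (Fin n) ℝ) (z : (κ → Fin n) × Fin n) : ℝ :=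
  fct (typ z.1 + Finsupp.single z.2 1) * p.coeff (typ z.1 + Finsupp.single z.2 1)

lemma Tq_pderiv (q : MvPolynomial (Fin n) ℝ) (k : Fin n) (w : κ → Fin n) : Tq (MvPolynomial.pderiv k q) w = Tq q (ocons k w) := by
  simp only [Tq, typ_ocons, fct_add_single, MvPolynomial.coeff_pderiv]; ring

lemma Tt_eq (p : MvPolynomial (Fin n) ℝ) (i : κ → Fin n) (j : Fin n) : Tt κ p (i, j) = Tq (MvPolynomial.pderiv j p) i := by
  rw [Tq_pderiv, Tq, typ_ocons]; rfl

lemma fl_Tt (p : MvPolynomial (Fin n) ℝ) : fl (Tt κ p) = Tq p := by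
  funext w
  have : w = ocons (w none) (fun s => w (some s)) := by funext o; cases o <;> rfl
  conv_rhs => rw [this]
  rw [Tq, typ_ocons]; rfl

lemma coeff_hom_Tq (p : MvPolynomial (Fin n) ℝ) (α : Fin n →₀ ℕ) (h : α.degree = Fintype.card κ) :
    (hom (Tq p : (κ → Fin n) → ℝ)).coeff α = (Fintype.card κ).factorial * p.coeff α := by
  rw [coeff_hom, ← count_words κ n α h, Finset.sum_mul]
  refine Finset.sum_congr rfl fun w _ => ?_
  split_ifs with hw
  · rw [Tq, hw]
  · simp

lemma nrm_Tq_sq (p : MvPolynomial (Fin n) ℝ) (h : p.totalDegree ≤ Fintype.card κ) :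
    nrm (Tq p : (κ → Fin n) → ℝ) ^ 2 = (Fintype.card κ).factorial * harmonicNorm p (Fintype.card κ) ^ 2 := by
  rw [harmonicNorm_sq p _ h, nrm_sq, ← sum_typ_tuple, Finset.mul_sum]
  refine Finset.sum_congr rfl fun a ha => ?_
  rw [Finset.Nat.mem_antidiagonalTuple] at ha
  rw [← count_words κ n (fs a) (by rw [fs_degree, ha]), Finset.sum_mul]
  refine Finset.sum_congr rfl fun w _ => ?_
  split_ifs with hw
  · rw [Tq, hw]; ring
  · simp
end top

section polpol
lemma eval_line_deriv {n : ℕ} (q : MvPolynomial (Fin n) ℝ) (y v : Fin n → ℝ) (t : ℝ) :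
    HasDerivAt (fun t : ℝ => MvPolynomial.eval (y + t • v) q) (∑ k, v k * MvPolynomial.eval (y + t • v) (MvPolynomial.pderiv k q)) t := by
  induction q using MvPolynomial.induction_on with
  | C a => simpa using hasDerivAt_const t a
  | add p q hp hq =>
    simp only [map_add, mul_add, Finset.sum_add_distrib]
    exact hp.add hq
  | mul_X p j hp =>
    have hx : HasDerivAt (fun t : ℝ => (y + t • v) j) (v j) t := by
      have : HasDerivAt (fun t : ℝ => y j + t * v j) (1 * v j) t := ((hasDerivAt_id t).mul_const (v j)).const_add (y j)
      simpa using this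
    have := hp.fun_mul hx
    have e : (∑ k, v k * MvPolynomial.eval (y + t • v) (MvPolynomial.pderiv k (p * MvPolynomial.X j))) =
        (∑ k, v k * MvPolynomial.eval (y + t • v) (MvPolynomial.pderiv k p)) * (y + t • v) j + MvPolynomial.eval (y + t • v) p * v j := by
      simp only [Derivation.leibniz, smul_eq_mul, map_add, map_mul, MvPolynomial.eval_X, MvPolynomial.pderiv_X, mul_add, Finset.sum_add_distrib, Finset.sum_mul]
      rw [add_comm]
      congr 1
      · exact Finset.sum_congr rfl fun _ _ => by ring
      · rw [Finset.sum_eq_single j]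
        · simp; ring
        · intro b _ hb; simp [Pi.single_apply, hb.symm]
        · simp
    rw [e]
    simpa using this

theorem polarize (κ : Type) [Fintype κ] [DecidableEq κ] : ∀ (n : ℕ) (q : MvPolynomial (Fin n) ℝ) (y : Fin n → ℝ) (v : κ → Fin n → ℝ),
    (∀ β : Fin n →₀ ℕ, Fintype.card κ < β.degree → q.coeff β = 0) →
    ∑ ω : κ → Bool, (∏ s, sg (ω s)) * MvPolynomial.eval (y + ∑ s, sg (ω s) • v s) q =
      2 ^ Fintype.card κ * ∑ i : κ → Fin n, Tq q i * ∏ s, v s (i s) := by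
  refine slot_induction (fun κ => ∀ (n : ℕ) (q : MvPolynomial (Fin n) ℝ) (y : Fin n → ℝ) (v : κ → Fin n → ℝ),
    (∀ β : Fin n →₀ ℕ, Fintype.card κ < β.degree → q.coeff β = 0) →
    ∑ ω : κ → Bool, (∏ s, sg (ω s)) * MvPolynomial.eval (y + ∑ s, sg (ω s) • v s) q =
      2 ^ Fintype.card κ * ∑ i : κ → Fin n, Tq q i * ∏ s, v s (i s)) ?_ ?_ ?_ κ
  · intro κ κ' _ _ _ _ e ih n q y v h
    rw [Fintype.card_congr e.symm] at h ⊢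
    have := ih n q y (fun s => v (e s)) h
    rw [← Equiv.sum_comp (Equiv.arrowCongr e (Equiv.refl (Fin n))), ← Equiv.sum_comp (Equiv.arrowCongr e (Equiv.refl Bool))]
    have h1 : ∀ w : κ → Fin n, Tq q ((Equiv.arrowCongr e (Equiv.refl (Fin n))) w) = Tq q w := by
      intro w
      have : typ ((Equiv.arrowCongr e (Equiv.refl (Fin n))) w) = typ w := typ_equiv e.symm w
      rw [Tq, Tq, this]
    convert this using 1
    · refine Finset.sum_congr rfl fun ω _ => ?_
      rw [← Equiv.prod_comp e, ← Equiv.sum_comp e]; simp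
    · congr 1
      refine Finset.sum_congr rfl fun i _ => ?_
      rw [h1, ← Equiv.prod_comp e]; simp
  · intro n q y v h
    have hq : q = MvPolynomial.C (q.coeff 0) := by
      ext β
      rw [MvPolynomial.coeff_C]
      split_ifs with hb
      · rw [hb]
      · refine h β ?_
        simp only [Fintype.card_eq_zero]
        rw [Nat.pos_iff_ne_zero, Ne, Finsupp.degree_eq_zero_iff]
        exact fun h => hb h.symm
    simp [Tq, typ, fct]
    conv_lhs => rw [hq]
    simp
  · intro κ _ _ ih n q y v h
    have ih' : ∀ (k : Fin n) (y' : Fin n → ℝ), ∑ ω : κ → Bool, (∏ s, sg (ω s)) * MvPolynomial.eval (y' + ∑ s, sg (ω s) • v (some s)) (MvPolynomial.pderiv k q) =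
      2 ^ Fintype.card κ * ∑ i : κ → Fin n, Tq q (ocons k i) * ∏ s, v (some s) (i s) := by
      intro k y'
      rw [ih n (MvPolynomial.pderiv k q) y' (fun s => v (some s))]
      · simp only [Tq_pderiv]
      · intro β hβ
        rw [MvPolynomial.coeff_pderiv, h _ (by rw [map_add, Finsupp.degree_single, Fintype.card_option]; omega), zero_mul]
    set c := ∑ k, v none k * (2 ^ Fintype.card κ * ∑ i : κ → Fin n, Tq q (ocons k i) * ∏ s, v (some s) (i s)) with hc
    let g : ℝ → ℝ := fun t => ∑ ω : κ → Bool, (∏ s, sg (ω s)) * MvPolynomial.eval ((y + ∑ s, sg (ω s) • v (some s)) + t • v none) q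
    have hg : ∀ t, HasDerivAt g c t := by
      intro t
      have h1 : HasDerivAt g (∑ ω : κ → Bool, (∏ s, sg (ω s)) * ∑ k, v none k * MvPolynomial.eval ((y + ∑ s, sg (ω s) • v (some s)) + t • v none) (MvPolynomial.pderiv k q)) t := by
        refine HasDerivAt.fun_sum fun ω _ => ?_
        exact (eval_line_deriv q _ _ t).const_mul _
      convert h1 using 1
      simp only [Finset.mul_sum]
      rw [Finset.sum_comm, hc]
      refine Finset.sum_congr rfl fun k _ => ?_
      rw [← ih' k (y + t • v none), Finset.mul_sum]
      refine Finset.sum_congr rfl fun ω _ => ?_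
      rw [add_right_comm]; ring
    have hg2 : ∀ t, HasDerivAt (fun t => g t - c * t) 0 t := by
      intro t
      have := (hg t).fun_sub ((hasDerivAt_id t).const_mul c)
      simpa using this
    have hg3 : g 1 - c * 1 = g (-1) - c * (-1) :=
      is_const_of_deriv_eq_zero (fun t => (hg2 t).differentiableAt) (fun t => (hg2 t).deriv) 1 (-1)
    have e1 : ∑ ω : Option κ → Bool, (∏ s, sg (ω s)) * MvPolynomial.eval (y + ∑ s, sg (ω s) • v s) q = g 1 - g (-1) := by
      rw [sum_ocons, Fintype.sum_bool]
      simp only [Fintype.prod_option, Fintype.sum_option, ocons_none, ocons_some, g, sg]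
      rw [sub_eq_add_neg, ← Finset.sum_neg_distrib]
      congr 1
      · refine Finset.sum_congr rfl fun ω _ => ?_
        simp only [if_true, one_mul]
        congr 2
        simp only [one_smul]
        abel_nf
      · refine Finset.sum_congr rfl fun ω _ => ?_
        simp only [Bool.false_eq_true, if_false, neg_mul, one_mul]
        congr 3
        abel_nf
    rw [e1, sum_ocons, Fintype.card_option, pow_succ]
    have : g 1 - g (-1) = 2 * c := by linarith
    rw [this, hc, Finset.mul_sum, Finset.mul_sum]
    refine Finset.sum_congr rfl fun k _ => ?_
    simp only [Finset.mul_sum, Fintype.prod_option, ocons_none, ocons_some]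
    exact Finset.sum_congr rfl fun i _ => by ring
end polpol

section small
lemma exists_section {E F : Type} [MeasurableSpace E] [MeasurableSpace F] (ν : Measure E) (μ : Measure F) [IsProbabilityMeasure ν] [IsProbabilityMeasure μ]
    {S : Set (E × F)} (hS : MeasurableSet S) {r : ENNReal} (h : r < (ν.prod μ) S) : ∃ y, r < μ {x | (y, x) ∈ S} := by
  by_contra hcon
  push Not at hcon
  have e : (ν.prod μ) S = ∫⁻ y, μ {x | (y, x) ∈ S} ∂ν := Measure.prod_apply hS
  have : ∫⁻ y, μ {x | (y, x) ∈ S} ∂ν ≤ ∫⁻ y, r ∂ν := lintegral_mono hcon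
  rw [lintegral_const, measure_univ, mul_one, ← e] at this
  exact absurd h (not_lt.mpr this)

/-- scaling of Gaussian splitting -/
noncomputable def sca (κ : Type) [Fintype κ] : ℝ := (Real.sqrt (Fintype.card (Option κ)))⁻¹
lemma sca_pos (κ : Type) [Fintype κ] : 0 < sca κ := by
  unfold sca
  have : 0 < Fintype.card (Option κ) := Fintype.card_pos
  positivity
lemma sca_sq (κ : Type) [Fintype κ] : sca κ ^ 2 * Fintype.card (Option κ) = 1 := by
  unfold sca
  have : 0 < Fintype.card (Option κ) := Fintype.card_pos
  rw [inv_pow, Real.sq_sqrt (by positivity)]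
  field_simp

/-- gradient -/
noncomputable def gr {n : ℕ} (p : MvPolynomial (Fin n) ℝ) (x : Fin n → ℝ) (j : Fin n) : ℝ := MvPolynomial.eval x (MvPolynomial.pderiv j p)

lemma measurable_gr {n : ℕ} (p : MvPolynomial (Fin n) ℝ) : Measurable (gr p) :=
  measurable_pi_lambda _ fun j => (MvPolynomial.continuous_eval _).measurable

lemma alt_gr {κ : Type} [Fintype κ] [DecidableEq κ] {n : ℕ} (p : MvPolynomial (Fin n) ℝ) (hp : p.totalDegree ≤ Fintype.card κ + 1)
    (y : Fin n → ℝ) (v : κ → Fin n → ℝ) (b : ℝ) (j : Fin n) :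
    ∑ ω : κ → Bool, (∏ s, sg (ω s)) * gr p (y + ∑ s, sg (ω s) • (b • v s)) j = 2 ^ Fintype.card κ * (b ^ Fintype.card κ * ev (Tt κ p) v j) := by
  simp only [gr]
  rw [polarize κ n (MvPolynomial.pderiv j p) y (fun s => b • v s)]
  · congr 1
    rw [ev, Finset.mul_sum]
    refine Finset.sum_congr rfl fun i _ => ?_
    rw [Tt_eq]
    simp only [Pi.smul_apply, smul_eq_mul, Finset.prod_mul_distrib, Finset.prod_const, Finset.card_univ]
    ring
  · intro β hβ
    rw [MvPolynomial.coeff_pderiv]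
    have : MvPolynomial.coeff (β + Finsupp.single j 1) p = 0 := by
      by_contra hcon
      have := MvPolynomial.le_totalDegree (MvPolynomial.mem_support_iff.mpr hcon)
      have h2 : (β + Finsupp.single j 1).degree ≤ p.totalDegree := this
      rw [map_add, Finsupp.degree_single] at h2
      omega
    rw [this, zero_mul]

theorem small_ball_T {κ : Type} [Fintype κ] [DecidableEq κ] {n : ℕ} (p : MvPolynomial (Fin n) ℝ) (hp : p.totalDegree ≤ Fintype.card κ + 1)
    {ε δ : ℝ} (hδ : 0 < δ) (h : ENNReal.ofReal δ < gam (Fin n) {x | nrm (gr p x) < ε}) :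
    δ ^ (2 ^ Fintype.card κ) / 2 ≤ (gamS κ (Fin n)).real {x | (sca κ * ra) ^ Fintype.card κ * nrm (ev (Tt κ p) x) ≤ ε} := by
  have hS : MeasurableSet {x | nrm (gr p x) < ε} := measurableSet_lt (measurable_nrm.comp (measurable_gr p)) measurable_const
  have hm : Measurable (fun x : Option κ → Fin n → ℝ => sca κ • ∑ s, x s) := by fun_prop
  rw [← gamS_map_sum (κ := Option κ) (sca κ) (sca_sq κ), Measure.map_apply hm hS] at h
  have hS2 := hm hS
  have hmp := (mp_ocons (gam (Fin n)) (κ := κ))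
  rw [← hmp.measure_preimage hS2.nullMeasurableSet] at h
  obtain ⟨y, hy⟩ := exists_section _ _ (hmp.measurable hS2) h
  set G : Set (κ → Fin n → ℝ) := {x | (y, x) ∈ (fun z : (Fin n → ℝ) × (κ → Fin n → ℝ) => ocons z.1 z.2) ⁻¹' ((fun x : Option κ → Fin n → ℝ => sca κ • ∑ s, x s) ⁻¹' {x | nrm (gr p x) < ε})} with hG
  have hGm : MeasurableSet G := measurable_prodMk_left (hmp.measurable hS2)
  have hGδ : δ ≤ (gamS κ (Fin n)).real G := by
    have := ENNReal.toReal_mono (measure_ne_top _ _) hy.le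
    rwa [ENNReal.toReal_ofReal hδ.le] at this
  obtain ⟨c, -, hc⟩ := cube_choice hGm MeasurableSet.univ hδ hGδ (by simp; positivity)
  refine hc.trans (measureReal_mono (fun x hx => ?_))
  have hb : 0 < sca κ * ra := mul_pos (sca_pos κ) ra_pos
  have h1 := nrm_alt_le (fun ω => gr p (sca κ • (y + ∑ s, ra • c s) + ∑ s, sg (ω s) • ((sca κ * ra) • x s))) (B := ε) (fun ω => by
    have := hx ω
    simp only [hG, Set.mem_setOf_eq, Set.mem_preimage, Fintype.sum_option, ocons_none, ocons_some, vert] at this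
    have e0 : sca κ • (y + ∑ s, ra • c s) + ∑ s, sg (ω s) • ((sca κ * ra) • x s) = sca κ • (y + ∑ i, (ra • c i + (sg (ω i) * ra) • x i)) := by
      rw [Finset.sum_add_distrib, ← add_assoc, smul_add (sca κ) (y + ∑ s, ra • c s), Finset.smul_sum (s := Finset.univ) (f := fun s => (sg (ω s) * ra) • x s)]
      congr 1
      refine Finset.sum_congr rfl fun s _ => ?_
      simp only [smul_smul]; congr 1; ring
    simp only [e0]
    exact this.le)
  have e : (fun k => ∑ ω : κ → Bool, (∏ s, sg (ω s)) * gr p (sca κ • (y + ∑ s, ra • c s) + ∑ s, sg (ω s) • ((sca κ * ra) • x s)) k) =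
      ((2:ℝ) ^ Fintype.card κ * (sca κ * ra) ^ Fintype.card κ) • ev (Tt κ p) x := by
    funext j; rw [alt_gr p hp]; simp [mul_assoc]
  rw [e, nrm_smul, abs_of_pos (by positivity), mul_assoc] at h1
  exact le_of_mul_le_mul_left h1 (by positivity)
end small

section final
lemma gaussL2_nonneg {n : ℕ} (p : MvPolynomial (Fin n) ℝ) : 0 ≤ gaussL2 p := Real.sqrt_nonneg _
lemma harmonicNorm_nonneg {n : ℕ} (p : MvPolynomial (Fin n) ℝ) (d : ℕ) : 0 ≤ harmonicNorm p d := Real.sqrt_nonneg _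

lemma gaussL2_C_mul {n : ℕ} (A : ℝ) (p : MvPolynomial (Fin n) ℝ) : gaussL2 (MvPolynomial.C A * p) = |A| * gaussL2 p := by
  have h : gaussL2 (MvPolynomial.C A * p) ^ 2 = (|A| * gaussL2 p) ^ 2 := by
    rw [mul_pow, gaussL2_sq, gaussL2_sq, sq_abs, ← integral_const_mul]
    refine integral_congr_ae (ae_of_all _ fun x => ?_)
    simp [mul_pow]
  exact (pow_left_inj₀ (gaussL2_nonneg _) (mul_nonneg (abs_nonneg _) (gaussL2_nonneg _)) two_ne_zero).mp h

lemma le_fact_of_sq {x y : ℝ} {k : ℕ} (hx : 0 ≤ x) (hy : 0 ≤ y) (h : x ^ 2 ≤ k.factorial * y ^ 2) : x ≤ k.factorial * y := by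
  have h1 : (1:ℝ) ≤ k.factorial := by exact_mod_cast Nat.succ_le_of_lt k.factorial_pos
  refine (pow_le_pow_iff_left₀ hx (by positivity) two_ne_zero).mp (h.trans ?_)
  rw [mul_pow]
  refine mul_le_mul_of_nonneg_right ?_ (by positivity)
  nlinarith

lemma wick_le {κ : Type} [Fintype κ] [DecidableEq κ] {n : ℕ} (τ : (κ → Fin n) → ℝ) : gaussL2 (Wick τ) ≤ (Fintype.card κ).factorial * nrm τ :=
  le_fact_of_sq (gaussL2_nonneg _) (nrm_nonneg _) (wick_bound τ)

lemma prod_to_poly {κ : Type} [Fintype κ] [DecidableEq κ] {n d : ℕ} (hκ : Fintype.card κ + 1 = d) (s : (κ → Fin n) × Fin n → ℝ)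
    (h : IsProd s) {A : ℝ} (hA : 0 < A) : hom (fl s) = 0 ∨ ∃ a b : MvPolynomial (Fin n) ℝ,
      (a.totalDegree < d ∧ b.totalDegree < d ∧ a.totalDegree + b.totalDegree = d) ∧
      gaussL2 a * gaussL2 b ≤ A * d.factorial * nrm s ∧ IsTopD (a * b) (MvPolynomial.C A * hom (fl s)) d := by
  obtain ⟨κ1, κ2, _, _, _, _, e, hn, u, v, huv⟩ := h
  by_cases h0 : hom (fl s) = 0
  · exact Or.inl h0
  refine Or.inr ?_
  have hs := hom_prod e huv
  rw [hs] at h0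
  have hu : hom (fun w => u (w, ())) ≠ 0 := left_ne_zero_of_mul h0
  have hv : hom (fl v) ≠ 0 := right_ne_zero_of_mul h0
  have hcard : Fintype.card κ1 + Fintype.card κ2 = Fintype.card κ := by
    rw [← Fintype.card_sum, Fintype.card_congr e]
  have hpos : 0 < Fintype.card κ1 := Fintype.card_pos
  have hu' : MvPolynomial.C A * hom (fun w => u (w, ())) ≠ 0 := mul_ne_zero (by simpa using hA.ne') hu
  have ta := (isTop_Wick (fun w => u (w, ()))).C_mul A
  have tb := isTop_Wick (fl v)
  have da := ta.eq hu'
  have db := tb.eq hv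
  rw [Fintype.card_option] at db
  have hd : Fintype.card κ1 + Fintype.card (Option κ2) = d := by rw [Fintype.card_option]; omega
  refine ⟨MvPolynomial.C A * Wick (fun w => u (w, ())), Wick (fl v), ⟨by omega, by omega, by omega⟩, ?_, ?_⟩
  · have h1 := wick_le (fun w => u (w, ()))
    have h2 := wick_le (fl v)
    have hnu : nrm (fun w => u (w, ())) = nrm u := nrm_comp_equiv (Equiv.prodUnique (κ1 → Fin n) Unit).symm u
    rw [nrm_fl] at h2
    rw [hnu] at h1
    rw [gaussL2_C_mul, abs_of_pos hA, isProd_nrm e huv]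
    have h3 : ((Fintype.card κ1).factorial : ℝ) * (Fintype.card (Option κ2)).factorial ≤ d.factorial := by
      rw [← hd]
      exact_mod_cast Nat.le_of_dvd (Nat.factorial_pos _) (Nat.factorial_mul_factorial_dvd_factorial_add _ _)
    have n1 := nrm_nonneg u
    have n2 := nrm_nonneg v
    calc A * gaussL2 (Wick fun w => u (w, ())) * gaussL2 (Wick (fl v))
        ≤ A * ((Fintype.card κ1).factorial * nrm u) * ((Fintype.card (Option κ2)).factorial * nrm v) := by
          gcongr
          exact gaussL2_nonneg _
      _ = A * (((Fintype.card κ1).factorial : ℝ) * (Fintype.card (Option κ2)).factorial) * (nrm u * nrm v) := by ring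
      _ ≤ _ := by gcongr
  · have := ta.mul tb
    rw [hd, mul_assoc, mul_assoc] at this
    rw [hs, mul_assoc]; exact this

lemma list_to_poly {κ : Type} [Fintype κ] [DecidableEq κ] {n d : ℕ} (hκ : Fintype.card κ + 1 = d) {A B : ℝ} (hA : 0 < A)
    (l : List ((κ → Fin n) × Fin n → ℝ)) (h : ∀ s ∈ l, IsProd s ∧ nrm s ≤ B) :
    ∃ (k : ℕ) (a b : Fin k → MvPolynomial (Fin n) ℝ), k ≤ l.length ∧
      (∀ i, (a i).totalDegree < d ∧ (b i).totalDegree < d ∧ (a i).totalDegree + (b i).totalDegree = d) ∧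
      (∀ i, gaussL2 (a i) * gaussL2 (b i) ≤ A * d.factorial * B) ∧
      IsTopD (∑ i, a i * b i) (MvPolynomial.C A * hom (fl l.sum)) d := by
  induction l with
  | nil =>
    refine ⟨0, Fin.elim0, Fin.elim0, le_rfl, fun i => i.elim0, fun i => i.elim0, ?_⟩
    rw [List.sum_nil, hom_fl_zero, mul_zero]
    exact ⟨MvPolynomial.isHomogeneous_zero _ _ _, fun _ _ => by simp⟩
  | cons s l ih =>
    obtain ⟨k, a, b, hk, h1, h2, h3⟩ := ih fun s' hs' => h s' (List.mem_cons_of_mem _ hs')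
    obtain ⟨hs, hsB⟩ := h s List.mem_cons_self
    rcases prod_to_poly hκ s hs hA with h0 | ⟨a0, b0, hd, hg, ht⟩
    · refine ⟨k, a, b, by simp; omega, h1, h2, ?_⟩
      rw [List.sum_cons, hom_fl_add, h0, zero_add]; exact h3
    · refine ⟨k + 1, Fin.cons a0 a, Fin.cons b0 b, by simpa using hk, ?_, ?_, ?_⟩
      · intro i; refine Fin.cases ?_ (fun i => ?_) i
        · simpa using hd
        · simpa using h1 i
      · intro i; refine Fin.cases ?_ (fun i => ?_) i
        · simp only [Fin.cons_zero]; exact hg.trans (by gcongr)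
        · simpa using h2 i
      · rw [Fin.sum_univ_succ, List.sum_cons, hom_fl_add, mul_add]
        simp only [Fin.cons_zero, Fin.cons_succ]
        refine ⟨ht.1.add h3.1, fun β hβ => ?_⟩
        rw [MvPolynomial.coeff_add, MvPolynomial.coeff_add, ht.2 β hβ, h3.2 β hβ]

lemma harm_rest {κ : Type} [Fintype κ] [DecidableEq κ] {n d : ℕ} (hκ : Fintype.card κ + 1 = d) (p Q : MvPolynomial (Fin n) ℝ)
    (hp : p.totalDegree ≤ d) {K : ℝ} (hK : 0 < K) (L : (κ → Fin n) × Fin n → ℝ)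
    (hQ : IsTopD Q (MvPolynomial.C (K / d.factorial) * hom (fl L)) d) :
    harmonicNorm (p - Q) d ≤ K * nrm ((K⁻¹ • Tt κ p) - L) := by
  have hd : Fintype.card (Option κ) = d := by rw [Fintype.card_option]; exact hκ
  have hdeg : (p - Q).totalDegree ≤ d := (MvPolynomial.totalDegree_sub _ _).trans (max_le hp hQ.le)
  have hf : (0:ℝ) < d.factorial := by exact_mod_cast d.factorial_pos
  set A := K / d.factorial with hA
  have hAp : 0 < A := by positivity
  have hc : ∀ α : Fin n →₀ ℕ, α.degree = d → (p - Q).coeff α = A * (hom (fl ((K⁻¹ • Tt κ p) - L))).coeff α := by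
    intro α hα
    rw [MvPolynomial.coeff_sub, hQ.2 α hα.ge, hom_fl_sub, hom_fl_smul, MvPolynomial.coeff_sub, MvPolynomial.coeff_C_mul, MvPolynomial.coeff_C_mul,
      fl_Tt, coeff_hom_Tq p α (by rw [hα, hd]), hd, hA]
    field_simp
  have hb := hom_bound (fl ((K⁻¹ • Tt κ p) - L))
  rw [hd, nrm_fl] at hb
  have h2 : harmonicNorm (p - Q) d ^ 2 ≤ d.factorial * (A * nrm ((K⁻¹ • Tt κ p) - L)) ^ 2 := by
    rw [harmonicNorm_sq _ _ hdeg]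
    have : ∑ a ∈ Finset.Nat.antidiagonalTuple n d, fct (fs a) * (p - Q).coeff (fs a) ^ 2 =
        A ^ 2 * ∑ a ∈ Finset.Nat.antidiagonalTuple n d, fct (fs a) * (hom (fl ((K⁻¹ • Tt κ p) - L))).coeff (fs a) ^ 2 := by
      rw [Finset.mul_sum]
      refine Finset.sum_congr rfl fun a ha => ?_
      rw [Finset.Nat.mem_antidiagonalTuple] at ha
      rw [hc _ (by rw [fs_degree, ha])]; ring
    rw [this]
    calc _ ≤ A ^ 2 * (d.factorial * nrm ((K⁻¹ • Tt κ p) - L) ^ 2) := by gcongr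
      _ = _ := by ring
  have h3 := le_fact_of_sq (harmonicNorm_nonneg _ _) (mul_nonneg hAp.le (nrm_nonneg _)) h2
  refine h3.trans (le_of_eq ?_)
  rw [hA]; field_simp

theorem decomposition_aux (d : ℕ) (hd : 0 < d) (c N : ℝ) (hc : 0 < c) (hN : 0 < N) :
    ∃ (k₀ : ℕ) (C : ℝ), 0 < C ∧
      ∀ (ε : ℝ), 0 < ε → ε < 1 / 2 →
        ∀ (n : ℕ) (p : MvPolynomial (Fin n) ℝ), p.totalDegree ≤ d → gaussL2 p ≤ 1 →
          ENNReal.ofReal (ε ^ N) < gam (Fin n) {x | nrm (gr p x) < ε} →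
          ∃ (k : ℕ) (a b : Fin k → MvPolynomial (Fin n) ℝ), k ≤ k₀ ∧
            (∀ i, (a i).totalDegree < d ∧ (b i).totalDegree < d ∧
              (a i).totalDegree + (b i).totalDegree = d) ∧
            (∀ i, gaussL2 (a i) * gaussL2 (b i) ≤ C * ε ^ (-c) * harmonicNorm p d) ∧
            harmonicNorm (p - ∑ i, a i * b i) d < C * ε ^ (1 - c) := by
  obtain ⟨m, rfl⟩ : ∃ m, d = m + 1 := ⟨d - 1, by omega⟩
  obtain ⟨κ, _, _, hm, hst⟩ := strong_all m
  have hκ : Fintype.card κ + 1 = m + 1 := by rw [hm]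
  have hN' : 0 < N * 2 ^ m + 1 := by positivity
  obtain ⟨k0, hk0⟩ := hst c (N * 2 ^ m + 1) hc hN'
  obtain ⟨ε0, hε0, hε0'⟩ := mem_nhdsGT_iff_exists_Ioo_subset.mp hk0
  rw [Set.mem_Ioi] at hε0
  set K0 := (sca κ * ra) ^ m with hK0
  have hK0p : 0 < K0 := pow_pos (mul_pos (sca_pos κ) ra_pos) _
  have hf1 : (1:ℝ) ≤ (m + 1).factorial := by exact_mod_cast Nat.succ_le_of_lt (m + 1).factorial_pos
  set F : ℝ := ((m + 1).factorial : ℝ) with hF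
  set K := F + K0⁻¹ with hK
  have hKp : 0 < K := by positivity
  set m0 := min 1 (ε0 ^ (1 - c)) with hm0
  have hm0p : 0 < m0 := lt_min one_pos (Real.rpow_pos_of_pos hε0 _)
  have hCp : 0 < K + 1 + F + 2 / m0 := by positivity
  refine ⟨k0, K + 1 + F + 2 / m0, hCp, fun ε hε hε2 n p hp hp1 hS => ?_⟩
  have hh1 : harmonicNorm p (m + 1) ≤ 1 := (bessel p _).trans hp1
  have hTn : nrm (Tt κ p) ≤ F * harmonicNorm p (m + 1) := by
    have := nrm_Tq_sq (κ := Option κ) p (by rw [Fintype.card_option, hκ]; exact hp)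
    rw [← fl_Tt, nrm_fl, Fintype.card_option, hκ] at this
    exact le_fact_of_sq (nrm_nonneg _) (harmonicNorm_nonneg _ _) this.le
  rcases lt_or_ge ε ε0 with hlt | hge
  · have hsmall := small_ball_T (κ := κ) p (by rw [hκ]; exact hp) (Real.rpow_pos_of_pos hε N) hS
    rw [hm] at hsmall
    have hnT : nrm (K⁻¹ • Tt κ p) ≤ 1 := by
      rw [nrm_smul, abs_of_pos (inv_pos.mpr hKp), inv_mul_le_iff₀ hKp, mul_one]
      calc _ ≤ F * harmonicNorm p (m + 1) := hTn
        _ ≤ F * 1 := by gcongr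
        _ ≤ K := by rw [hK, mul_one]; linarith [inv_pos.mpr hK0p]
    have hball : ε ^ (N * 2 ^ m + 1) ≤ (gamS κ (Fin n)).real {x | nrm (ev (K⁻¹ • Tt κ p) x) ≤ ε} := by
      calc ε ^ (N * 2 ^ m + 1) = (ε ^ N) ^ (2 ^ m) * ε := by
            rw [Real.rpow_add hε, Real.rpow_one, Real.rpow_mul hε.le, ← Real.rpow_natCast (ε ^ N) (2 ^ m)]
            push_cast; rfl
        _ ≤ (ε ^ N) ^ (2 ^ m) * (1 / 2) := by
            have := Real.rpow_pos_of_pos hε N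
            gcongr
        _ = (ε ^ N) ^ (2 ^ m) / 2 := by ring
        _ ≤ _ := hsmall
        _ ≤ _ := by
          refine measureReal_mono (fun x hx => ?_)
          have hx' : K0 * nrm (ev (Tt κ p) x) ≤ ε := hx
          change nrm (ev (K⁻¹ • Tt κ p) x) ≤ ε
          rw [ev_smul, nrm_smul, abs_of_pos (inv_pos.mpr hKp), inv_mul_le_iff₀ hKp]
          have : nrm (ev (Tt κ p) x) ≤ K0⁻¹ * ε := by
            rw [le_inv_mul_iff₀ hK0p]; exact hx'
          refine this.trans ?_
          gcongr
          rw [hK]; linarith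
    obtain ⟨l, hl, hls, hlr⟩ := hε0' ⟨hε, hlt⟩ (Fin n) (Fin n) (K⁻¹ • Tt κ p) hnT hball
    have hA : 0 < K / ((m + 1).factorial : ℝ) := by positivity
    obtain ⟨k, a, b, hk, h1, h2, h3⟩ := list_to_poly hκ hA l hls
    refine ⟨k, a, b, hk.trans hl, h1, fun i => (h2 i).trans ?_, ?_⟩
    · have he := Real.rpow_pos_of_pos hε (-c)
      rw [nrm_smul, abs_of_pos (inv_pos.mpr hKp), ← hF]
      have hF0 : 0 < F := by linarith
      calc K / F * F * (ε ^ (-c) * (K⁻¹ * nrm (Tt κ p))) = ε ^ (-c) * nrm (Tt κ p) := by field_simp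
        _ ≤ ε ^ (-c) * (F * harmonicNorm p (m + 1)) := by gcongr
        _ = F * ε ^ (-c) * harmonicNorm p (m + 1) := by ring
        _ ≤ _ := by
          have := harmonicNorm_nonneg p (m + 1)
          have : 0 < 2 / m0 := by positivity
          gcongr
          linarith
    · have he := Real.rpow_pos_of_pos hε (1 - c)
      refine (harm_rest hκ p _ hp hKp l.sum h3).trans_lt ?_
      calc K * nrm (K⁻¹ • Tt κ p - l.sum) ≤ K * ε ^ (1 - c) := by gcongr
        _ < _ := by
          have : 0 < 2 / m0 := by positivity
          refine mul_lt_mul_of_pos_right ?_ he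
          linarith
  · refine ⟨0, Fin.elim0, Fin.elim0, Nat.zero_le _, fun i => i.elim0, fun i => i.elim0, ?_⟩
    have e : p - ∑ i : Fin 0, (Fin.elim0 i : MvPolynomial (Fin n) ℝ) * Fin.elim0 i = p := by simp
    rw [e]
    have hme : m0 ≤ ε ^ (1 - c) := by
      rcases le_or_gt (1 - c) 0 with h | h
      · exact (min_le_left _ _).trans (Real.one_le_rpow_of_pos_of_le_one_of_nonpos hε (by linarith) h)
      · exact (min_le_right _ _).trans (Real.rpow_le_rpow hε0.le hge h.le)
    have h2 : 2 / m0 * m0 = 2 := by field_simp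
    calc harmonicNorm p (m + 1) ≤ 1 := hh1
      _ < 2 / m0 * m0 := by rw [h2]; norm_num
      _ ≤ (K + 1 + F + 2 / m0) * ε ^ (1 - c) := by
        gcongr
        linarith
end final

/-- **The Decomposition Proposition.**  For every positive integer `d` and reals `c, N > 0`
there exist `k₀ ∈ ℕ` and `C > 0`, depending only on `N, c, d`, such that for every
`0 < ε < 1/2` and every degree-`d` polynomial `p` with `|p|₂ ≤ 1` satisfying
`Pr_X(‖∇p(X)‖₂ < ε) > ε^N`, there exist `k ≤ k₀` and polynomials `a₁, …, a_k, b₁, …, b_k`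
of degree `< d` with `deg aᵢ + deg bᵢ = d`, `|aᵢ|₂·|bᵢ|₂ ≤ C ε^{-c} |p^{[d]}|₂`, and
`|(p - ∑ aᵢ bᵢ)^{[d]}|₂ < C ε^{1-c}`. -/
theorem decomposition_prop (d : ℕ) (hd : 0 < d) (c N : ℝ) (hc : 0 < c) (hN : 0 < N) :
    ∃ (k₀ : ℕ) (C : ℝ), 0 < C ∧
      ∀ (ε : ℝ), 0 < ε → ε < 1 / 2 →
        ∀ (n : ℕ) (p : MvPolynomial (Fin n) ℝ), p.totalDegree ≤ d → gaussL2 p ≤ 1 →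
          ENNReal.ofReal (ε ^ N) <
            stdGaussian n
              {x | Real.sqrt (∑ i, (MvPolynomial.eval x (MvPolynomial.pderiv i p)) ^ 2) < ε} →
          ∃ (k : ℕ) (a b : Fin k → MvPolynomial (Fin n) ℝ), k ≤ k₀ ∧
            (∀ i, (a i).totalDegree < d ∧ (b i).totalDegree < d ∧
              (a i).totalDegree + (b i).totalDegree = d) ∧
            (∀ i, gaussL2 (a i) * gaussL2 (b i) ≤ C * ε ^ (-c) * harmonicNorm p d) ∧
            harmonicNorm (p - ∑ i, a i * b i) d < C * ε ^ (1 - c) := by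
  exact decomposition_aux d hd c N hc hN
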